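/- arXiv:2605.18335 — 5 statements merged into one kernel-verified Lean document; each statement's English description precedes it below -/
import Mathlib

section
/- There exist absolute constants C > 0, D > 0 and ℓ_0 such that the following holds. Let u ≥ ℓ ≥ ℓ_0, let S ⊆ F_2^u have size 2^ℓ, and let h : F_2^u → F_2^ℓ be a uniformly random linear map. Then for every real R > 1 satisfying R ℓ^{1 − 1/R} ≥ D ln ℓ, one has Pr[M(S,h) ≥ R ℓ / log_2 ℓ] ≤ C (ln ℓ)^2 / (R^2 ℓ^{2 − 2/R}). -/
/-- The space of F_2-linear maps from F_2^u to F_2^ℓ. -/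
abbrev Lin (u ℓ : ℕ) := (Fin u → ZMod 2) →ₗ[ZMod 2] (Fin ℓ → ZMod 2)

/-- The maximum load M(S,h) = max_{y ∈ F_2^ℓ} |h^{-1}(y) ∩ S|. -/
def maxLoad (u ℓ : ℕ) (S : Finset (Fin u → ZMod 2)) (h : Lin u ℓ) : ℕ :=
  Finset.univ.sup fun y : Fin ℓ → ZMod 2 => (S.filter fun v => h v = y).card

section Helpers

/-- The potential: the sum over `y` of the product of the `1 + g x (y + h x)`. -/
noncomputable def pot {m : ℕ} {Y : Type} [AddCommGroup Y] [Module (ZMod 2) Y] [Fintype Y]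
    (g : (Fin m → ZMod 2) → Y → ℝ) (h : (Fin m → ZMod 2) →ₗ[ZMod 2] Y) : ℝ :=
  ∑ y, ∏ x, (1 + g x (y + h x))

lemma add_self_zero {X : Type} [AddCommGroup X] [Module (ZMod 2) X] (e : X) : e + e = 0 := by
  have : (2 : ZMod 2) • e = e + e := two_smul _ e
  rw [← this, show (2 : ZMod 2) = 0 from rfl, zero_smul]

/-- A direction with small correlation. -/
lemma exists_dir {X : Type} [AddCommGroup X] [Fintype X] [DecidableEq X] [Nontrivial X]
    (a : X → ℝ) :
    ∃ e : X, e ≠ 0 ∧ (Fintype.card X : ℝ) * ∑ x, a x * a (x + e) ≤ (∑ x, a x) ^ 2 := by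
  by_contra hcon
  push Not at hcon
  have hn : (1 : ℝ) < Fintype.card X := by exact_mod_cast Fintype.one_lt_card
  have htot : ∑ e, ∑ x, a x * a (x + e) = (∑ x, a x) ^ 2 := by
    rw [Finset.sum_comm, sq, Finset.sum_mul]
    refine Finset.sum_congr rfl fun x _ => ?_
    rw [← Finset.mul_sum]
    congr 1
    exact Fintype.sum_equiv (Equiv.addLeft x) _ _ (fun _ => rfl)
  rw [← Finset.add_sum_erase _ _ (Finset.mem_univ (0 : X))] at htot
  have hcs : (∑ x, a x) ^ 2 ≤ (Fintype.card X : ℝ) * ∑ x, a x * a (x + 0) := by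
    have := sq_sum_le_card_mul_sum_sq (s := (Finset.univ : Finset X)) (f := a)
    simpa [sq, Finset.card_univ] using this
  have hlt : ∑ e ∈ Finset.univ.erase (0 : X), (∑ x, a x) ^ 2 <
      ∑ e ∈ Finset.univ.erase (0 : X), (Fintype.card X : ℝ) * ∑ x, a x * a (x + e) := by
    apply Finset.sum_lt_sum_of_nonempty
    · obtain ⟨e, he⟩ := exists_ne (0 : X)
      exact ⟨e, by simp [he]⟩
    · intro e he
      exact hcon e (by simpa using he)
  rw [Finset.sum_const, ← Finset.mul_sum, Finset.card_erase_of_mem (Finset.mem_univ _),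
    Finset.card_univ, nsmul_eq_mul, Nat.cast_sub Fintype.card_pos] at hlt
  push_cast at hlt
  nlinarith

lemma exists_split (m : ℕ) (e : Fin (m + 1) → ZMod 2) (he : e ≠ 0) :
    ∃ φ : (ZMod 2 × (Fin m → ZMod 2)) ≃ₗ[ZMod 2] (Fin (m + 1) → ZMod 2), φ (1, 0) = e := by
  obtain ⟨W, hW⟩ := Submodule.exists_isCompl (ZMod 2 ∙ e)
  have hr : Module.finrank (ZMod 2) W = m := by
    have h1 := Submodule.finrank_add_eq_of_isCompl hW
    rw [finrank_span_singleton he] at h1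
    simp at h1
    omega
  let ψ : (Fin m → ZMod 2) ≃ₗ[ZMod 2] W :=
    LinearEquiv.ofFinrankEq _ _ (by simp [hr])
  refine ⟨((LinearEquiv.toSpanNonzeroSingleton (ZMod 2) _ e he).prodCongr ψ).trans
    (Submodule.prodEquivOfIsCompl _ _ hW), ?_⟩
  simp

/-- splitting linear maps -/
def splitHom {m : ℕ} {Y : Type} [AddCommGroup Y] [Module (ZMod 2) Y]
    (φ : (ZMod 2 × (Fin m → ZMod 2)) ≃ₗ[ZMod 2] (Fin (m + 1) → ZMod 2)) :
    (Y × ((Fin m → ZMod 2) →ₗ[ZMod 2] Y)) ≃ ((Fin (m + 1) → ZMod 2) →ₗ[ZMod 2] Y) where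
  toFun p := ((LinearMap.toSpanSingleton (ZMod 2) Y p.1).coprod p.2).comp φ.symm.toLinearMap
  invFun h := (h (φ (1, 0)), (h.comp φ.toLinearMap).comp (LinearMap.inr _ _ _))
  left_inv p := by
    ext <;> simp
  right_inv h := by
    apply LinearMap.ext
    intro x
    obtain ⟨⟨t, z⟩, rfl⟩ := φ.surjective x
    simp only [LinearMap.comp_apply, LinearEquiv.coe_coe, LinearEquiv.symm_apply_apply,
      LinearMap.coprod_apply, LinearMap.toSpanSingleton_apply, LinearMap.inr_apply]
    rw [← map_smul, ← map_add, ← map_smul, ← map_add]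
    simp

lemma splitHom_zero {m : ℕ} {Y : Type} [AddCommGroup Y] [Module (ZMod 2) Y]
    (φ : (ZMod 2 × (Fin m → ZMod 2)) ≃ₗ[ZMod 2] (Fin (m + 1) → ZMod 2))
    (v : Y) (h : (Fin m → ZMod 2) →ₗ[ZMod 2] Y) (t : ZMod 2) (x : Fin m → ZMod 2) :
    splitHom φ (v, h) (φ (t, x)) = t • v + h x := by
  simp [splitHom]

/-- The merged function. -/
def merge {m : ℕ} {Y : Type} [AddCommGroup Y] [Module (ZMod 2) Y]
    (φ : (ZMod 2 × (Fin m → ZMod 2)) ≃ₗ[ZMod 2] (Fin (m + 1) → ZMod 2))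
    (g : (Fin (m + 1) → ZMod 2) → Y → ℝ) (v : Y) (x : Fin m → ZMod 2) (y : Y) : ℝ :=
  g (φ (0, x)) y + g (φ (1, x)) (y + v) + g (φ (0, x)) y * g (φ (1, x)) (y + v)

lemma sum_split {m : ℕ}
    (φ : (ZMod 2 × (Fin m → ZMod 2)) ≃ₗ[ZMod 2] (Fin (m + 1) → ZMod 2))
    (F : (Fin (m + 1) → ZMod 2) → ℝ) :
    ∑ x, F x = ∑ x, (F (φ (0, x)) + F (φ (1, x))) := by
  rw [← Fintype.sum_equiv φ.toEquiv (fun p => F (φ p)) F (fun _ => rfl),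
    Fintype.sum_prod_type]
  rw [Finset.sum_add_distrib]
  exact Fin.sum_univ_two (fun t : Fin 2 => ∑ x, F (φ ((t : ZMod 2), x)))

lemma prod_split {m : ℕ}
    (φ : (ZMod 2 × (Fin m → ZMod 2)) ≃ₗ[ZMod 2] (Fin (m + 1) → ZMod 2))
    (F : (Fin (m + 1) → ZMod 2) → ℝ) :
    ∏ x, F x = ∏ x, (F (φ (0, x)) * F (φ (1, x))) := by
  rw [← Fintype.prod_equiv φ.toEquiv (fun p => F (φ p)) F (fun _ => rfl),
    Fintype.prod_prod_type]
  rw [Finset.prod_mul_distrib]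
  exact Fin.prod_univ_two (fun t : Fin 2 => ∏ x, F (φ ((t : ZMod 2), x)))

lemma pot_split {m : ℕ} {Y : Type} [AddCommGroup Y] [Module (ZMod 2) Y] [Fintype Y]
    (φ : (ZMod 2 × (Fin m → ZMod 2)) ≃ₗ[ZMod 2] (Fin (m + 1) → ZMod 2))
    (g : (Fin (m + 1) → ZMod 2) → Y → ℝ) (v : Y) (h : (Fin m → ZMod 2) →ₗ[ZMod 2] Y) :
    pot g (splitHom φ (v, h)) = pot (merge φ g v) h := by
  unfold pot
  refine Finset.sum_congr rfl fun y _ => ?_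
  rw [prod_split φ]
  refine Finset.prod_congr rfl fun x _ => ?_
  rw [splitHom_zero, splitHom_zero, merge]
  simp only [zero_smul, one_smul, zero_add]
  rw [show y + (v + h x) = y + h x + v by abel]
  ring

/-- Noise term. -/
def noise {m : ℕ} {Y : Type} [AddCommGroup Y] [Module (ZMod 2) Y] [Fintype Y]
    (φ : (ZMod 2 × (Fin m → ZMod 2)) ≃ₗ[ZMod 2] (Fin (m + 1) → ZMod 2))
    (g : (Fin (m + 1) → ZMod 2) → Y → ℝ) (v : Y) : ℝ :=
  ∑ x, ∑ y, g (φ (0, x)) y * g (φ (1, x)) (y + v)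

lemma merge_sum {m : ℕ} {Y : Type} [AddCommGroup Y] [Module (ZMod 2) Y] [Fintype Y]
    (φ : (ZMod 2 × (Fin m → ZMod 2)) ≃ₗ[ZMod 2] (Fin (m + 1) → ZMod 2))
    (g : (Fin (m + 1) → ZMod 2) → Y → ℝ) (v : Y) :
    ∑ x, ∑ y, merge φ g v x y = ∑ x, ∑ y, g x y + noise φ g v := by
  rw [sum_split φ (fun x => ∑ y, g x y), noise, ← Finset.sum_add_distrib]
  refine Finset.sum_congr rfl fun x _ => ?_
  simp only [merge, Finset.sum_add_distrib]
  congr 2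
  exact Fintype.sum_equiv (Equiv.addRight v) _ _ (fun _ => rfl)

lemma noise_sum {m : ℕ} {Y : Type} [AddCommGroup Y] [Module (ZMod 2) Y] [Fintype Y]
    (φ : (ZMod 2 × (Fin m → ZMod 2)) ≃ₗ[ZMod 2] (Fin (m + 1) → ZMod 2))
    (g : (Fin (m + 1) → ZMod 2) → Y → ℝ) :
    2 * ∑ v, noise φ g v = ∑ x, (∑ y, g x y) * (∑ y, g (x + φ (1, 0)) y) := by
  have h1 : ∑ v, noise φ g v = ∑ x, (∑ y, g (φ (0, x)) y) * (∑ y, g (φ (1, x)) y) := by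
    unfold noise
    rw [Finset.sum_comm]
    refine Finset.sum_congr rfl fun x _ => ?_
    rw [Finset.sum_comm, Finset.sum_mul]
    refine Finset.sum_congr rfl fun y _ => ?_
    rw [← Finset.mul_sum]
    congr 1
    exact Fintype.sum_equiv (Equiv.addLeft y) _ _ (fun _ => rfl)
  rw [h1, sum_split φ, Finset.mul_sum]
  refine Finset.sum_congr rfl fun x _ => ?_
  rw [← map_add, ← map_add]
  simp only [Prod.mk_add_mk, add_zero, zero_add]
  rw [show (1 : ZMod 2) + 1 = 0 from rfl]
  ring

/-- The scalar truncation inequality. -/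
lemma trunc_ineq (p d ε n : ℝ) (hd : 0 ≤ d) (hε : 0 ≤ ε) (hn : 0 ≤ n) (hp1 : p ≤ 1)
    (hp : p ≤ d ^ 2 * (2 * ε + n) ^ 2) :
    p ≤ 4 * d ^ 2 * ε ^ 2 + (4 * d ^ 2 * ε + d) * n := by
  by_cases h : d * n ≤ 1
  · nlinarith [mul_nonneg (mul_nonneg hd hn) (sub_nonneg.2 h)]
  · push Not at h
    have : 0 ≤ 4 * d ^ 2 * ε ^ 2 + 4 * d ^ 2 * ε * n := by positivity
    nlinarith

/-- Tail bound predicate. -/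
def TailBound (Y : Type) [AddCommGroup Y] [Module (ZMod 2) Y] [Fintype Y] (H : ℝ) (m : ℕ)
    (d : ℝ) : Prop :=
  ∀ g : (Fin m → ZMod 2) → Y → ℝ, (∀ x y, 0 ≤ g x y) →
    (Nat.card {h : (Fin m → ZMod 2) →ₗ[ZMod 2] Y //
      Real.exp H * Fintype.card Y ≤ pot g h} : ℝ) ≤
    Nat.card ((Fin m → ZMod 2) →ₗ[ZMod 2] Y) *
      (d ^ 2 * ((∑ x, ∑ y, g x y) / (2 ^ m * Fintype.card Y)) ^ 2)

lemma tail_step (Y : Type) [AddCommGroup Y] [Module (ZMod 2) Y] [Fintype Y] (H : ℝ) (m : ℕ)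
    (d' d : ℝ) (hd' : 0 < d') (hd : 0 < d) (hdd : 4 * d' ^ 2 + 4 * d' ^ 2 / d + d' ≤ d ^ 2)
    (hT : TailBound Y H m d') : TailBound Y H (m + 1) d := by
  classical
  intro g hg
  have : Finite ((Fin m → ZMod 2) →ₗ[ZMod 2] Y) := Module.finite_of_finite (ZMod 2)
  have : Finite ((Fin (m + 1) → ZMod 2) →ₗ[ZMod 2] Y) := Module.finite_of_finite (ZMod 2)
  have hYpos : (0 : ℝ) < Fintype.card Y := by exact_mod_cast Fintype.card_pos
  set A := ∑ x, ∑ y, g x y with hA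
  have hA0 : 0 ≤ A := Finset.sum_nonneg fun x _ => Finset.sum_nonneg fun y _ => hg x y
  set ε := A / (2 ^ (m + 1) * Fintype.card Y) with hεdef
  have hε : 0 ≤ ε := by positivity
  by_cases hbig : 1 ≤ d * ε
  · have h1 : (Nat.card {h : (Fin (m + 1) → ZMod 2) →ₗ[ZMod 2] Y //
      Real.exp H * Fintype.card Y ≤ pot g h} : ℝ) ≤
        Nat.card ((Fin (m + 1) → ZMod 2) →ₗ[ZMod 2] Y) := by
      exact_mod_cast Finite.card_subtype_le _
    have h2 : 1 ≤ d ^ 2 * ε ^ 2 := by nlinarith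
    refine h1.trans ?_
    exact le_mul_of_one_le_right (Nat.cast_nonneg _) h2
  push Not at hbig
  obtain ⟨e, he, hcor⟩ := exists_dir (fun x : Fin (m + 1) → ZMod 2 => ∑ y, g x y)
  obtain ⟨φ, rfl⟩ := exists_split m e he
  rw [← noise_sum φ g, ← hA] at hcor
  simp only [Fintype.card_pi, ZMod.card, Finset.prod_const, Finset.card_univ,
    Fintype.card_fin, Nat.cast_pow, Nat.cast_ofNat] at hcor
  set N : ℝ := (Nat.card ((Fin m → ZMod 2) →ₗ[ZMod 2] Y) : ℝ) with hN
  have hN0 : 0 < N := by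
    rw [hN]; exact_mod_cast Nat.card_pos
  have hcardHom : (Nat.card ((Fin (m + 1) → ZMod 2) →ₗ[ZMod 2] Y) : ℝ) = Fintype.card Y * N := by
    rw [← Nat.card_congr (splitHom (Y := Y) φ), Nat.card_prod, Nat.card_eq_fintype_card (α := Y)]
    push_cast; rfl
  have hcount : (Nat.card {h : (Fin (m + 1) → ZMod 2) →ₗ[ZMod 2] Y //
      Real.exp H * Fintype.card Y ≤ pot g h} : ℝ) =
      ∑ v : Y, (Nat.card {h : (Fin m → ZMod 2) →ₗ[ZMod 2] Y //
        Real.exp H * Fintype.card Y ≤ pot (merge φ g v) h} : ℝ) := by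
    have e1 : {p : Y × ((Fin m → ZMod 2) →ₗ[ZMod 2] Y) //
        Real.exp H * Fintype.card Y ≤ pot (merge φ g p.1) p.2} ≃
        {h : (Fin (m + 1) → ZMod 2) →ₗ[ZMod 2] Y //
          Real.exp H * Fintype.card Y ≤ pot g h} :=
      (splitHom φ).subtypeEquiv (fun p => by rw [← pot_split])
    have e2 : {p : Y × ((Fin m → ZMod 2) →ₗ[ZMod 2] Y) //
        Real.exp H * Fintype.card Y ≤ pot (merge φ g p.1) p.2} ≃
        (Σ v : Y, {h : (Fin m → ZMod 2) →ₗ[ZMod 2] Y //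
        Real.exp H * Fintype.card Y ≤ pot (merge φ g v) h}) :=
      { toFun := fun p => ⟨p.1.1, p.1.2, p.2⟩
        invFun := fun p => ⟨(p.1, p.2.1), p.2.2⟩
        left_inv := fun _ => rfl
        right_inv := fun _ => rfl }
    rw [← Nat.card_congr e1, Nat.card_congr e2, Nat.card_sigma]
    push_cast; rfl
  rw [hcount, hcardHom]
  set n : Y → ℝ := fun v => noise φ g v / (2 ^ m * Fintype.card Y) with hn
  have hn0 : ∀ v, 0 ≤ n v := fun v => by
    apply div_nonneg _ (by positivity)
    exact Finset.sum_nonneg fun x _ => Finset.sum_nonneg fun y _ => mul_nonneg (hg _ _) (hg _ _)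
  have hnsum : ∑ v, n v ≤ Fintype.card Y * ε ^ 2 := by
    rw [hn, ← Finset.sum_div, hεdef, div_pow, div_le_iff₀ (by positivity)]
    have : (Fintype.card Y : ℝ) * (A ^ 2 / (2 ^ (m + 1) * Fintype.card Y) ^ 2) *
      (2 ^ m * Fintype.card Y) = A ^ 2 / (2 ^ (m + 1) * 2) := by
      field_simp
      ring
    rw [this, le_div_iff₀ (by positivity)]
    linarith
  have hstep : ∀ v : Y, (Nat.card {h : (Fin m → ZMod 2) →ₗ[ZMod 2] Y //
        Real.exp H * Fintype.card Y ≤ pot (merge φ g v) h} : ℝ) ≤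
        N * (4 * d' ^ 2 * ε ^ 2 + (4 * d' ^ 2 * ε + d') * n v) := by
    intro v
    have h1 := hT (merge φ g v) (fun x y => by
      unfold merge
      have := hg (φ (0, x)) y
      have := hg (φ (1, x)) (y + v)
      positivity)
    have h2 : (∑ x, ∑ y, merge φ g v x y) / (2 ^ m * Fintype.card Y) = 2 * ε + n v := by
      rw [merge_sum, ← hA, hεdef, hn]
      field_simp
      ring
    rw [h2] at h1
    have h3 : (Nat.card {h : (Fin m → ZMod 2) →ₗ[ZMod 2] Y //
        Real.exp H * Fintype.card Y ≤ pot (merge φ g v) h} : ℝ) ≤ N := by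
      rw [hN]
      exact_mod_cast Finite.card_subtype_le _
    rw [← div_le_iff₀' hN0]
    apply trunc_ineq _ _ _ _ hd'.le hε (hn0 v)
    · rwa [div_le_one hN0]
    · rwa [div_le_iff₀' hN0]
  refine (Finset.sum_le_sum fun v _ => hstep v).trans ?_
  have hsplit : ∑ v, N * (4 * d' ^ 2 * ε ^ 2 + (4 * d' ^ 2 * ε + d') * n v) =
      N * ((Fintype.card Y : ℝ) * (4 * d' ^ 2 * ε ^ 2) +
        (4 * d' ^ 2 * ε + d') * ∑ v, n v) := by
    rw [← Finset.mul_sum, Finset.sum_add_distrib, Finset.sum_const, Finset.card_univ,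
      nsmul_eq_mul, ← Finset.mul_sum]
  rw [hsplit, mul_comm (Fintype.card Y : ℝ) N, mul_assoc N]
  apply mul_le_mul_of_nonneg_left _ hN0.le
  have hεd : ε ≤ 1 / d := by
    rw [le_div_iff₀ hd]; linarith
  calc (Fintype.card Y : ℝ) * (4 * d' ^ 2 * ε ^ 2) + (4 * d' ^ 2 * ε + d') * ∑ v, n v
      ≤ (Fintype.card Y : ℝ) * (4 * d' ^ 2 * ε ^ 2) +
        (4 * d' ^ 2 * (1 / d) + d') * (Fintype.card Y * ε ^ 2) := by
        gcongr
        exact Finset.sum_nonneg fun v _ => hn0 v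
    _ = Fintype.card Y * ((4 * d' ^ 2 + 4 * d' ^ 2 / d + d') * ε ^ 2) := by ring
    _ ≤ _ := by gcongr

lemma tail_zero (Y : Type) [AddCommGroup Y] [Module (ZMod 2) Y] [Fintype Y] (H : ℝ)
    (hH : 1 ≤ H) : TailBound Y H 0 (4 * Real.exp (-H)) := by
  intro g hg
  have : Finite ((Fin 0 → ZMod 2) →ₗ[ZMod 2] Y) := Module.finite_of_finite (ZMod 2)
  have hYpos : (0 : ℝ) < Fintype.card Y := by exact_mod_cast Fintype.card_pos
  by_cases hne : Nonempty {h : (Fin 0 → ZMod 2) →ₗ[ZMod 2] Y //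
      Real.exp H * Fintype.card Y ≤ pot g h}
  · obtain ⟨h, hh⟩ := hne
    have hp : pot g h = Fintype.card Y + ∑ x, ∑ y, g x y := by
      unfold pot
      simp only [Fintype.prod_unique, Fintype.sum_unique, Finset.sum_add_distrib]
      have h0 : ∀ z : Fin 0 → ZMod 2, h z = 0 := fun z => by
        rw [Subsingleton.elim z 0, map_zero]
      simp [h0]
    rw [hp] at hh
    set A := ∑ x, ∑ y, g x y
    have hε : Real.exp H - 1 ≤ A / (2 ^ 0 * Fintype.card Y) := by
      rw [pow_zero, one_mul, le_div_iff₀ hYpos]; linarith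
    have h1 : (Nat.card {h : (Fin 0 → ZMod 2) →ₗ[ZMod 2] Y //
      Real.exp H * Fintype.card Y ≤ pot g h} : ℝ) ≤
        Nat.card ((Fin 0 → ZMod 2) →ₗ[ZMod 2] Y) := by
      exact_mod_cast Finite.card_subtype_le _
    refine h1.trans (le_mul_of_one_le_right (Nat.cast_nonneg _) ?_)
    have he2 : 2 ≤ Real.exp H := by linarith [Real.add_one_le_exp H]
    have hm : Real.exp (-H) * Real.exp H = 1 := by rw [← Real.exp_add]; simp
    have h4 : 1 ≤ 4 * Real.exp (-H) * (A / (2 ^ 0 * Fintype.card Y)) := by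
      have := mul_le_mul_of_nonneg_left hε (Real.exp_pos (-H)).le
      nlinarith [Real.exp_pos (-H)]
    rw [← mul_pow]
    exact one_le_pow₀ h4
  · rw [not_nonempty_iff] at hne
    rw [Nat.card_of_isEmpty]
    simp only [Nat.cast_zero]
    positivity

lemma tail_all (Y : Type) [AddCommGroup Y] [Module (ZMod 2) Y] [Fintype Y] (H : ℝ)
    (hH : 1 ≤ H) (m : ℕ) : ∃ d : ℝ, 0 < d ∧ TailBound Y H m d ∧
      (d = 4 * Real.exp (-(H / 2 ^ m)) ∨ d + 1 ≤ 8 * 2 ^ m / H) := by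
  have hH0 : 0 < H := by linarith
  induction m with
  | zero => exact ⟨_, by positivity, tail_zero Y H hH, Or.inl (by simp)⟩
  | succ m ih =>
    obtain ⟨d, hd, hT, hor⟩ := ih
    have caseB : d + 1 ≤ 8 * 2 ^ m / H → ∃ d : ℝ, 0 < d ∧ TailBound Y H (m + 1) d ∧
      (d = 4 * Real.exp (-(H / 2 ^ (m + 1))) ∨ d + 1 ≤ 8 * 2 ^ (m + 1) / H) := by
      intro hb
      refine ⟨2 * d + 1, by positivity, tail_step Y H m d _ hd (by positivity) ?_ hT, Or.inr ?_⟩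
      · have : 4 * d ^ 2 / (2 * d + 1) ≤ 2 * d := by
          rw [div_le_iff₀ (by positivity)]; nlinarith
        nlinarith
      · rw [pow_succ]
        have : 8 * (2 ^ m * 2) / H = 2 * (8 * 2 ^ m / H) := by ring
        linarith
    rcases hor with ha | hb
    · set x := H / 2 ^ m with hx
      have hx0 : 0 < x := by positivity
      by_cases hsm : d ≤ 1 / 4
      · set w := 2 * Real.exp (-(H / 2 ^ (m + 1))) with hw
        have hw0 : 0 < w := by positivity
        have hdw : d = w ^ 2 := by
          rw [ha, hw, mul_pow, ← Real.exp_nat_mul]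
          congr 2
          · norm_num
          · rw [hx, pow_succ]; push_cast; field_simp
        have hw2 : w ≤ 1 / 2 := by
          by_contra hc
          push Not at hc
          nlinarith
        refine ⟨2 * w, by positivity, tail_step Y H m d _ hd (by positivity) ?_ hT,
          Or.inl (by rw [hw]; ring)⟩
        rw [hdw]
        have : 4 * (w ^ 2) ^ 2 / (2 * w) = 2 * w ^ 3 := by field_simp; ring
        rw [this]
        have h2 : w ^ 2 * (4 * w ^ 2 + 2 * w - 3) ≤ 0 := by
          apply mul_nonpos_of_nonneg_of_nonpos (by positivity)
          nlinarith
        nlinarith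
      · push Not at hsm
        apply caseB
        have hxe : 8 * 2 ^ m / H = 8 / x := by rw [hx]; field_simp
        rw [hxe, le_div_iff₀ hx0, ha]
        have h1 : x * Real.exp (-x) ≤ 1 := by
          have h2 := Real.add_one_le_exp x
          have h3 : Real.exp (-x) * Real.exp x = 1 := by rw [← Real.exp_add]; simp
          nlinarith [Real.exp_pos (-x)]
        have h4 : x ≤ 4 := by
          by_contra hc
          push Not at hc
          have h5 : Real.exp (-x) ≤ Real.exp (-4) := Real.exp_le_exp.2 (by linarith)
          have h6 : Real.exp (-4) * Real.exp 4 = 1 := by rw [← Real.exp_add]; simp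
          have h7 : (2 : ℝ) ^ 4 ≤ Real.exp 4 := by
            have : Real.exp 4 = Real.exp 1 ^ 4 := by rw [← Real.exp_nat_mul]; norm_num
            rw [this]
            have := Real.add_one_le_exp (1 : ℝ)
            gcongr
            linarith
          nlinarith [Real.exp_pos (-4)]
        nlinarith
    · exact caseB hb

lemma tail_final (Y : Type) [AddCommGroup Y] [Module (ZMod 2) Y] [Fintype Y] (H : ℝ)
    (hH : 1 ≤ H) (m : ℕ) : TailBound Y H m (8 * 2 ^ m / H) := by
  have hH0 : 0 < H := by linarith
  obtain ⟨d, hd, hT, hor⟩ := tail_all Y H hH m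
  have hle : d ≤ 8 * 2 ^ m / H := by
    rcases hor with ha | hb
    · set x := H / 2 ^ m with hx
      have hx0 : 0 < x := by positivity
      have hxe : 8 * 2 ^ m / H = 8 / x := by rw [hx]; field_simp
      rw [hxe, le_div_iff₀ hx0, ha]
      have h2 := Real.add_one_le_exp x
      have h3 : Real.exp (-x) * Real.exp x = 1 := by rw [← Real.exp_add]; simp
      nlinarith [Real.exp_pos (-x)]
    · linarith
  intro g hg
  refine (hT g hg).trans ?_
  gcongr

lemma pot_ge (u ℓ : ℕ) (S : Finset (Fin u → ZMod 2)) (h : Lin u ℓ) (b : ℝ) (hb : 1 ≤ b) :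
    b ^ (maxLoad u ℓ S h) ≤
      pot (fun x (y : Fin ℓ → ZMod 2) => if x ∈ S ∧ y = 0 then b - 1 else 0) h := by
  classical
  have hval : ∀ y : Fin ℓ → ZMod 2,
      ∏ x, (1 + (if x ∈ S ∧ y + h x = 0 then b - 1 else 0)) =
        b ^ (S.filter fun v => h v = -y).card := by
    intro y
    have : ∀ x, (1 + (if x ∈ S ∧ y + h x = 0 then b - 1 else 0)) =
        if x ∈ S.filter (fun v => h v = -y) then b else 1 := by
      intro x
      have hiff : y + h x = 0 ↔ h x = -y := by
        rw [add_comm, add_eq_zero_iff_eq_neg]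
      simp only [Finset.mem_filter, hiff]
      split_ifs <;> ring
    rw [Finset.prod_congr rfl fun x _ => this x, Finset.prod_ite_mem, Finset.univ_inter,
      Finset.prod_const]
  obtain ⟨y, -, hy⟩ := Finset.exists_mem_eq_sup (Finset.univ : Finset (Fin ℓ → ZMod 2))
    Finset.univ_nonempty (fun y => (S.filter fun v => h v = y).card)
  unfold pot
  rw [Finset.sum_congr rfl fun y _ => hval y, maxLoad, hy]
  have := Finset.single_le_sum (f := fun y : Fin ℓ → ZMod 2 =>
    b ^ (S.filter fun v => h v = -y).card) (fun i _ => by positivity) (Finset.mem_univ (-y))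
  simpa using this

end Helpers

/-- There exist absolute constants C > 0, D > 0 and ℓ_0 such that the following
holds. Let u ≥ ℓ ≥ ℓ_0, let S ⊆ F_2^u have size 2^ℓ, and let h : F_2^u → F_2^ℓ be a uniformly
random linear map. Then for every real R > 1 satisfying R ℓ^{1 − 1/R} ≥ D ln ℓ, one has
Pr[M(S,h) ≥ R ℓ / log_2 ℓ] ≤ C (ln ℓ)^2 / (R^2 ℓ^{2 − 2/R}). -/
theorem stmt_11 :
    ∃ C > (0 : ℝ), ∃ D > (0 : ℝ), ∃ ℓ₀ : ℕ,
      ∀ (ℓ u : ℕ), ℓ₀ ≤ ℓ → ℓ ≤ u →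
      ∀ S : Finset (Fin u → ZMod 2), S.card = 2 ^ ℓ →
      ∀ R : ℝ, 1 < R → D * Real.log ℓ ≤ R * (ℓ : ℝ) ^ (1 - 1 / R) →
      (Nat.card {h : Lin u ℓ // R * ℓ / Real.logb 2 ℓ ≤ (maxLoad u ℓ S h : ℝ)} : ℝ) /
          (Nat.card (Lin u ℓ) : ℝ) ≤
        C * (Real.log ℓ) ^ 2 / (R ^ 2 * (ℓ : ℝ) ^ (2 - 2 / R)) := by
  refine ⟨64 * Real.exp 1 ^ 2 / Real.log 2 ^ 2, by
    have := Real.log_pos one_lt_two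
    positivity, 1, one_pos, 2, ?_⟩
  intro ℓ u hℓ _ S hS R hR _
  classical
  have hl2 : 0 < Real.log 2 := Real.log_pos one_lt_two
  have hℓ2 : (2 : ℝ) ≤ ℓ := by exact_mod_cast hℓ
  have hℓ0 : (0 : ℝ) < ℓ := by linarith
  have hL : 0 < Real.log ℓ := Real.log_pos (by linarith)
  have hR0 : 0 < R := by linarith
  set b : ℝ := Real.exp 1 * (ℓ : ℝ) ^ (1 / R) with hbdef
  set H : ℝ := Real.log 2 * R * ℓ / Real.log ℓ with hHdef
  have hb1 : 1 ≤ b := by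
    have h1 : 1 ≤ Real.exp 1 := Real.one_le_exp (by norm_num)
    have h2 : 1 ≤ (ℓ : ℝ) ^ (1 / R) := Real.one_le_rpow (by linarith) (by positivity)
    nlinarith
  have hH : 1 ≤ H := by
    rw [hHdef, le_div_iff₀ hL, one_mul]
    have h1 : Real.log ℓ ≤ ℓ * Real.log 2 := by
      rw [← Real.log_pow]
      apply Real.log_le_log hℓ0
      exact_mod_cast Nat.lt_two_pow_self.le
    nlinarith [mul_pos hℓ0 hl2]
  have hlogb : Real.log b = 1 + Real.log ℓ / R := by
    rw [hbdef, Real.log_mul (by positivity) (by positivity), Real.log_exp, Real.log_rpow hℓ0]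
    ring
  have hcY : (Fintype.card (Fin ℓ → ZMod 2) : ℝ) = 2 ^ ℓ := by simp [ZMod.card]
  set g : (Fin u → ZMod 2) → (Fin ℓ → ZMod 2) → ℝ :=
    fun x y => if x ∈ S ∧ y = 0 then b - 1 else 0 with hg
  have : Finite (Lin u ℓ) := Module.finite_of_finite (ZMod 2)
  have hsub : (Nat.card {h : Lin u ℓ // R * ℓ / Real.logb 2 ℓ ≤ (maxLoad u ℓ S h : ℝ)} : ℝ) ≤
      Nat.card {h : Lin u ℓ // Real.exp H * Fintype.card (Fin ℓ → ZMod 2) ≤ pot g h} := by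
    have himp : ∀ h : Lin u ℓ, R * ℓ / Real.logb 2 ℓ ≤ (maxLoad u ℓ S h : ℝ) →
        Real.exp H * Fintype.card (Fin ℓ → ZMod 2) ≤ pot g h := by
      intro h hh
      refine le_trans ?_ (pot_ge u ℓ S h b hb1)
      rw [hcY, ← Real.exp_log (show (0 : ℝ) < 2 ^ ℓ by positivity), ← Real.exp_add,
        ← Real.exp_log (show (0 : ℝ) < b ^ (maxLoad u ℓ S h) by positivity), Real.log_pow,
        Real.log_pow, Real.exp_le_exp]
      refine le_trans (le_of_eq ?_)
        (mul_le_mul_of_nonneg_right hh (Real.log_nonneg hb1))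
      rw [hlogb, hHdef, Real.logb]
      field_simp
    exact_mod_cast Nat.card_le_card_of_injective
      (Subtype.map id himp) (Subtype.map_injective _ Function.injective_id)
  have hT := tail_final (Fin ℓ → ZMod 2) H hH u g (fun x y => by
    rw [hg]; dsimp only; split_ifs <;> linarith)
  have hsum : ∑ x, ∑ y, g x y = 2 ^ ℓ * (b - 1) := by
    have : ∀ x, ∑ y, g x y = if x ∈ S then b - 1 else 0 := by
      intro x
      by_cases hx : x ∈ S <;> simp [hg, hx]
    rw [Finset.sum_congr rfl fun x _ => this x, Finset.sum_ite_mem, Finset.univ_inter,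
      Finset.sum_const, hS, nsmul_eq_mul]
    push_cast; rfl
  rw [hsum, hcY] at hT
  have hNpos : (0 : ℝ) < Nat.card (Lin u ℓ) := by exact_mod_cast Nat.card_pos
  rw [div_le_iff₀' hNpos]
  rw [← hcY] at hT
  refine hsub.trans (hT.trans ?_)
  apply mul_le_mul_of_nonneg_left _ hNpos.le
  rw [hcY]
  have hpow : (ℓ : ℝ) ^ (2 - 2 / R) = ℓ ^ 2 / ((ℓ : ℝ) ^ (1 / R)) ^ 2 := by
    rw [Real.rpow_sub hℓ0, ← Real.rpow_natCast ((ℓ : ℝ) ^ (1 / R)), ← Real.rpow_mul hℓ0.le]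
    congr 1
    · exact_mod_cast Real.rpow_natCast (ℓ : ℝ) 2
    · congr 1; push_cast; ring
  have e1 : (8 * 2 ^ u / H) ^ 2 * (2 ^ ℓ * (b - 1) / (2 ^ u * 2 ^ ℓ)) ^ 2 =
      64 * (b - 1) ^ 2 / H ^ 2 := by
    field_simp; ring
  rw [e1]
  have e2 : 64 * Real.exp 1 ^ 2 / Real.log 2 ^ 2 * Real.log ℓ ^ 2 /
      (R ^ 2 * (ℓ : ℝ) ^ (2 - 2 / R)) = 64 * b ^ 2 / H ^ 2 := by
    rw [hpow, hbdef, hHdef]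
    field_simp
  rw [e2]
  gcongr
  linarith
end

section
/- For every ε > 0 there exists ℓ_0 such that for every ℓ ≥ ℓ_0, every u ≥ ℓ, and every set S ⊆ F_2^u of size 2^ℓ, the expected maximum load of a uniformly random linear map h : F_2^u → F_2^ℓ satisfies E_h[M(S,h)] ≤ (1 + (1 + ε) · (ln ln ℓ)/(ln ℓ)) · ℓ / log_2 ℓ. -/
noncomputable instance (u ℓ : ℕ) : Fintype (Lin u ℓ) :=
  Fintype.ofInjective DFunLike.coe DFunLike.coe_injective

set_option linter.unusedSectionVars false
namespace LH
section process
variable {G : Type*} [AddCommGroup G] [Fintype G]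

/-- average over a finite group -/
noncomputable def av (F : G → ℝ) : ℝ := (∑ x, F x) / (Fintype.card G : ℝ)

def step (v : G) (g : G → ℝ) : G → ℝ := fun x => g x * g (x + v)

noncomputable def R : ℕ → ((G → ℝ) → ℝ) → (G → ℝ) → ℝ
  | 0, F, g => F g
  | n + 1, F, g => av (fun v => R n F (step v g))

lemma card_pos' : (0 : ℝ) < (Fintype.card G : ℝ) := by
  exact_mod_cast Fintype.card_pos

lemma av_mono {F F' : G → ℝ} (h : ∀ x, F x ≤ F' x) : av F ≤ av F' := by
  unfold av
  have := card_pos' (G := G)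
  gcongr
  exact h _

lemma av_const (c : ℝ) : av (fun _ : G => c) = c := by
  unfold av
  have := card_pos' (G := G)
  simp

lemma av_add (F F' : G → ℝ) : av (fun x => F x + F' x) = av F + av F' := by
  unfold av
  rw [Finset.sum_add_distrib, add_div]

lemma av_mul (c : ℝ) (F : G → ℝ) : av (fun x => c * F x) = c * av F := by
  unfold av
  rw [← Finset.mul_sum, mul_div_assoc]

lemma av_step (g : G → ℝ) : av (fun v => av (step v g)) = av g ^ 2 := by
  unfold av step
  have hc := card_pos' (G := G)
  rw [← Finset.sum_div, Finset.sum_comm]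
  have : ∀ x : G, ∑ v, g x * g (x + v) = g x * ∑ v, g v := by
    intro x
    rw [← Finset.mul_sum]
    congr 1
    exact Fintype.sum_equiv (Equiv.addLeft x) _ _ (fun v => rfl)
  simp_rw [this]
  rw [← Finset.sum_mul]
  field_simp

lemma av_trans (g : G → ℝ) (v : G) : av (fun x => g (x + v)) = av g := by
  unfold av
  congr 1
  exact Fintype.sum_equiv (Equiv.addRight v) _ _ (fun v => rfl)

lemma step_one_le {g : G → ℝ} (hg : ∀ x, 1 ≤ g x) (v : G) : ∀ x, 1 ≤ step v g x := by
  intro x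
  exact one_le_mul_of_one_le_of_one_le (hg _) (hg _)

lemma one_le_av {g : G → ℝ} (hg : ∀ x, 1 ≤ g x) : 1 ≤ av g := by
  calc (1 : ℝ) = av (fun _ : G => (1 : ℝ)) := (av_const 1).symm
    _ ≤ av g := av_mono hg

lemma av_step_ge {g : G → ℝ} (hg : ∀ x, 1 ≤ g x) (v : G) : 2 * av g - 1 ≤ av (step v g) := by
  have h1 : av (fun x => (g x + g (x + v)) + (-1)) ≤ av (step v g) := by
    apply av_mono
    intro x
    unfold step
    nlinarith [hg x, hg (x + v)]
  rw [av_add, av_add, av_trans, av_const] at h1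
  linarith

lemma R_mono {F F' : (G → ℝ) → ℝ} (h : ∀ g, (∀ x, 1 ≤ g x) → F g ≤ F' g) (n : ℕ) :
    ∀ g : G → ℝ, (∀ x, 1 ≤ g x) → R n F g ≤ R n F' g := by
  induction n with
  | zero => exact h
  | succ n ih =>
    intro g hg
    exact av_mono fun v => ih _ (step_one_le hg v)

lemma R_add (a b : ℕ) (F : (G → ℝ) → ℝ) : ∀ g, R (a + b) F g = R a (R b F) g := by
  induction a with
  | zero => intro g; simp [R]
  | succ a ih =>
    intro g
    rw [Nat.succ_add]
    simp only [R]
    congr 1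
    funext v
    exact ih _

lemma R_lin (c d : ℝ) (F : (G → ℝ) → ℝ) (n : ℕ) :
    ∀ g, R n (fun g => c + d * F g) g = c + d * R n F g := by
  induction n with
  | zero => intro g; rfl
  | succ n ih =>
    intro g
    simp only [R, ih]
    rw [av_add, av_mul, av_const]

lemma av_rpow_le {F : G → ℝ} (hF : ∀ x, 0 ≤ F x) {p : ℝ} (h0 : 0 ≤ p) (h1 : p ≤ 1) :
    av (fun x => F x ^ p) ≤ av F ^ p := by
  have hc := card_pos' (G := G)
  have := (Real.concaveOn_rpow h0 h1).le_map_sum (t := Finset.univ)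
    (w := fun _ : G => 1 / (Fintype.card G : ℝ)) (p := F) (fun _ _ => by positivity)
    (by simp) (fun x _ => hF x)
  simp only [smul_eq_mul, ← Finset.mul_sum] at this
  unfold av
  rw [div_eq_inv_mul, div_eq_inv_mul]
  simpa using this

lemma phase2 (m : ℕ) : ∀ (θ : ℝ) (g : G → ℝ), (∀ x, 1 ≤ g x) → 0 ≤ θ → θ * 2 ^ m ≤ 1 →
    R m (fun g => av g ^ θ) g ≤ av g ^ (θ * 2 ^ m) := by
  induction m with
  | zero => intro θ g hg h0 h1; simp [R]
  | succ m ih =>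
    intro θ g hg h0 h1
    have h2 : θ * 2 ^ m ≤ 1 := by
      rw [pow_succ] at h1
      have : 0 ≤ θ * 2 ^ m := by positivity
      nlinarith
    calc R (m + 1) (fun g => av g ^ θ) g
        = av (fun v => R m (fun g => av g ^ θ) (step v g)) := rfl
      _ ≤ av (fun v => av (step v g) ^ (θ * 2 ^ m)) :=
          av_mono fun v => ih θ _ (step_one_le hg v) h0 h2
      _ ≤ (av (fun v => av (step v g))) ^ (θ * 2 ^ m) := by
          apply av_rpow_le _ (by positivity) h2
          intro v
          exact le_trans zero_le_one (one_le_av (step_one_le hg v))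
      _ = av g ^ (θ * 2 ^ (m + 1)) := by
          rw [av_step, ← Real.rpow_natCast, ← Real.rpow_mul (le_trans zero_le_one (one_le_av hg))]
          congr 1
          push_cast
          ring

noncomputable def phi (z : ℝ) : ℝ := min 1 (z ^ 2)

lemma phi_add {z y : ℝ} (hz : 0 ≤ z) (hy : 0 ≤ y) : phi (z + y) ≤ phi z + 2 * y := by
  unfold phi
  rcases le_total 1 z with h | h
  · rw [min_eq_left (show (1 : ℝ) ≤ z ^ 2 by nlinarith)]
    have := min_le_left (1 : ℝ) ((z + y) ^ 2)
    linarith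
  · rw [min_eq_right (show z ^ 2 ≤ 1 by nlinarith)]
    rcases le_total (z + y) 1 with h' | h'
    · refine le_trans (min_le_right _ _) ?_
      nlinarith
    · refine le_trans (min_le_left _ _) ?_
      nlinarith

lemma phase1 (n : ℕ) : ∀ g : G → ℝ, (∀ x, 1 ≤ g x) →
    R n (fun g => phi (av g - 1)) g ≤ Real.exp (1 - (1 / 2) ^ n) * phi (2 ^ n * (av g - 1)) := by
  induction n with
  | zero => intro g hg; simp [R]
  | succ n ih =>
    intro g hg
    set q := av g - 1 with hq
    have hq0 : 0 ≤ q := by have := one_le_av hg; linarith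
    set b := 2 ^ (n + 1) * q with hb
    have hb0 : 0 ≤ b := by positivity
    have key : av (fun v => phi (2 ^ n * (av (step v g) - 1))) ≤ phi b + 2 ^ (n + 1) * q ^ 2 := by
      calc av (fun v => phi (2 ^ n * (av (step v g) - 1)))
          ≤ av (fun v => (phi b + (-(2 ^ (n + 1)) * (1 + 2 * q))) + 2 ^ (n + 1) * av (step v g)) := by
            apply av_mono
            intro v
            have h1 := av_step_ge hg v
            have h2 := phi_add hb0 (y := 2 ^ n * (av (step v g) - 1 - 2 * q))
              (by apply mul_nonneg (by positivity); linarith)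
            rw [show b + 2 ^ n * (av (step v g) - 1 - 2 * q) = 2 ^ n * (av (step v g) - 1) by
              rw [hb]; ring] at h2
            refine h2.trans (le_of_eq ?_)
            ring
        _ = phi b + 2 ^ (n + 1) * q ^ 2 := by
            rw [av_add, av_const, av_mul, av_step]
            rw [show av g = q + 1 by rw [hq]; ring]
            ring
    have key2 : av (fun v => phi (2 ^ n * (av (step v g) - 1))) ≤
        (1 + (1 / 2) ^ (n + 1)) * phi b := by
      rcases le_total 1 b with h | h
      · have : phi b = 1 := by unfold phi; exact min_eq_left (by nlinarith)
        rw [this]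
        have h3 : av (fun v => phi (2 ^ n * (av (step v g) - 1))) ≤ av (fun _ : G => (1 : ℝ)) :=
          av_mono fun v => min_le_left _ _
        rw [av_const] at h3
        have : (0 : ℝ) ≤ (1 / 2) ^ (n + 1) := by positivity
        linarith
      · have : phi b = b ^ 2 := by unfold phi; exact min_eq_right (by nlinarith)
        rw [this] at key ⊢
        refine key.trans (le_of_eq ?_)
        rw [hb]
        have : (2 : ℝ) ^ (n + 1) * (1 / 2) ^ (n + 1) = 1 := by
          rw [← mul_pow]; norm_num
        linear_combination (-(2 : ℝ) ^ (n + 1) * q ^ 2) * this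
    have hphi : 0 ≤ phi b := by unfold phi; positivity
    calc R (n + 1) (fun g => phi (av g - 1)) g
        = av (fun v => R n (fun g => phi (av g - 1)) (step v g)) := rfl
      _ ≤ av (fun v => Real.exp (1 - (1 / 2) ^ n) * phi (2 ^ n * (av (step v g) - 1))) :=
          av_mono fun v => ih _ (step_one_le hg v)
      _ = Real.exp (1 - (1 / 2) ^ n) * av (fun v => phi (2 ^ n * (av (step v g) - 1))) := av_mul _ _
      _ ≤ Real.exp (1 - (1 / 2) ^ n) * ((1 + (1 / 2) ^ (n + 1)) * phi b) := by gcongr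
      _ ≤ Real.exp (1 - (1 / 2) ^ n) * (Real.exp ((1 / 2) ^ (n + 1)) * phi b) := by
          gcongr
          have := Real.add_one_le_exp (((1 : ℝ) / 2) ^ (n + 1))
          linarith
      _ = Real.exp (1 - (1 / 2) ^ (n + 1)) * phi b := by
          rw [← mul_assoc, ← Real.exp_add]
          congr 2
          ring

/-- tail bound for the process -/
lemma process_tail (a m : ℕ) (s : ℝ) (g : G → ℝ) (hg : ∀ x, 1 ≤ g x)
    (F : (G → ℝ) → ℝ) (hF1 : ∀ g, F g ≤ 1)
    (hF : ∀ g, (∀ x, 1 ≤ g x) → F g ≤ Real.exp (-s) * av g ^ ((1 / 2 : ℝ) ^ m)) :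
    R (a + m) F g ≤ 2 * Real.exp (-s) + 3 * (2 ^ a * (av g - 1)) ^ 2 := by
  have h1 : ∀ g : G → ℝ, (∀ x, 1 ≤ g x) →
      R m F g ≤ 2 * Real.exp (-s) + 1 * phi (av g - 1) := by
    intro g hg
    have hA : R m F g ≤ 1 := by
      refine (R_mono (F' := fun _ => 1 + 0 * 1) (fun g _ => by simpa using hF1 g) m g hg).trans ?_
      rw [R_lin 1 0 (fun _ => 1)]
      simp
    have hB : R m F g ≤ Real.exp (-s) * av g := by
      refine (R_mono (F' := fun g => 0 + Real.exp (-s) * av g ^ ((1 / 2 : ℝ) ^ m))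
        (fun g hg => by simpa using hF g hg) m g hg).trans ?_
      rw [R_lin 0 (Real.exp (-s)) (fun g => av g ^ ((1 / 2 : ℝ) ^ m)), zero_add]
      have h2 : ((1 / 2 : ℝ) ^ m) * 2 ^ m = 1 := by rw [← mul_pow]; norm_num
      have := phase2 m ((1 / 2 : ℝ) ^ m) g hg (by positivity) h2.le
      rw [h2, Real.rpow_one] at this
      gcongr
    have hq := one_le_av hg
    have he := Real.exp_pos (-s)
    unfold phi
    rcases le_total 1 (av g - 1) with h | h
    · rw [min_eq_left (by nlinarith)]
      linarith
    · have : 0 ≤ min 1 ((av g - 1) ^ 2) := by positivity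
      nlinarith
  rw [R_add]
  refine (R_mono h1 a g hg).trans ?_
  rw [R_lin (2 * Real.exp (-s)) 1 (fun g => phi (av g - 1))]
  have h2 := phase1 a g hg
  have h3 : phi (2 ^ a * (av g - 1)) ≤ (2 ^ a * (av g - 1)) ^ 2 := min_le_right _ _
  have h4 : Real.exp (1 - (1 / 2) ^ a) ≤ 3 := by
    have h5 : Real.exp (1 - (1 / 2) ^ a) ≤ Real.exp 1 := by
      apply Real.exp_le_exp.mpr
      have : (0 : ℝ) ≤ (1 / 2) ^ a := by positivity
      linarith
    have := Real.exp_one_lt_d9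
    linarith
  have h6 : Real.exp (1 - (1 / 2) ^ a) * phi (2 ^ a * (av g - 1)) ≤
      3 * (2 ^ a * (av g - 1)) ^ 2 := by
    apply mul_le_mul h4 h3 _ (by norm_num)
    unfold phi
    positivity
  linarith

def iter : (k : ℕ) → (Fin k → G) → (G → ℝ) → (G → ℝ)
  | 0, _, g => g
  | k + 1, v, g => iter k (Fin.tail v) (step (v 0) g)

lemma R_eq_sum (k : ℕ) (F : (G → ℝ) → ℝ) : ∀ g : G → ℝ,
    R k F g = (∑ v : Fin k → G, F (iter k v g)) / (Fintype.card G : ℝ) ^ k := by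
  induction k with
  | zero => intro g; simp [R, iter]
  | succ k ih =>
    intro g
    simp only [R, ih]
    unfold av
    rw [← Finset.sum_div, div_div, ← pow_succ]
    congr 1
    rw [← Fintype.sum_prod_type']
    refine Fintype.sum_equiv (Fin.consEquiv (fun _ : Fin (k + 1) => G)) _ _ ?_
    rintro ⟨a, w⟩
    simp [iter, Fin.consEquiv]

lemma iter_eq [Module (ZMod 2) G] (k : ℕ) : ∀ (v : Fin k → G) (g : G → ℝ) (x : G),
    iter k v g x = ∏ w : Fin k → ZMod 2, g (x + ∑ i, w i • v i) := by
  induction k with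
  | zero => intro v g x; simp [iter]
  | succ k ih =>
    intro v g x
    simp only [iter, ih, step]
    rw [← Fintype.prod_equiv (Fin.consEquiv (fun _ : Fin (k + 1) => ZMod 2))
      (fun p => g (x + (p.1 • v 0 + ∑ i, p.2 i • v i.succ))) _ (by
        rintro ⟨a, w⟩
        simp [Fin.consEquiv, Fin.sum_univ_succ])]
    rw [Fintype.prod_prod_type_right]
    refine Finset.prod_congr rfl fun w _ => ?_
    change _ = ∏ a : Fin 2, _
    rw [Fin.prod_univ_two]
    change _ = g (x + ((0 : ZMod 2) • v 0 + _)) * g (x + ((1 : ZMod 2) • v 0 + _))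
    rw [zero_smul, one_smul, zero_add]
    congr 2
    rw [add_assoc]
    congr 1
    rw [add_comm]
    rfl

end process
section linalg
variable {G Y : Type*} [AddCommGroup G] [Fintype G] [DecidableEq G] [Module (ZMod 2) G]
  [AddCommGroup Y] [Fintype Y] [DecidableEq Y] [Module (ZMod 2) Y]

def mx (S : Finset G) (H : G →ₗ[ZMod 2] Y) : ℕ :=
  Finset.univ.sup fun y : Y => (S.filter fun v => H v = y).card

noncomputable def g0 (S : Finset G) (lam : ℝ) : G → ℝ := fun x => if x ∈ S then Real.exp lam else 1

lemma g0_ge {S : Finset G} {lam : ℝ} (h : 0 ≤ lam) : ∀ x, 1 ≤ g0 S lam x := by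
  intro x
  unfold g0
  split_ifs
  · exact Real.one_le_exp h
  · exact le_rfl

lemma av_g0 (S : Finset G) (lam : ℝ) (k ℓ : ℕ) (hG : Fintype.card G = 2 ^ (k + ℓ))
    (hS : S.card = 2 ^ ℓ) : av (g0 S lam) - 1 = (1 / 2) ^ k * (Real.exp lam - 1) := by
  have h1 : ∀ x, g0 S lam x = 1 + (Real.exp lam - 1) * (if x ∈ S then 1 else 0) := by
    intro x
    unfold g0
    split_ifs <;> ring
  have h2 : av (g0 S lam) = 1 + (Real.exp lam - 1) * ((2 : ℝ) ^ ℓ / 2 ^ (k + ℓ)) := by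
    rw [show g0 S lam = fun x => 1 + (Real.exp lam - 1) * (if x ∈ S then 1 else 0) from funext h1]
    rw [av_add, av_mul, av_const]
    unfold av
    rw [hG, Finset.sum_ite_mem, Finset.univ_inter]
    simp [hS]
  rw [h2, pow_add, div_pow, one_pow]
  field_simp
  ring

lemma card_fib (k ℓ : ℕ) (hG : Fintype.card G = 2 ^ (k + ℓ)) (hY : Fintype.card Y = 2 ^ ℓ)
    (H : G →ₗ[ZMod 2] Y) (hH : Function.Surjective H) (y : Y) :
    (Finset.univ.filter fun x => H x = y).card = 2 ^ k := by
  have h1 : ∀ y', (Finset.univ.filter fun x => H x = y').card =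
      (Finset.univ.filter fun x => H x = y).card := by
    intro y'
    exact AddMonoidHom.card_fiber_eq_of_mem_range H.toAddMonoidHom (hH y') (hH y)
  have h2 := Finset.card_eq_sum_card_fiberwise (f := H) (s := Finset.univ) (t := Finset.univ)
    (fun _ _ => Finset.mem_coe.mpr (Finset.mem_univ _))
  simp only [h1] at h2
  rw [Finset.sum_const, Finset.card_univ, Finset.card_univ, hG, hY, smul_eq_mul, add_comm,
    pow_add] at h2
  exact (Nat.eq_of_mul_eq_mul_left (by positivity) h2).symm

lemma key1 (k ℓ : ℕ) (hG : Fintype.card G = 2 ^ (k + ℓ)) (hY : Fintype.card Y = 2 ^ ℓ)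
    (H : G →ₗ[ZMod 2] Y) (hH : Function.Surjective H) (v : Fin k → G)
    (hv : LinearIndependent (ZMod 2) v) (hHv : ∀ i, H (v i) = 0) (S : Finset G) (lam : ℝ) :
    Real.exp (lam * mx S H) ≤ 2 ^ ℓ * av (iter k v (g0 S lam)) := by
  obtain ⟨y, -, hy⟩ := Finset.exists_mem_eq_sup (Finset.univ : Finset Y) ⟨0, Finset.mem_univ _⟩
    (fun y : Y => (S.filter fun v => H v = y).card)
  have hmx : mx S H = (S.filter fun v => H v = y).card := hy
  have hval : ∀ x, iter k v (g0 S lam) x =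
      Real.exp (lam * (S.filter fun v => H v = H x).card) := by
    intro x
    rw [iter_eq]
    have hinj : Function.Injective (fun w : Fin k → ZMod 2 => x + ∑ i, w i • v i) := by
      intro w w' h
      have h' : ∑ i, w i • v i = ∑ i, w' i • v i := add_left_cancel h
      have h3 := Fintype.linearIndependent_iff.mp hv (fun i => w i - w' i) (by
        simp only [sub_smul, Finset.sum_sub_distrib, h', sub_self])
      funext i
      exact sub_eq_zero.mp (h3 i)
    have himg : Finset.univ.image (fun w : Fin k → ZMod 2 => x + ∑ i, w i • v i) =
        Finset.univ.filter fun z => H z = H x := by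
      apply Finset.eq_of_subset_of_card_le
      · intro z hz
        obtain ⟨w, -, rfl⟩ := Finset.mem_image.mp hz
        simp [hHv]
      · rw [card_fib k ℓ hG hY H hH, Finset.card_image_of_injective _ hinj]
        simp [ZMod.card]
    rw [← Finset.prod_image (f := g0 S lam) (s := Finset.univ)
      (g := fun w : Fin k → ZMod 2 => x + ∑ i, w i • v i) (fun a _ b _ h => hinj h), himg]
    unfold g0
    rw [Finset.prod_ite, Finset.prod_const_one, mul_one, Finset.prod_const, ← Real.exp_nat_mul,
      mul_comm]
    congr 3
    congr 1
    ext z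
    simp [and_comm]
  have hsum : (2 : ℝ) ^ k * Real.exp (lam * mx S H) ≤ ∑ x, iter k v (g0 S lam) x := by
    calc (2 : ℝ) ^ k * Real.exp (lam * mx S H)
        = ∑ x ∈ Finset.univ.filter (fun x => H x = y), Real.exp (lam * mx S H) := by
          rw [Finset.sum_const, card_fib k ℓ hG hY H hH y]
          simp
      _ = ∑ x ∈ Finset.univ.filter (fun x => H x = y), iter k v (g0 S lam) x := by
          refine Finset.sum_congr rfl fun x hx => ?_
          rw [hval, (Finset.mem_filter.mp hx).2, hmx]
      _ ≤ ∑ x, iter k v (g0 S lam) x := by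
          apply Finset.sum_le_sum_of_subset_of_nonneg (Finset.filter_subset _ _)
          intro x _ _
          rw [hval]
          positivity
  unfold av
  rw [hG]
  push_cast
  rw [← mul_div_assoc, le_div_iff₀ (by positivity), pow_add]
  have : (0 : ℝ) < 2 ^ ℓ := by positivity
  nlinarith

lemma finrank_of_card {V : Type*} [AddCommGroup V] [Fintype V] [Module (ZMod 2) V] (n : ℕ)
    (h : Fintype.card V = 2 ^ n) : Module.finrank (ZMod 2) V = n := by
  have h1 := Module.card_eq_pow_finrank (K := ZMod 2) (V := V)
  rw [ZMod.card, h] at h1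
  exact (Nat.pow_right_injective le_rfl h1).symm

lemma prod_ge (k : ℕ) : (1 / 4 : ℝ) * 2 ^ (k * k) ≤
    ((∏ i : Fin k, (2 ^ k - 2 ^ i.val) : ℕ) : ℝ) := by
  have h1 : ((∏ i : Fin k, (2 ^ k - 2 ^ i.val) : ℕ) : ℝ) =
      ∏ i ∈ Finset.range k, ((2 : ℝ) ^ k * (1 - (1 / 2) ^ (i + 1))) := by
    rw [Fin.prod_univ_eq_prod_range (fun i => 2 ^ k - 2 ^ i) k, ← Finset.prod_range_reflect]
    push_cast
    refine Finset.prod_congr rfl fun i hi => ?_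
    have hi := Finset.mem_range.mp hi
    rw [Nat.cast_sub (Nat.pow_le_pow_right (by norm_num) (by omega))]
    push_cast
    rw [mul_sub, mul_one]
    congr 1
    have : (2 : ℝ) ^ k = 2 ^ (k - 1 - i) * 2 ^ (i + 1) := by
      rw [← pow_add]; congr 1; omega
    rw [this, mul_assoc, ← mul_pow]
    norm_num
  have h2 : ∀ n : ℕ, 1 / 4 + (1 / 2 : ℝ) ^ (n + 2) ≤
      ∏ i ∈ Finset.range (n + 1), (1 - (1 / 2 : ℝ) ^ (i + 1)) := by
    intro n
    induction n with
    | zero => norm_num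
    | succ n ih =>
      rw [Finset.prod_range_succ]
      have h3 : (1 / 2 : ℝ) ^ (n + 2) ≤ 1 / 4 := by
        rw [pow_add]
        have : (1 / 2 : ℝ) ^ n ≤ 1 := pow_le_one₀ (by norm_num) (by norm_num)
        norm_num
        linarith
      have h4 : (0 : ℝ) ≤ (1 / 2 : ℝ) ^ (n + 2) := by positivity
      have h5 := mul_le_mul_of_nonneg_right ih
        (show (0 : ℝ) ≤ 1 - (1 / 2 : ℝ) ^ (n + 1 + 1) by
          have : n + 1 + 1 = n + 2 := rfl
          rw [this]; linarith)
      refine le_trans ?_ h5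
      rw [show n + 1 + 1 = n + 2 from rfl, show n + 1 + 2 = n + 2 + 1 from rfl,
        pow_succ _ (n + 2)]
      nlinarith
  rw [h1, Finset.prod_mul_distrib, Finset.prod_const, Finset.card_range, ← pow_mul, mul_comm]
  gcongr
  cases k with
  | zero => norm_num
  | succ n =>
    refine le_trans ?_ (h2 n)
    have : (0 : ℝ) ≤ (1 / 2 : ℝ) ^ (n + 2) := by positivity
    linarith

open Classical in
lemma key2 (k ℓ : ℕ) (hG : Fintype.card G = 2 ^ (k + ℓ)) (hY : Fintype.card Y = 2 ^ ℓ)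
    (H : G →ₗ[ZMod 2] Y) (hH : Function.Surjective H) :
    (1 / 4 : ℝ) * 2 ^ (k * k) ≤ ((Finset.univ.filter fun v : Fin k → G =>
      LinearIndependent (ZMod 2) v ∧ ∀ i, H (v i) = 0).card : ℝ) := by
  refine (prod_ge k).trans ?_
  have hker : Module.finrank (ZMod 2) (LinearMap.ker H) = k := by
    have h1 := LinearMap.finrank_range_add_finrank_ker H
    rw [LinearMap.range_eq_top.mpr hH, finrank_top, finrank_of_card _ hG, finrank_of_card _ hY] at h1
    omega
  have h2 := card_linearIndependent (K := ZMod 2) (V := LinearMap.ker H) (k := k) hker.ge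
  rw [hker, ZMod.card] at h2
  rw [← h2, Nat.card_eq_fintype_card, Fintype.card_subtype]
  norm_cast
  refine Finset.card_le_card_of_injOn (fun s i => (s i : G)) ?_ ?_
  · intro s hs
    have hs' : LinearIndependent (ZMod 2) s := by simpa using hs
    simp only [Finset.coe_filter, Finset.mem_univ, true_and, Set.mem_ofPred_eq]
    refine ⟨hs'.map' (LinearMap.ker H).subtype (Submodule.ker_subtype _), fun i => ?_⟩
    exact (s i).2
  · intro s _ s' _ h
    funext i
    exact Subtype.ext (congrFun h i)

open Classical in
lemma key3 [Fintype (G →ₗ[ZMod 2] Y)] (k ℓ : ℕ) (hG : Fintype.card G = 2 ^ (k + ℓ))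
    (hY : Fintype.card Y = 2 ^ ℓ) (v : Fin k → G) (hv : LinearIndependent (ZMod 2) v) :
    (Finset.univ.filter fun H : G →ₗ[ZMod 2] Y => ∀ i, H (v i) = 0).card ≤ 2 ^ (ℓ * ℓ) := by
  set W := Submodule.span (ZMod 2) (Set.range v) with hW
  have hWr : Module.finrank (ZMod 2) W = k := by
    rw [hW, finrank_span_eq_card hv, Fintype.card_fin]
  have hq : Module.finrank (ZMod 2) (G ⧸ W) = ℓ := by
    have := Submodule.finrank_quotient_add_finrank W
    rw [hWr, finrank_of_card _ hG] at this
    omega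
  have : Finite ((G ⧸ W) →ₗ[ZMod 2] Y) := DFunLike.finite _
  have hc : Nat.card ((G ⧸ W) →ₗ[ZMod 2] Y) = 2 ^ (ℓ * ℓ) := by
    rw [Module.natCard_eq_pow_finrank (K := ZMod 2), Module.finrank_linearMap, hq,
      finrank_of_card _ hY]
    simp
  rw [← hc, ← Fintype.card_subtype, ← Nat.card_eq_fintype_card]
  have hle : ∀ H : {H : G →ₗ[ZMod 2] Y // ∀ i, H (v i) = 0}, W ≤ LinearMap.ker H.1 := by
    intro H
    rw [hW, Submodule.span_le]
    rintro _ ⟨i, rfl⟩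
    exact H.2 i
  refine Nat.card_le_card_of_injective (fun H => W.liftQ H.1 (hle H)) ?_
  intro H H' h
  apply Subtype.ext
  ext x
  have := congrArg (fun f => f (Submodule.Quotient.mk x)) h
  simpa using this

open Classical in
lemma card_hom [Fintype (G →ₗ[ZMod 2] Y)] (n ℓ : ℕ) (hG : Fintype.card G = 2 ^ n)
    (hY : Fintype.card Y = 2 ^ ℓ) : Fintype.card (G →ₗ[ZMod 2] Y) = 2 ^ (n * ℓ) := by
  rw [← Nat.card_eq_fintype_card, Module.natCard_eq_pow_finrank (K := ZMod 2),
    Module.finrank_linearMap, finrank_of_card _ hG, finrank_of_card _ hY]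
  simp

open Classical in
lemma tail [Fintype (G →ₗ[ZMod 2] Y)] (k ℓ m : ℕ) (hm : m ≤ k)
    (hG : Fintype.card G = 2 ^ (k + ℓ)) (hY : Fintype.card Y = 2 ^ ℓ)
    (S : Finset G) (hS : S.card = 2 ^ ℓ) (lam s μ : ℝ) (hlam : 0 ≤ lam)
    (hμ : ℓ * Real.log 2 + 2 ^ m * s ≤ lam * μ) :
    ((Finset.univ.filter fun H : G →ₗ[ZMod 2] Y => Function.Surjective H ∧ μ ≤ mx S H).card : ℝ)
      ≤ 4 * (2 * Real.exp (-s) + 3 * (Real.exp lam / 2 ^ m) ^ 2) *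
        (Fintype.card (G →ₗ[ZMod 2] Y) : ℝ) := by
  set F : (G → ℝ) → ℝ := fun g => if Real.exp (2 ^ m * s) ≤ av g then 1 else 0 with hF
  have hp := process_tail (k - m) m s (g0 S lam) (g0_ge hlam) F
    (by intro g; simp only [hF]; split_ifs <;> norm_num)
    (by
      intro g hg
      simp only [hF]
      have h1 := one_le_av hg
      split_ifs with h
      · have h2 : Real.exp s ≤ av g ^ ((1 / 2 : ℝ) ^ m) := by
          calc Real.exp s = Real.exp (2 ^ m * s) ^ ((1 / 2 : ℝ) ^ m) := by
                rw [← Real.exp_mul]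
                congr 1
                have : (2 : ℝ) ^ m * (1 / 2) ^ m = 1 := by rw [← mul_pow]; norm_num
                linear_combination (-s) * this
            _ ≤ _ := Real.rpow_le_rpow (Real.exp_pos _).le h (by positivity)
        calc (1 : ℝ) = Real.exp (-s) * Real.exp s := by rw [← Real.exp_add]; simp
          _ ≤ _ := by gcongr
      · positivity)
  rw [Nat.sub_add_cancel hm, av_g0 S lam k ℓ hG hS] at hp
  have hq : (2 ^ (k - m) * ((1 / 2 : ℝ) ^ k * (Real.exp lam - 1))) ^ 2 ≤
      (Real.exp lam / 2 ^ m) ^ 2 := by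
    have h1 : (2 : ℝ) ^ (k - m) * ((1 / 2 : ℝ) ^ k * (Real.exp lam - 1)) =
        (Real.exp lam - 1) / 2 ^ m := by
      have : (2 : ℝ) ^ k = 2 ^ (k - m) * 2 ^ m := by rw [← pow_add]; congr 1; omega
      rw [div_pow, one_pow, this]
      field_simp
    rw [h1]
    have := Real.one_le_exp hlam
    gcongr
    linarith
  have hR : R k F (g0 S lam) ≤ 2 * Real.exp (-s) + 3 * (Real.exp lam / 2 ^ m) ^ 2 := by linarith
  set E := 2 * Real.exp (-s) + 3 * (Real.exp lam / 2 ^ m) ^ 2 with hE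
  rw [R_eq_sum, hG, div_le_iff₀ (by positivity)] at hR
  set Bad := Finset.univ.filter fun v : Fin k → G =>
    Real.exp (2 ^ m * s) ≤ av (iter k v (g0 S lam)) with hBad
  have hR2 : (Bad.card : ℝ) ≤ E * 2 ^ ((k + ℓ) * k) := by
    have : ∑ v : Fin k → G, F (iter k v (g0 S lam)) = (Bad.card : ℝ) := by
      simp [hF, hBad]
    rw [this] at hR
    push_cast at hR
    rwa [← pow_mul] at hR
  set A := Finset.univ.filter fun H : G →ₗ[ZMod 2] Y => Function.Surjective H ∧ μ ≤ mx S H with hA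
  -- double counting
  have hdc : (A.card : ℝ) * ((1 / 4 : ℝ) * 2 ^ (k * k)) ≤ (Bad.card : ℝ) * 2 ^ (ℓ * ℓ) := by
    have e1 : (A.card : ℝ) * ((1 / 4 : ℝ) * 2 ^ (k * k)) ≤ ∑ H ∈ A,
        ((Finset.univ.filter fun v : Fin k → G =>
          LinearIndependent (ZMod 2) v ∧ ∀ i, H (v i) = 0).card : ℝ) := by
      rw [← nsmul_eq_mul]
      apply Finset.card_nsmul_le_sum
      intro H hH
      exact key2 k ℓ hG hY H (Finset.mem_filter.mp hH).2.1
    have e2 : ∑ H ∈ A, (Finset.univ.filter fun v : Fin k → G =>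
          LinearIndependent (ZMod 2) v ∧ ∀ i, H (v i) = 0).card ≤
        ∑ v ∈ Bad.filter (fun v => LinearIndependent (ZMod 2) v),
          (Finset.univ.filter fun H : G →ₗ[ZMod 2] Y => ∀ i, H (v i) = 0).card := by
      rw [← Finset.card_sigma, ← Finset.card_sigma]
      refine Finset.card_le_card_of_injOn (fun p => ⟨p.2, p.1⟩) ?_ ?_
      · rintro ⟨H, v⟩ hp
        simp only [Finset.coe_sigma, Set.mem_sigma_iff, Finset.mem_coe, hA, Finset.mem_filter,
          Finset.mem_univ, true_and] at hp
        obtain ⟨⟨hs, hmu⟩, hli, hz⟩ := hp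
        simp only [Finset.coe_sigma, Set.mem_sigma_iff, Finset.mem_coe, hBad, Finset.mem_filter,
          Finset.mem_univ, true_and]
        refine ⟨⟨?_, hli⟩, hz⟩
        have h1 := key1 k ℓ hG hY H hs v hli hz S lam
        have h2 : Real.exp (ℓ * Real.log 2 + 2 ^ m * s) ≤ Real.exp (lam * mx S H) := by
          apply Real.exp_le_exp.mpr
          refine hμ.trans ?_
          gcongr
        rw [Real.exp_add, mul_comm (ℓ : ℝ), Real.exp_mul, Real.exp_log (by norm_num),
          Real.rpow_natCast] at h2
        exact le_of_mul_le_mul_left (h2.trans h1) (by positivity)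
      · rintro ⟨H, v⟩ _ ⟨H', v'⟩ _ h
        simp only [Sigma.mk.injEq, heq_eq_eq] at h ⊢
        exact ⟨h.2, h.1⟩
    have e3 : ∑ v ∈ Bad.filter (fun v => LinearIndependent (ZMod 2) v),
          (Finset.univ.filter fun H : G →ₗ[ZMod 2] Y => ∀ i, H (v i) = 0).card ≤
        Bad.card * 2 ^ (ℓ * ℓ) := by
      refine (Finset.sum_le_card_nsmul _ _ (2 ^ (ℓ * ℓ)) ?_).trans ?_
      · intro v hv
        exact key3 k ℓ hG hY v (Finset.mem_filter.mp hv).2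
      · rw [smul_eq_mul]
        gcongr
        exact Finset.filter_subset _ _
    refine e1.trans ?_
    exact_mod_cast e2.trans e3
  rw [card_hom (k + ℓ) ℓ hG hY]
  push_cast
  have h1 : (A.card : ℝ) * ((1 / 4 : ℝ) * 2 ^ (k * k)) ≤ E * 2 ^ ((k + ℓ) * k) * 2 ^ (ℓ * ℓ) :=
    hdc.trans (by gcongr)
  have h2 : (2 : ℝ) ^ ((k + ℓ) * k) * 2 ^ (ℓ * ℓ) = 2 ^ ((k + ℓ) * ℓ) * 2 ^ (k * k) := by
    rw [← pow_add, ← pow_add]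
    congr 1
    ring
  have h3 : (0 : ℝ) < 2 ^ (k * k) := by positivity
  rw [mul_assoc, h2] at h1
  refine le_of_mul_le_mul_right ?_ h3
  linarith

open Classical in
lemma nonsurj [Fintype (G →ₗ[ZMod 2] Y)] (n ℓ : ℕ) (hG : Fintype.card G = 2 ^ n)
    (hY : Fintype.card Y = 2 ^ ℓ) :
    ((Finset.univ.filter fun H : G →ₗ[ZMod 2] Y => ¬ Function.Surjective H).card : ℝ) * 2 ^ n
      ≤ 2 ^ ℓ * (Fintype.card (G →ₗ[ZMod 2] Y) : ℝ) := by
  have : Finite (Y →ₗ[ZMod 2] ZMod 2) := DFunLike.finite _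
  have : Finite (G →ₗ[ZMod 2] ZMod 2) := DFunLike.finite _
  let _ : Fintype (Y →ₗ[ZMod 2] ZMod 2) := Fintype.ofFinite _
  let _ : Fintype (G →ₗ[ZMod 2] ZMod 2) := Fintype.ofFinite _
  have hdual : Fintype.card (Y →ₗ[ZMod 2] ZMod 2) = 2 ^ ℓ := by
    have := card_hom (G := Y) (Y := ZMod 2) ℓ 1 hY (by simp [ZMod.card])
    simpa using this
  have hdualG : Fintype.card (G →ₗ[ZMod 2] ZMod 2) = 2 ^ n := by
    have := card_hom (G := G) (Y := ZMod 2) n 1 hG (by simp [ZMod.card])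
    simpa using this
  have hone : ∀ φ : Y →ₗ[ZMod 2] ZMod 2, φ ≠ 0 →
      (Finset.univ.filter fun H : G →ₗ[ZMod 2] Y => φ ∘ₗ H = 0).card * 2 ^ n =
        Fintype.card (G →ₗ[ZMod 2] Y) := by
    intro φ hφ
    have hsurj : Function.Surjective φ := LinearMap.surjective hφ
    obtain ⟨y, hy⟩ := hsurj 1
    let comp : (G →ₗ[ZMod 2] Y) →+ (G →ₗ[ZMod 2] ZMod 2) :=
      { toFun := fun H => φ ∘ₗ H
        map_zero' := by simp
        map_add' := fun a b => by ext; simp }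
    have hcs : Function.Surjective comp := by
      intro ψ
      refine ⟨(LinearMap.toSpanSingleton (ZMod 2) Y y) ∘ₗ ψ, ?_⟩
      ext x
      simp [comp, hy]
    have h1 : ∀ ψ, (Finset.univ.filter fun H => comp H = ψ).card =
        (Finset.univ.filter fun H => comp H = 0).card := fun ψ =>
      AddMonoidHom.card_fiber_eq_of_mem_range comp (hcs _) (hcs _)
    have h2 := Finset.card_eq_sum_card_fiberwise (f := comp) (s := Finset.univ) (t := Finset.univ)
      (fun _ _ => Finset.mem_coe.mpr (Finset.mem_univ _))
    simp only [h1] at h2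
    rw [Finset.sum_const, Finset.card_univ, Finset.card_univ, hdualG, smul_eq_mul] at h2
    rw [h2, mul_comm]
    rfl
  have hcover : (Finset.univ.filter fun H : G →ₗ[ZMod 2] Y => ¬ Function.Surjective H) ⊆
      (Finset.univ.filter fun φ : Y →ₗ[ZMod 2] ZMod 2 => φ ≠ 0).biUnion
        (fun φ => Finset.univ.filter fun H : G →ₗ[ZMod 2] Y => φ ∘ₗ H = 0) := by
    intro H hH
    simp only [Finset.mem_filter, Finset.mem_univ, true_and] at hH
    have hlt : LinearMap.range H < ⊤ := lt_top_iff_ne_top.mpr fun h =>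
      hH (LinearMap.range_eq_top.mp h)
    obtain ⟨φ, hφ, hle⟩ := Submodule.exists_le_ker_of_lt_top _ hlt
    simp only [Finset.mem_biUnion, Finset.mem_filter, Finset.mem_univ, true_and]
    exact ⟨φ, hφ, LinearMap.range_le_ker_iff.mp hle⟩
  have h3 : (Finset.univ.filter fun H : G →ₗ[ZMod 2] Y => ¬ Function.Surjective H).card * 2 ^ n ≤
      2 ^ ℓ * Fintype.card (G →ₗ[ZMod 2] Y) := by
    calc _ ≤ (∑ φ ∈ (Finset.univ.filter fun φ : Y →ₗ[ZMod 2] ZMod 2 => φ ≠ 0),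
        (Finset.univ.filter fun H : G →ₗ[ZMod 2] Y => φ ∘ₗ H = 0).card) * 2 ^ n := by
          gcongr
          exact (Finset.card_le_card hcover).trans Finset.card_biUnion_le
      _ = ∑ φ ∈ (Finset.univ.filter fun φ : Y →ₗ[ZMod 2] ZMod 2 => φ ≠ 0),
          Fintype.card (G →ₗ[ZMod 2] Y) := by
          rw [Finset.sum_mul]
          refine Finset.sum_congr rfl fun φ hφ => hone φ (Finset.mem_filter.mp hφ).2
      _ ≤ _ := by
          rw [Finset.sum_const, smul_eq_mul, ← hdual]
          gcongr
          exact Finset.card_le_univ _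
  exact_mod_cast h3

end linalg
section analysis
open Filter Real

lemma exists_m {t : ℝ} (ht : 1 ≤ t) : ∃ m : ℕ, (2 : ℝ) ^ m ≤ t ∧ t < 2 ^ (m + 1) :=
  exists_nat_pow_near ht (by norm_num)

noncomputable def BB (c x : ℝ) : ℝ := 8 * exp (-(c * x)) + 48 * c ^ 2 * x ^ 2 * exp (-((c - 1) * x))

noncomputable def TT (c : ℝ) (L : ℝ) : ℝ :=
  (1 + c * Real.log (Real.log L) / Real.log L) * (L * Real.log 2 / Real.log L)

lemma paramA (c : ℝ) (hc : 1 < c) : ∀ᶠ x : ℝ in atTop, ∀ ℓ : ℕ, (ℓ : ℝ) = exp (exp x) →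
    ∃ m : ℕ, m ≤ ℓ ∧ ∃ lam s : ℝ, 0 ≤ lam ∧ ℓ * Real.log 2 + 2 ^ m * s ≤ lam * TT c ℓ ∧
      4 * (2 * exp (-s) + 3 * (exp lam / 2 ^ m) ^ 2) ≤ BB c x := by
  have t0 : Tendsto (fun x : ℝ => x * exp (-x)) atTop (nhds 0) := by
    simpa using Real.tendsto_pow_mul_exp_neg_atTop_nhds_zero 1
  have e1 : ∀ᶠ x : ℝ in atTop, x * exp (-x) < (c - 1) / (2 * (c * (c + 1))) :=
    t0.eventually (gt_mem_nhds (by apply div_pos <;> nlinarith))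
  have e2 : ∀ᶠ x : ℝ in atTop, x * exp (-x) < 2 / (c + 1) :=
    t0.eventually (gt_mem_nhds (by positivity))
  have e3 : ∀ᶠ x : ℝ in atTop, exp x * exp (-exp x) < 1 / (c + 1) :=
    (t0.comp tendsto_exp_atTop).eventually (gt_mem_nhds (by positivity))
  have t4 : Tendsto (fun y : ℝ => y ^ 2 * exp (-y)) atTop (nhds 0) :=
    Real.tendsto_pow_mul_exp_neg_atTop_nhds_zero 2
  have e4 : ∀ᶠ x : ℝ in atTop, (exp x) ^ 2 * exp (-exp x) < 1 / (c + 1) :=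
    (t4.comp tendsto_exp_atTop).eventually (gt_mem_nhds (by positivity))
  have e5 : ∀ᶠ x : ℝ in atTop, 4 / (Real.log 2 * (c - 1)) < x := eventually_gt_atTop _
  filter_upwards [e1, e2, e4, e5, eventually_gt_atTop (1 : ℝ)] with x h1 h2 h4 h5 h6 ℓ hℓ
  have hl2 : 0 < Real.log 2 := Real.log_pos (by norm_num)
  set Λ := exp x with hΛ
  have hΛ0 : 0 < Λ := exp_pos x
  have hxΛ : x + 1 ≤ Λ := add_one_le_exp x
  have hneg : exp (-x) = 1 / Λ := by rw [exp_neg, one_div]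
  have hnegΛ : exp (-Λ) = 1 / ℓ := by rw [exp_neg, one_div, hℓ]
  have hℓ0 : (0 : ℝ) < ℓ := by rw [hℓ]; exact exp_pos _
  have hlogℓ : Real.log ℓ = Λ := by rw [hℓ, Real.log_exp]
  have hloglog : Real.log Λ = x := by rw [hΛ, Real.log_exp]
  set s := c * x with hs
  have hs1 : 1 ≤ s := by nlinarith
  have hs0 : 0 < s := by linarith
  have hΛs : 1 ≤ Λ * s := by nlinarith
  have ht : 1 ≤ ℓ / (Λ * s) := by
    rw [le_div_iff₀ (by positivity), one_mul]
    rw [hnegΛ, mul_one_div, div_lt_div_iff₀ hℓ0 (by positivity)] at h4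
    nlinarith
  obtain ⟨m, hm1, hm2⟩ := exists_m ht
  have hmℓ : m ≤ ℓ := by
    have h7 : (2 : ℝ) ^ m ≤ ℓ := hm1.trans (div_le_self hℓ0.le hΛs)
    have h8 : 2 ^ m ≤ ℓ := by exact_mod_cast h7
    exact (Nat.lt_two_pow_self).le.trans h8
  refine ⟨m, hmℓ, Λ - (c + 1) / 2 * x, s, ?_, ?_, ?_⟩
  · rw [hneg, mul_one_div, div_lt_div_iff₀ hΛ0 (by positivity)] at h2
    linarith
  · unfold TT
    rw [hlogℓ, hloglog]
    have h7 : (2 : ℝ) ^ m * s ≤ ℓ / Λ := by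
      calc (2 : ℝ) ^ m * s ≤ ℓ / (Λ * s) * s := by gcongr
        _ = ℓ / Λ := by field_simp
    refine (add_le_add le_rfl h7).trans ?_
    have h8 : (Λ - (c + 1) / 2 * x) * ((1 + c * x / Λ) * (ℓ * Real.log 2 / Λ)) =
        ℓ * Real.log 2 + ℓ / Λ * (Real.log 2 * x * ((c - 1) / 2 - c * (c + 1) / 2 * (x / Λ))) := by
      field_simp
      ring
    rw [h8]
    have h9 : 1 ≤ Real.log 2 * x * ((c - 1) / 2 - c * (c + 1) / 2 * (x / Λ)) := by
      rw [hneg, mul_one_div, lt_div_iff₀ (by positivity)] at h1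
      have h10 : (c - 1) / 4 ≤ (c - 1) / 2 - c * (c + 1) / 2 * (x / Λ) := by linarith
      have hc1 : 0 < c - 1 := by linarith
      rw [div_lt_iff₀ (by positivity)] at h5
      have h11 : 0 < Real.log 2 * x := by positivity
      nlinarith
    have h10 : 0 < ℓ / Λ := by positivity
    nlinarith
  · unfold BB
    have h7 : exp (Λ - (c + 1) / 2 * x) / 2 ^ m ≤ 2 * s * exp (-((c - 1) / 2 * x)) := by
      rw [div_le_iff₀ (by positivity)]
      have h8 : (ℓ : ℝ) ≤ 2 * 2 ^ m * (Λ * s) := by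
        rw [div_lt_iff₀ (by positivity), pow_succ] at hm2
        linarith
      calc exp (Λ - (c + 1) / 2 * x) = ℓ * exp (-((c + 1) / 2 * x)) := by
            rw [hℓ, ← exp_add]; congr 1
        _ ≤ 2 * 2 ^ m * (Λ * s) * exp (-((c + 1) / 2 * x)) := by gcongr
        _ = 2 * s * (exp x * exp (-((c + 1) / 2 * x))) * 2 ^ m := by rw [hΛ]; ring
        _ = 2 * s * exp (-((c - 1) / 2 * x)) * 2 ^ m := by
            rw [← exp_add]; congr 3; ring
    have h8 : (exp (Λ - (c + 1) / 2 * x) / 2 ^ m) ^ 2 ≤ (2 * s * exp (-((c - 1) / 2 * x))) ^ 2 := by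
      gcongr
    have h9 : (2 * s * exp (-((c - 1) / 2 * x))) ^ 2 = 4 * c ^ 2 * x ^ 2 * exp (-((c - 1) * x)) := by
      rw [mul_pow, ← exp_nat_mul, hs]
      push_cast
      rw [show 2 * -((c - 1) / 2 * x) = -((c - 1) * x) by ring]
      ring
    rw [h9] at h8
    linarith

lemma paramB : ∀ᶠ ℓ : ℕ in atTop, ∀ n : ℕ, 2 * ℓ ≤ n → n ≤ 2 ^ ℓ →
    ∃ m : ℕ, m ≤ ℓ ∧ ∃ s : ℝ, ℓ * Real.log 2 + 2 ^ m * s ≤ 1 * (n : ℝ) ∧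
      4 * (2 * exp (-s) + 3 * (exp 1 / 2 ^ m) ^ 2) ≤ 200000 * (n : ℝ) ^ (-(3 / 2) : ℝ) := by
  have e1 : ∀ᶠ y : ℝ in atTop, Real.log y ≤ 1 / 4 * y := by
    have := (Real.isLittleO_log_id_atTop).bound (show (0 : ℝ) < 1 / 4 by norm_num)
    filter_upwards [this, eventually_ge_atTop (1 : ℝ)] with y hy h1
    simp only [id, norm_eq_abs] at hy
    rw [abs_of_nonneg (Real.log_nonneg h1), abs_of_nonneg (by linarith)] at hy
    exact hy
  obtain ⟨y0, hy0⟩ := eventually_atTop.mp e1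
  filter_upwards [eventually_ge_atTop (⌈y0⌉₊ + 3)] with ℓ hℓ n hn hn2
  have hny : y0 ≤ n := by
    refine (Nat.le_ceil y0).trans ?_
    exact_mod_cast (by omega : ⌈y0⌉₊ ≤ n)
  have hlog := hy0 n hny
  have hn6 : (6 : ℝ) ≤ n := by exact_mod_cast (by omega : 6 ≤ n)
  have hn0 : (0 : ℝ) < n := by linarith
  have hl1 : 1 ≤ Real.log n := by
    rw [Real.le_log_iff_exp_le hn0]
    have := Real.exp_one_lt_d9
    linarith
  have ht : 1 ≤ (n : ℝ) / (4 * Real.log n) := by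
    rw [le_div_iff₀ (by positivity)]
    linarith
  obtain ⟨m, hm1, hm2⟩ := exists_m ht
  have hmℓ : m ≤ ℓ := by
    have h7 : (2 : ℝ) ^ m ≤ n := hm1.trans (div_le_self hn0.le (by linarith))
    have h8 : 2 ^ m ≤ n := by exact_mod_cast h7
    exact (Nat.pow_le_pow_iff_right (by norm_num)).mp (h8.trans hn2)
  refine ⟨m, hmℓ, 2 * Real.log n, ?_, ?_⟩
  · have h1 : (2 : ℝ) ^ m * (2 * Real.log n) ≤ n / 2 := by
      calc (2 : ℝ) ^ m * (2 * Real.log n) ≤ (n : ℝ) / (4 * Real.log n) * (2 * Real.log n) := by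
            gcongr
        _ = n / 2 := by field_simp; ring
    have h2 : (2 : ℝ) * ℓ ≤ n := by exact_mod_cast hn
    have h3 := Real.log_two_lt_d9
    have h4 : (0 : ℝ) ≤ ℓ := by positivity
    nlinarith
  · have hr : (n : ℝ) ^ (-(3 / 2) : ℝ) = (n : ℝ) ^ (1 / 2 : ℝ) / n ^ 2 := by
      rw [← Real.rpow_natCast, ← Real.rpow_sub hn0]
      norm_num
    rw [hr]
    set w := (n : ℝ) ^ (1 / 2 : ℝ) with hw
    have hw1 : 1 ≤ w := Real.one_le_rpow (by linarith) (by norm_num)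
    have h1 : exp (-(2 * Real.log n)) = 1 / (n : ℝ) ^ 2 := by
      rw [exp_neg, mul_comm, exp_mul, Real.exp_log hn0, one_div]
      norm_cast
    have h2 : exp 1 / 2 ^ m ≤ 24 * Real.log n / n := by
      rw [div_lt_iff₀ (by positivity), pow_succ] at hm2
      rw [div_le_div_iff₀ (by positivity) hn0]
      have := Real.exp_one_lt_d9
      nlinarith
    have h3 : Real.log n ^ 2 ≤ 16 * w := by
      have h4 := Real.log_le_rpow_div hn0.le (show (0 : ℝ) < 1 / 4 by norm_num)
      have h5 : ((n : ℝ) ^ (1 / 4 : ℝ)) ^ 2 = w := by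
        rw [← Real.rpow_natCast, ← Real.rpow_mul hn0.le]
        norm_num [hw]
      calc Real.log n ^ 2 ≤ ((n : ℝ) ^ (1 / 4 : ℝ) / (1 / 4)) ^ 2 := by gcongr
        _ = 16 * w := by rw [div_pow, h5]; ring
    have h4 : (exp 1 / 2 ^ m) ^ 2 ≤ 9216 * w / n ^ 2 := by
      calc (exp 1 / 2 ^ m) ^ 2 ≤ (24 * Real.log n / n) ^ 2 := by gcongr
        _ = 576 * Real.log n ^ 2 / n ^ 2 := by ring
        _ ≤ 576 * (16 * w) / n ^ 2 := by gcongr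
        _ = _ := by ring
    rw [h1]
    have h5 : 1 / (n : ℝ) ^ 2 ≤ w / n ^ 2 := by gcongr
    have h6 : 9216 * w / (n : ℝ) ^ 2 = 9216 * (w / n ^ 2) := by ring
    have h7 : 0 ≤ w / (n : ℝ) ^ 2 := by positivity
    rw [h6] at h4
    linarith

/-- final numerical comparison -/
lemma numeric (ε D : ℝ) (hε : 0 < ε) : ∀ᶠ x : ℝ in atTop, ∀ L : ℝ, L = exp (exp x) →
    TT (1 + ε / 2) L + D + (TT (10 + ε / 2) L - TT (1 + ε / 2) L) * BB (1 + ε / 2) x +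
      2 * L * BB (10 + ε / 2) x ≤ TT (1 + ε) L := by
  have hl2 : 0 < Real.log 2 := Real.log_pos (by norm_num)
  have texp : ∀ (p : ℕ) (a : ℝ), 0 < a → Tendsto (fun x : ℝ => x ^ p * exp (-(a * x))) atTop (nhds 0) := by
    intro p a ha
    have h1 := (Real.tendsto_pow_mul_exp_neg_atTop_nhds_zero p).comp
      (tendsto_id.const_mul_atTop ha)
    have h2 := h1.const_mul ((1 / a) ^ p)
    rw [mul_zero] at h2
    refine h2.congr fun x => ?_
    simp only [Function.comp, id, mul_pow]
    rw [← mul_assoc, ← mul_assoc, ← mul_pow, one_div, inv_mul_cancel₀ ha.ne', one_pow, one_mul]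
  have tB : ∀ (c a : ℝ), 1 + a < c → 0 ≤ a →
      Tendsto (fun x => BB c x * exp (a * x)) atTop (nhds 0) := by
    intro c a hc ha
    have h1 := ((texp 0 (c - a) (by linarith)).const_mul 8).add
      ((texp 2 (c - 1 - a) (by linarith)).const_mul (48 * c ^ 2))
    simp only [mul_zero, add_zero] at h1
    refine h1.congr fun x => ?_
    unfold BB
    rw [add_mul, mul_assoc 8, mul_assoc _ (exp _) (exp _), ← exp_add, ← exp_add]
    rw [show -(c * x) + a * x = -((c - a) * x) by ring,
      show -((c - 1) * x) + a * x = -((c - 1 - a) * x) by ring]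
    ring
  have e1 : ∀ᶠ x : ℝ in atTop, BB (1 + ε / 2) x * exp (0 * x) < ε / 54 :=
    (tB _ 0 (by linarith) le_rfl).eventually (gt_mem_nhds (by positivity))
  have e2 : ∀ᶠ x : ℝ in atTop, BB (10 + ε / 2) x * exp (2 * x) < ε * Real.log 2 / 12 :=
    (tB _ 2 (by linarith) (by norm_num)).eventually (gt_mem_nhds (by positivity))
  have e3 : ∀ᶠ x : ℝ in atTop, 6 * D / (ε * Real.log 2) ≤ exp (exp x) / exp x ^ 2 :=
    ((Real.tendsto_exp_div_pow_atTop 2).comp tendsto_exp_atTop).eventually (eventually_ge_atTop _)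
  filter_upwards [e1, e2, e3, eventually_ge_atTop (1 : ℝ)] with x h1 h2 h3 h4 L hL
  rw [zero_mul, exp_zero, mul_one] at h1
  have hL0 : 0 < L := by rw [hL]; exact exp_pos _
  have hlogL : Real.log L = exp x := by rw [hL, Real.log_exp]
  rw [← hL] at h3
  set Λ := exp x with hΛ
  have hΛ0 : 0 < Λ := exp_pos x
  set U := L * Real.log 2 * x / Λ ^ 2 with hU
  have hU0 : 0 < U := by positivity
  have hT : ∀ c, TT c L = L * Real.log 2 / Λ + c * U := by
    intro c
    unfold TT
    rw [hlogL, hΛ, Real.log_exp, ← hΛ, hU]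
    field_simp
  rw [hT, hT, hT]
  have h5 : 2 * L * BB (10 + ε / 2) x ≤ ε / 6 * U := by
    have h6 : exp (2 * x) = Λ ^ 2 := by rw [hΛ, ← exp_nat_mul]; norm_num
    rw [h6, ← lt_div_iff₀ (by positivity)] at h2
    have h7 : BB (10 + ε / 2) x ≤ ε * Real.log 2 / 12 / Λ ^ 2 * x := by
      refine h2.le.trans ?_
      apply le_mul_of_one_le_right (by positivity) h4
    calc 2 * L * BB (10 + ε / 2) x ≤ 2 * L * (ε * Real.log 2 / 12 / Λ ^ 2 * x) := by gcongr
      _ = ε / 6 * U := by rw [hU]; ring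
  have h6 : D ≤ ε / 6 * U := by
    rw [div_le_iff₀ (by positivity)] at h3
    have h7 : L / Λ ^ 2 * (ε * Real.log 2) ≤ L / Λ ^ 2 * (ε * Real.log 2) * x :=
      le_mul_of_one_le_right (by positivity) h4
    have h8 : L / Λ ^ 2 * (ε * Real.log 2) * x = ε * U := by rw [hU]; ring
    linarith
  have h7 : (9 * U) * BB (1 + ε / 2) x ≤ (9 * U) * (ε / 54) := by gcongr
  have h8 : L * Real.log 2 / Λ + (10 + ε / 2) * U - (L * Real.log 2 / Λ + (1 + ε / 2) * U) = 9 * U := by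
    ring
  rw [h8]
  linarith

end analysis
section assembly
variable {G Y : Type*} [AddCommGroup G] [Fintype G] [DecidableEq G] [Module (ZMod 2) G]
  [AddCommGroup Y] [Fintype Y] [DecidableEq Y] [Module (ZMod 2) Y]

lemma mx_le (S : Finset G) (H : G →ₗ[ZMod 2] Y) : mx S H ≤ S.card :=
  Finset.sup_le fun _ _ => Finset.card_filter_le _ _

open Classical in
lemma expect [Fintype (G →ₗ[ZMod 2] Y)] (k ℓ : ℕ) (hk : ℓ ≤ k)
    (hG : Fintype.card G = 2 ^ (k + ℓ)) (hY : Fintype.card Y = 2 ^ ℓ)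
    (S : Finset G) (hS : S.card = 2 ^ ℓ) (T0 T1 b0 b1 : ℝ) (b : ℕ → ℝ) (h0 : 0 ≤ T0) (h01 : T0 ≤ T1)
    (hb0 : ((Finset.univ.filter fun H : G →ₗ[ZMod 2] Y =>
      Function.Surjective H ∧ T0 ≤ mx S H).card : ℝ) ≤ b0 * Fintype.card (G →ₗ[ZMod 2] Y))
    (hb1 : ((Finset.univ.filter fun H : G →ₗ[ZMod 2] Y =>
      Function.Surjective H ∧ T1 ≤ mx S H).card : ℝ) ≤ b1 * Fintype.card (G →ₗ[ZMod 2] Y))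
    (hb : ∀ n ∈ Finset.Ioc (2 * ℓ) (2 ^ ℓ), ((Finset.univ.filter fun H : G →ₗ[ZMod 2] Y =>
      Function.Surjective H ∧ (n : ℝ) ≤ mx S H).card : ℝ) ≤ b n * Fintype.card (G →ₗ[ZMod 2] Y)) :
    ∑ H : G →ₗ[ZMod 2] Y, (mx S H : ℝ) ≤
      (T0 + 1 + (T1 - T0) * b0 + 2 * ℓ * b1 + ∑ n ∈ Finset.Ioc (2 * ℓ) (2 ^ ℓ), b n) *
        Fintype.card (G →ₗ[ZMod 2] Y) := by
  set N : ℝ := (Fintype.card (G →ₗ[ZMod 2] Y) : ℝ) with hN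
  have hpt : ∀ H : G →ₗ[ZMod 2] Y, (mx S H : ℝ) ≤ T0 +
      2 ^ ℓ * (if ¬ Function.Surjective H then 1 else 0) +
      (T1 - T0) * (if Function.Surjective H ∧ T0 ≤ mx S H then 1 else 0) +
      2 * ℓ * (if Function.Surjective H ∧ T1 ≤ mx S H then 1 else 0) +
      ∑ n ∈ Finset.Ioc (2 * ℓ) (2 ^ ℓ),
        (if Function.Surjective H ∧ (n : ℝ) ≤ mx S H then 1 else 0) := by
    intro H
    have hM : mx S H ≤ 2 ^ ℓ := hS ▸ mx_le S H
    have hM' : (mx S H : ℝ) ≤ 2 ^ ℓ := by exact_mod_cast hM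
    have hT : 0 ≤ T1 - T0 := by linarith
    have hl : (0 : ℝ) ≤ 2 * ℓ := by positivity
    by_cases hs : Function.Surjective H
    · simp only [hs, not_true_eq_false, if_false, true_and, mul_zero, add_zero]
      have hsum : (mx S H : ℝ) - 2 * ℓ ≤ ∑ n ∈ Finset.Ioc (2 * ℓ) (2 ^ ℓ),
          (if (n : ℝ) ≤ mx S H then (1 : ℝ) else 0) := by
        rw [Finset.sum_boole]
        have h1 : Finset.Ioc (2 * ℓ) (mx S H) ⊆
            (Finset.Ioc (2 * ℓ) (2 ^ ℓ)).filter (fun n : ℕ => (n : ℝ) ≤ mx S H) := by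
          intro n hn
          rw [Finset.mem_Ioc] at hn
          rw [Finset.mem_filter, Finset.mem_Ioc]
          exact ⟨⟨hn.1, hn.2.trans hM⟩, by exact_mod_cast hn.2⟩
        have h2 := Finset.card_le_card h1
        rw [Nat.card_Ioc] at h2
        have h3 : mx S H ≤ ((Finset.Ioc (2 * ℓ) (2 ^ ℓ)).filter
          (fun n : ℕ => (n : ℝ) ≤ mx S H)).card + 2 * ℓ := by omega
        have h4 : (mx S H : ℝ) ≤ (((Finset.Ioc (2 * ℓ) (2 ^ ℓ)).filter
          (fun n : ℕ => (n : ℝ) ≤ mx S H)).card : ℝ) + 2 * ℓ := by exact_mod_cast h3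
        linarith
      have hsum0 : (0 : ℝ) ≤ ∑ n ∈ Finset.Ioc (2 * ℓ) (2 ^ ℓ),
          (if (n : ℝ) ≤ mx S H then (1 : ℝ) else 0) :=
        Finset.sum_nonneg fun n _ => by split_ifs <;> norm_num
      split_ifs with c1 c2 <;> linarith
    · simp only [hs, not_false_eq_true, if_true, false_and, if_false, mul_zero, add_zero, mul_one,
        Finset.sum_const_zero]
      linarith
  have hns := nonsurj (G := G) (Y := Y) (k + ℓ) ℓ hG hY
  rw [← hN] at hns
  have hN0 : 0 ≤ N := by positivity
  have hns' : (2 : ℝ) ^ ℓ * ((Finset.univ.filter fun H : G →ₗ[ZMod 2] Y =>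
      ¬ Function.Surjective H).card : ℝ) ≤ N := by
    have h1 : (2 : ℝ) ^ ℓ ≤ 2 ^ k := pow_le_pow_right₀ (by norm_num) hk
    rw [pow_add, ← mul_assoc, mul_comm (2 ^ ℓ : ℝ) N] at hns
    have h2 := le_of_mul_le_mul_right hns (by positivity)
    refine le_trans ?_ h2
    rw [mul_comm]
    gcongr
  refine (Finset.sum_le_sum fun H _ => hpt H).trans ?_
  simp only [Finset.sum_add_distrib]
  rw [Finset.sum_comm]
  simp only [← Finset.mul_sum, Finset.sum_boole, Finset.sum_const, nsmul_eq_mul, Finset.card_univ]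
  rw [← hN]
  have hT : 0 ≤ T1 - T0 := by linarith
  have i1 := mul_le_mul_of_nonneg_left hb0 hT
  have i2 := mul_le_mul_of_nonneg_left hb1 (show (0 : ℝ) ≤ 2 * ℓ by positivity)
  have i3 := Finset.sum_le_sum hb
  rw [← Finset.sum_mul] at i3
  linarith

lemma sum_const_bound : ∃ K : ℝ, ∀ ℓ : ℕ, ∑ n ∈ Finset.Ioc (2 * ℓ) (2 ^ ℓ),
    200000 * (n : ℝ) ^ (-(3 / 2) : ℝ) ≤ K := by
  have hs : Summable (fun n : ℕ => 200000 * (n : ℝ) ^ (-(3 / 2) : ℝ)) :=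
    (Real.summable_nat_rpow.mpr (by norm_num)).mul_left _
  exact ⟨_, fun ℓ => hs.sum_le_tsum _ fun n _ => by positivity⟩

open Filter in
/-- abstract version of the main theorem -/
lemma main (ε : ℝ) (hε : 0 < ε) : ∀ᶠ ℓ : ℕ in atTop, ∀ (G Y : Type) [AddCommGroup G] [Fintype G]
    [DecidableEq G] [Module (ZMod 2) G] [AddCommGroup Y] [Fintype Y] [DecidableEq Y]
    [Module (ZMod 2) Y] [Fintype (G →ₗ[ZMod 2] Y)] (k : ℕ), ℓ ≤ k →
    Fintype.card G = 2 ^ (k + ℓ) → Fintype.card Y = 2 ^ ℓ → ∀ S : Finset G, S.card = 2 ^ ℓ →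
    ∑ H : G →ₗ[ZMod 2] Y, (mx S H : ℝ) ≤ TT (1 + ε) ℓ * Fintype.card (G →ₗ[ZMod 2] Y) := by
  obtain ⟨K, hK⟩ := sum_const_bound
  have hx : Tendsto (fun ℓ : ℕ => Real.log (Real.log ℓ)) atTop atTop :=
    Real.tendsto_log_atTop.comp (Real.tendsto_log_atTop.comp tendsto_natCast_atTop_atTop)
  filter_upwards [hx.eventually (paramA (1 + ε / 2) (by linarith)),
    hx.eventually (paramA (10 + ε / 2) (by linarith)), paramB,
    hx.eventually (numeric ε (1 + K) hε), eventually_ge_atTop 3,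
    hx.eventually (eventually_ge_atTop 0)] with ℓ hA0 hA1 hB hnum hℓ3 hx0
  intro G Y _ _ _ _ _ _ _ _ _ k hk hG hY S hS
  have hℓ3' : (3 : ℝ) ≤ ℓ := by exact_mod_cast hℓ3
  have hlog : 1 < Real.log ℓ := by
    rw [Real.lt_log_iff_exp_lt (by linarith)]
    have := Real.exp_one_lt_d9
    linarith
  have hexp : (ℓ : ℝ) = Real.exp (Real.exp (Real.log (Real.log ℓ))) := by
    rw [Real.exp_log (by linarith), Real.exp_log (by linarith)]
  obtain ⟨m0, hm0, lam0, s0, hl0, hc0, hd0⟩ := hA0 ℓ hexp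
  obtain ⟨m1, hm1, lam1, s1, hl1, hc1, hd1⟩ := hA1 ℓ hexp
  have hnum := hnum ℓ hexp
  have hlog2 : 0 < Real.log 2 := Real.log_pos (by norm_num)
  have hT0 : 0 ≤ TT (1 + ε / 2) ℓ := by unfold TT; positivity
  have hT01 : TT (1 + ε / 2) ℓ ≤ TT (10 + ε / 2) ℓ := by
    unfold TT
    gcongr
    norm_num
  have hN : (0 : ℝ) ≤ Fintype.card (G →ₗ[ZMod 2] Y) := by positivity
  refine (expect k ℓ hk hG hY S hS (TT (1 + ε / 2) ℓ) (TT (10 + ε / 2) ℓ)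
    (BB (1 + ε / 2) (Real.log (Real.log ℓ))) (BB (10 + ε / 2) (Real.log (Real.log ℓ)))
    (fun n => 200000 * (n : ℝ) ^ (-(3 / 2) : ℝ)) hT0 hT01 ?_ ?_ ?_).trans ?_
  · exact (tail k ℓ m0 (hm0.trans hk) hG hY S hS lam0 s0 _ hl0 hc0).trans (by gcongr)
  · exact (tail k ℓ m1 (hm1.trans hk) hG hY S hS lam1 s1 _ hl1 hc1).trans (by gcongr)
  · intro n hn
    rw [Finset.mem_Ioc] at hn
    obtain ⟨m, hm, s, hc, hd⟩ := hB n hn.1.le hn.2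
    exact (tail k ℓ m (hm.trans hk) hG hY S hS 1 s _ zero_le_one hc).trans (by gcongr)
  · gcongr
    have := hK ℓ
    linarith

end assembly
end LH

/-- For every ε > 0 there exists ℓ_0 such that for every ℓ ≥ ℓ_0, every u ≥ ℓ, and
every set S ⊆ F_2^u of size 2^ℓ, the expected maximum load of a uniformly random linear map
h : F_2^u → F_2^ℓ satisfies E_h[M(S,h)] ≤ (1 + (1 + ε)·(ln ln ℓ)/(ln ℓ)) · ℓ / log_2 ℓ. -/
theorem stmt_12 (ε : ℝ) (hε : 0 < ε) :
    ∃ ℓ₀ : ℕ, ∀ (ℓ u : ℕ), ℓ₀ ≤ ℓ → ℓ ≤ u →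
      ∀ S : Finset (Fin u → ZMod 2), S.card = 2 ^ ℓ →
      (∑ h : Lin u ℓ, (maxLoad u ℓ S h : ℝ)) / (Fintype.card (Lin u ℓ) : ℝ) ≤
        (1 + (1 + ε) * Real.log (Real.log ℓ) / Real.log ℓ) * ((ℓ : ℝ) / Real.logb 2 ℓ) := by
  obtain ⟨ℓ₀, hℓ₀⟩ := Filter.eventually_atTop.mp (LH.main ε hε)
  refine ⟨ℓ₀, fun ℓ u hℓ hu S hS => ?_⟩
  let X := Fin u → ZMod 2
  let Y := Fin ℓ → ZMod 2
  let _ : Fintype (X × Y →ₗ[ZMod 2] Y) := Fintype.ofInjective DFunLike.coe DFunLike.coe_injective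
  have hYc : Fintype.card Y = 2 ^ ℓ := by simp [Y, ZMod.card]
  have hGc : Fintype.card (X × Y) = 2 ^ (u + ℓ) := by simp [X, Y, ZMod.card, pow_add]
  let emb : X ↪ X × Y := ⟨fun x => (x, 0), fun a b h => (Prod.mk.inj h).1⟩
  have hmain := hℓ₀ ℓ hℓ (X × Y) Y u hu hGc hYc (S.map emb) (by rw [Finset.card_map, hS])
  let e : (Lin u ℓ × Lin ℓ ℓ) ≃ (X × Y →ₗ[ZMod 2] Y) :=
    (LinearMap.coprodEquiv (ZMod 2)).toEquiv
  have hload : ∀ p : Lin u ℓ × Lin ℓ ℓ, LH.mx (S.map emb) (e p) = maxLoad u ℓ S p.1 := by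
    rintro ⟨h, B⟩
    unfold LH.mx maxLoad
    congr 1
    funext y
    rw [Finset.filter_map, Finset.card_map]
    congr 1
    ext x
    have he : e (h, B) (emb x) = h x := by
      change h x + B 0 = h x
      rw [map_zero, add_zero]
    simp only [Finset.mem_filter, Function.comp, he]
  have hsum : ∑ H : X × Y →ₗ[ZMod 2] Y, (LH.mx (S.map emb) H : ℝ) =
      (Fintype.card (Lin ℓ ℓ) : ℝ) * ∑ h : Lin u ℓ, (maxLoad u ℓ S h : ℝ) := by
    rw [← e.sum_comp, Fintype.sum_prod_type]
    simp only [hload, Finset.sum_const, nsmul_eq_mul, Finset.card_univ]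
    rw [Finset.mul_sum]
  have hcard : (Fintype.card (X × Y →ₗ[ZMod 2] Y) : ℝ) =
      (Fintype.card (Lin ℓ ℓ) : ℝ) * Fintype.card (Lin u ℓ) := by
    rw [← Fintype.card_congr e, Fintype.card_prod]
    push_cast
    ring
  have p1 : (0 : ℝ) < Fintype.card (Lin ℓ ℓ) := by exact_mod_cast Fintype.card_pos
  have p2 : (0 : ℝ) < Fintype.card (Lin u ℓ) := by exact_mod_cast Fintype.card_pos
  rw [hsum, hcard, mul_left_comm] at hmain
  have h1 := le_of_mul_le_mul_left hmain p1
  rw [div_le_iff₀ p2]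
  refine h1.trans (le_of_eq ?_)
  unfold LH.TT Real.logb
  rw [div_div_eq_mul_div]
end

section
/- There exist absolute constants C > 0 and D > 0 such that the following holds. Let n = 2^ℓ, let S ⊆ F_2^u have size m with u ≥ ℓ, set λ = m/n, and let h : F_2^u → F_2^ℓ be a uniformly random linear map. Then for every real T > 0 satisfying T ≥ D λ n^{1/T}, one has Pr[M(S,h) ≥ T] ≤ C (λ n^{1/T} / T)^2. -/
namespace LH

set_option linter.unusedSectionVars false

variable {Y : Type} [AddCommGroup Y] [Module (ZMod 2) Y] [Fintype Y] [DecidableEq Y]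

def ev {K : ℕ} (h : Fin K → Y) (t : Fin K → ZMod 2) : Y := ∑ i, t i • h i

def load {K : ℕ} (f : (Fin K → ZMod 2) → Y → ℕ) (h : Fin K → Y) (z : Y) : ℕ :=
  ∑ t, f t (z - ev h t)

noncomputable def pot {K : ℕ} (b : ℝ) (f : (Fin K → ZMod 2) → Y → ℕ) (h : Fin K → Y) : ℝ :=
  ∑ z, b ^ load f h z

open Classical in
noncomputable def cnt {K : ℕ} (b : ℝ) (f : (Fin K → ZMod 2) → Y → ℕ) (A : ℝ) : ℝ :=
  ∑ h : Fin K → Y, if A ≤ pot b f h then (1 : ℝ) else 0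

/-- one reduction step -/
def red {K : ℕ} (f : (Fin (K + 1) → ZMod 2) → Y → ℕ) (w : Fin K → ZMod 2) (v : Y) :
    (Fin K → ZMod 2) → Y → ℕ :=
  fun t y => f (Fin.cons 0 t) y + f (Fin.cons 1 (t + w)) (y + v)

noncomputable def alpha (K : ℕ) (e L : ℝ) : ℝ :=
  ∑ i ∈ Finset.range K, (e * 2 ^ i) ^ 2 / (L ^ (2 ^ (i + 1)) - 1 - 2 ^ (i + 1) * e)

theorem sum_cons {K : ℕ} {R X : Type} [AddCommMonoid R] [Fintype X]
    (F : (Fin (K + 1) → X) → R) :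
    ∑ h, F h = ∑ a, ∑ h, F (Fin.cons a h) := by
  rw [← Fintype.sum_prod_type' (fun a h => F (Fin.cons a h))]
  exact (Equiv.sum_comp (Fin.consEquiv (fun _ : Fin (K + 1) => X)) F).symm

theorem sum_cons2 {K : ℕ} {R : Type} [AddCommMonoid R] (F : (Fin (K + 1) → ZMod 2) → R) :
    ∑ h, F h = ∑ t, F (Fin.cons 0 t) + ∑ t, F (Fin.cons 1 t) := by
  rw [sum_cons]
  exact Fin.sum_univ_two (fun a : Fin 2 => ∑ h, F (Fin.cons (α := fun _ => ZMod 2) a h))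

theorem ev_cons {K : ℕ} (a : Y) (h : Fin K → Y) (s : ZMod 2) (t : Fin K → ZMod 2) :
    ev (Fin.cons a h : Fin (K + 1) → Y) (Fin.cons s t) = s • a + ev h t := by
  simp [ev, Fin.sum_univ_succ]

theorem ev_add {K : ℕ} (h : Fin K → Y) (s t : Fin K → ZMod 2) :
    ev h (s + t) = ev h s + ev h t := by
  simp [ev, add_smul, Finset.sum_add_distrib]

theorem load_red {K : ℕ} (f : (Fin (K + 1) → ZMod 2) → Y → ℕ) (w : Fin K → ZMod 2) (v : Y)
    (h : Fin K → Y) (z : Y) :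
    load (red f w v) h z = load f (Fin.cons (-(ev h w + v)) h) z := by
  unfold load
  rw [sum_cons2]
  simp only [red, Finset.sum_add_distrib, ev_cons]
  congr 1
  · simp
  · rw [← Equiv.sum_comp (Equiv.addRight w)
      (fun t => f (Fin.cons 1 t) (z - ((1 : ZMod 2) • (-(ev h w + v)) + ev h t)))]
    refine Finset.sum_congr rfl fun t _ => ?_
    simp only [Equiv.coe_addRight, ev_add, one_smul]
    congr 1
    abel

theorem pot_red {K : ℕ} (b : ℝ) (f : (Fin (K + 1) → ZMod 2) → Y → ℕ) (w : Fin K → ZMod 2) (v : Y)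
    (h : Fin K → Y) :
    pot b (red f w v) h = pot b f (Fin.cons (-(ev h w + v)) h) := by
  simp only [pot, load_red]

theorem cnt_red {K : ℕ} (b : ℝ) (f : (Fin (K + 1) → ZMod 2) → Y → ℕ) (A : ℝ) :
    ∑ w, ∑ v, cnt b (red f w v) A = 2 ^ K * cnt b f A := by
  classical
  unfold cnt
  simp only [pot_red]
  have key : ∀ w : Fin K → ZMod 2,
      ∑ v : Y, ∑ h : Fin K → Y,
        (if A ≤ pot b f (Fin.cons (-(ev h w + v)) h) then (1 : ℝ) else 0)
      = ∑ h : Fin (K + 1) → Y, if A ≤ pot b f h then (1 : ℝ) else 0 := by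
    intro w
    rw [sum_cons, Finset.sum_comm, Finset.sum_comm (s := (Finset.univ : Finset Y))]
    refine Finset.sum_congr rfl fun h _ => ?_
    exact Equiv.sum_comp ((Equiv.addLeft (ev h w)).trans (Equiv.neg Y))
      (fun a => if A ≤ pot b f (Fin.cons a h) then (1 : ℝ) else 0)
  simp only [key]
  simp

theorem sum_red {K : ℕ} (f : (Fin (K + 1) → ZMod 2) → Y → ℕ) (w : Fin K → ZMod 2) (v : Y) :
    ∑ t, ∑ y, (red f w v t y : ℝ) = ∑ t, ∑ y, (f t y : ℝ) := by
  rw [sum_cons2]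
  simp only [red, Nat.cast_add, Finset.sum_add_distrib]
  congr 1
  rw [← Equiv.sum_comp (Equiv.addRight w) (fun t => ∑ y, (f (Fin.cons 1 t) y : ℝ))]
  refine Finset.sum_congr rfl fun t _ => ?_
  exact Equiv.sum_comp (Equiv.addRight v) (fun y => (f (Fin.cons 1 (t + w)) y : ℝ))

theorem pow_red {K : ℕ} (b : ℝ) (f : (Fin (K + 1) → ZMod 2) → Y → ℕ) :
    4 * ∑ w, ∑ v, ∑ t, ∑ y, b ^ (red f w v t y) ≤ (∑ t, ∑ y, b ^ (f t y)) ^ 2 := by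
  have h1 : ∑ w, ∑ v, ∑ t, ∑ y, b ^ (red f w v t y)
      = (∑ t, ∑ y, b ^ f (Fin.cons 0 t) y) * (∑ t, ∑ y, b ^ f (Fin.cons 1 t) y) := by
    simp only [red, pow_add]
    have l : ∑ w : Fin K → ZMod 2, ∑ v : Y, ∑ t : Fin K → ZMod 2, ∑ y : Y,
        b ^ f (Fin.cons 0 t) y * b ^ f (Fin.cons 1 (t + w)) (y + v)
        = ∑ q : (Fin K → ZMod 2) × Y, ∑ p : (Fin K → ZMod 2) × Y,
        b ^ f (Fin.cons 0 p.1) p.2 * b ^ f (Fin.cons 1 (p.1 + q.1)) (p.2 + q.2) := by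
      simp only [Fintype.sum_prod_type]
    rw [l, ← Fintype.sum_prod_type' (fun t y => b ^ f (Fin.cons 0 t) y),
      ← Fintype.sum_prod_type' (fun t y => b ^ f (Fin.cons 1 t) y),
      Finset.sum_comm, Finset.sum_mul]
    refine Finset.sum_congr rfl fun p _ => ?_
    rw [← Finset.mul_sum]
    congr 1
    exact Equiv.sum_comp (Equiv.addLeft p)
      (fun q : (Fin K → ZMod 2) × Y => b ^ f (Fin.cons 1 q.1) q.2)
  rw [h1, sum_cons2 (fun t => ∑ y, b ^ f t y)]
  nlinarith [sq_nonneg ((∑ t, ∑ y, b ^ f (Fin.cons 0 t) y) - (∑ t, ∑ y, b ^ f (Fin.cons 1 t) y))]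

theorem one_le_aux (e L : ℝ) (he : 0 ≤ e) (hL : 1 + e < L) : 1 + 2 * e < L ^ 2 := by
  nlinarith

theorem alpha_nonneg (K : ℕ) : ∀ (e L : ℝ), 0 ≤ e → 1 + e < L → 0 ≤ alpha K e L := by
  intro e L he hL
  have : ∀ i : ℕ, 1 + 2 ^ i * e < L ^ (2 ^ i) := by
    intro i
    induction i with
    | zero => simpa using hL
    | succ i ih =>
      have := one_le_aux _ _ (by positivity) ih
      have e1 : L ^ 2 ^ (i + 1) = (L ^ 2 ^ i) ^ 2 := by rw [← pow_mul, pow_succ]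
      rw [e1, pow_succ]
      linarith
  refine Finset.sum_nonneg fun i _ => ?_
  have := this (i + 1)
  apply div_nonneg (by positivity)
  linarith

theorem alpha_succ (K : ℕ) (e L : ℝ) :
    alpha (K + 1) e L = alpha K (2 * e) (L ^ 2) + e ^ 2 / (L ^ 2 - 1 - 2 * e) := by
  unfold alpha
  rw [Finset.sum_range_succ']
  congr 1
  · refine Finset.sum_congr rfl fun i _ => ?_
    rw [← pow_mul, ← pow_succ' 2 (i + 1)]
    congr 1 <;> ring
  · simp

theorem base_le {K : ℕ} (b : ℝ) (hb : 1 ≤ b) (f : (Fin K → ZMod 2) → Y → ℕ) :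
    2 ^ K * (Fintype.card Y : ℝ) + (b - 1) * ∑ t, ∑ y, (f t y : ℝ) ≤ ∑ t, ∑ y, b ^ f t y := by
  have : 2 ^ K * (Fintype.card Y : ℝ) + (b - 1) * ∑ t, ∑ y, (f t y : ℝ)
      = ∑ t : Fin K → ZMod 2, ∑ y : Y, (1 + (f t y : ℝ) * (b - 1)) := by
    simp only [Finset.sum_add_distrib, ← Finset.sum_mul]
    simp
    ring
  rw [this]
  refine Finset.sum_le_sum fun t _ => Finset.sum_le_sum fun y _ => ?_
  have := one_add_mul_le_pow (a := b - 1) (by linarith) (f t y)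
  simpa using this

theorem cnt_le {K : ℕ} (b : ℝ) (f : (Fin K → ZMod 2) → Y → ℕ) (A : ℝ) :
    cnt b f A ≤ (Fintype.card Y : ℝ) ^ K := by
  classical
  unfold cnt
  calc _ ≤ ∑ h : Fin K → Y, (1 : ℝ) := Finset.sum_le_sum fun h _ => by split_ifs <;> norm_num
    _ = _ := by simp

theorem main_s17 (b : ℝ) (hb : 1 ≤ b) (K : ℕ) : ∀ (f : (Fin K → ZMod 2) → Y → ℕ) (L e p : ℝ),
    e * (2 ^ K * (Fintype.card Y : ℝ)) = (b - 1) * ∑ t, ∑ y, (f t y : ℝ) →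
    p * (2 ^ K * (Fintype.card Y : ℝ)) = ∑ t, ∑ y, b ^ f t y →
    1 + e < L →
    cnt b f (L ^ (2 ^ K) * (Fintype.card Y : ℝ)) ≤
      (Fintype.card Y : ℝ) ^ K * (alpha K e L + (p - 1 - e) / (L - 1 - e)) := by
  classical
  have hN : (0 : ℝ) < Fintype.card Y := by exact_mod_cast Fintype.card_pos
  induction K with
  | zero =>
    intro f L e p he hp hL
    have hbase := base_le b hb f
    rw [← he, ← hp] at hbase
    have hpe : 1 + e ≤ p := by
      simp only [pow_zero, one_mul] at hbase
      nlinarith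
    have hD : 0 < L - 1 - e := by linarith
    by_cases hc : L ≤ p
    · refine (cnt_le _ _ _).trans ?_
      simp only [pow_zero, one_mul, alpha, Finset.range_zero, Finset.sum_empty, zero_add]
      rw [le_div_iff₀ hD]; linarith
    · have : cnt b f (L ^ (2 ^ 0) * (Fintype.card Y : ℝ)) = 0 := by
        unfold cnt
        refine Finset.sum_eq_zero fun h _ => ?_
        rw [if_neg]
        have : pot b f h = p * (Fintype.card Y : ℝ) := by
          rw [pow_zero, one_mul] at hp
          rw [hp]
          simp [pot, load, ev]
        rw [this]
        push Not at hc ⊢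
        simpa using mul_lt_mul_of_pos_right hc hN
      rw [this]
      simp only [pow_zero, one_mul, alpha, Finset.range_zero, Finset.sum_empty, zero_add]
      apply div_nonneg <;> linarith
  | succ K ih =>
    intro f L e p he hp hL
    have hbase := base_le b hb f
    rw [← he, ← hp] at hbase
    have hM : (0 : ℝ) < 2 ^ K * (Fintype.card Y : ℝ) := by positivity
    have hM2 : (0 : ℝ) < 2 ^ (K + 1) * (Fintype.card Y : ℝ) := by positivity
    have hpe : 1 + e ≤ p := by nlinarith
    have he0 : 0 ≤ e := by
      by_contra hneg
      push Not at hneg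
      have : 0 ≤ (b - 1) * ∑ t, ∑ y, (f t y : ℝ) := by
        apply mul_nonneg (by linarith); positivity
      nlinarith
    have hD : 0 < L - 1 - e := by linarith
    have hL2 := one_le_aux e L he0 hL
    have hD2 : 0 < L ^ 2 - 1 - 2 * e := by linarith
    by_cases hc : L ≤ p
    · refine (cnt_le _ _ _).trans ?_
      have h1 : 1 ≤ (p - 1 - e) / (L - 1 - e) := by rw [le_div_iff₀ hD]; linarith
      have h2 := alpha_nonneg (K + 1) e L he0 hL
      have h3 : (0 : ℝ) < (Fintype.card Y : ℝ) ^ (K + 1) := by positivity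
      nlinarith
    · push Not at hc
      set N : ℝ := (Fintype.card Y : ℝ) with hNdef
      set M : ℝ := 2 ^ K * N with hMdef
      have step : ∀ w v, cnt b (red f w v) (L ^ (2 ^ (K + 1)) * N) ≤
          N ^ K * (alpha K (2 * e) (L ^ 2) +
            ((∑ t, ∑ y, b ^ (red f w v t y)) / M - 1 - 2 * e) / (L ^ 2 - 1 - 2 * e)) := by
        intro w v
        have := ih (red f w v) (L ^ 2) (2 * e) ((∑ t, ∑ y, b ^ (red f w v t y)) / M)
          (by rw [sum_red, ← he, pow_succ]; ring) (by field_simp) (by linarith)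
        rwa [← pow_mul, ← pow_succ'] at this
      have hsum := Finset.sum_le_sum (s := Finset.univ) fun w _ =>
        Finset.sum_le_sum (s := Finset.univ) fun v _ => step w v
      rw [cnt_red] at hsum
      set Q := ∑ w, ∑ v, ∑ t, ∑ y, b ^ (red f w v t y) with hQ
      have hrhs : ∑ w : Fin K → ZMod 2, ∑ v : Y, N ^ K * (alpha K (2 * e) (L ^ 2) +
            ((∑ t, ∑ y, b ^ (red f w v t y)) / M - 1 - 2 * e) / (L ^ 2 - 1 - 2 * e))
          = N ^ K * (M * alpha K (2 * e) (L ^ 2) +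
            (Q / M - M * (1 + 2 * e)) / (L ^ 2 - 1 - 2 * e)) := by
        simp only [← Finset.mul_sum, Finset.sum_add_distrib, ← Finset.sum_div,
          Finset.sum_sub_distrib]
        simp only [Finset.sum_const, Finset.card_univ, Fintype.card_fun, ZMod.card,
          Fintype.card_fin, nsmul_eq_mul, Nat.cast_pow, Nat.cast_ofNat, ← hNdef, ← hQ, hMdef]
        ring
      rw [hrhs] at hsum
      have hQle : Q / M ≤ M * p ^ 2 := by
        have := pow_red b f
        rw [← hp, ← hQ] at this
        rw [div_le_iff₀ hM]
        have e2 : p * (2 ^ (K + 1) * N) = 2 * (p * M) := by rw [hMdef, pow_succ]; ring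
        rw [e2] at this
        nlinarith
      have hfrac : (p ^ 2 - 1 - 2 * e) / (L ^ 2 - 1 - 2 * e) ≤
          e ^ 2 / (L ^ 2 - 1 - 2 * e) + (p - 1 - e) / (L - 1 - e) := by
        rw [← sub_le_iff_le_add', ← sub_div, div_le_div_iff₀ hD2 hD]
        have e3 : p ^ 2 - 1 - 2 * e - e ^ 2 = (p - 1 - e) * (p + 1 + e) := by ring
        rw [e3, mul_assoc]
        apply mul_le_mul_of_nonneg_left _ (by linarith)
        nlinarith [sq_nonneg e]
      have hN1 : (0 : ℝ) < N ^ K := by positivity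
      have hfin : 2 ^ K * cnt b f (L ^ 2 ^ (K + 1) * N) ≤
          N ^ K * (M * (alpha (K + 1) e L + (p - 1 - e) / (L - 1 - e))) := by
        refine hsum.trans (mul_le_mul_of_nonneg_left ?_ hN1.le)
        rw [alpha_succ]
        have : (Q / M - M * (1 + 2 * e)) / (L ^ 2 - 1 - 2 * e) ≤
            M * ((p ^ 2 - 1 - 2 * e) / (L ^ 2 - 1 - 2 * e)) := by
          rw [← mul_div_assoc]
          apply div_le_div_of_nonneg_right _ hD2.le
          linarith
        nlinarith
      have h2K : (0 : ℝ) < 2 ^ K := by positivity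
      refine le_of_mul_le_mul_left (hfin.trans_eq ?_) h2K
      rw [hMdef, pow_succ N]; ring

theorem tele (x : ℝ) (hx : 0 < x) :
    x ^ 2 / (Real.exp x - 1) ≤ 12 * (2 * x / (1 + 2 * x) - x / (1 + x)) := by
  have h := Real.sum_le_exp_of_nonneg hx.le 4
  simp [Finset.sum_range_succ, Nat.factorial] at h
  have e1 : 12 * (2 * x / (1 + 2 * x) - x / (1 + x)) = 12 * x / ((1 + 2 * x) * (1 + x)) := by
    field_simp; ring
  have hpos : 0 < Real.exp x - 1 := by nlinarith [sq_nonneg x, pow_pos hx 3]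
  rw [e1, div_le_div_iff₀ hpos (by positivity)]
  have : x * (1 + 3 * x + 2 * x ^ 2) ≤ 12 * (Real.exp x - 1) := by
    nlinarith [sq_nonneg x, pow_pos hx 3]
  nlinarith

theorem alpha_bound (K : ℕ) (B T : ℝ) (hT : 0 < T) (hBT : 2 * B ≤ T) :
    alpha K (B / 2 ^ K) (Real.exp (T / 2 ^ K)) ≤ 6 * (B / T) ^ 2 := by
  let x : ℕ → ℝ := fun i => T / 2 ^ K * 2 ^ i
  let g : ℕ → ℝ := fun i => x i / (1 + x i)
  have hx : ∀ i, 0 < x i := fun i => by positivity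
  have term : ∀ i, (B / 2 ^ K * 2 ^ i) ^ 2 /
      (Real.exp (T / 2 ^ K) ^ (2 ^ (i + 1)) - 1 - 2 ^ (i + 1) * (B / 2 ^ K)) ≤
      6 * (B / T) ^ 2 * (g (i + 2) - g (i + 1)) := by
    intro i
    have h1 : Real.exp (T / 2 ^ K) ^ (2 ^ (i + 1)) = Real.exp (x (i + 1)) := by
      rw [← Real.exp_nat_mul]; congr 1; simp only [x]; push_cast; ring
    have h2 : 2 ^ (i + 1) * (B / 2 ^ K) ≤ x (i + 1) / 2 := by
      have : x (i + 1) / 2 - 2 ^ (i + 1) * (B / 2 ^ K)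
        = (T - 2 * B) * (2 ^ (i + 1) / 2 ^ K / 2) := by simp only [x]; ring
      have h3 : 0 ≤ (T - 2 * B) * (2 ^ (i + 1) / 2 ^ K / 2) :=
        mul_nonneg (by linarith) (by positivity)
      linarith
    have h4 := Real.add_one_le_exp (x (i + 1))
    have h5 := tele _ (hx (i + 1))
    have h6 : (B / 2 ^ K * 2 ^ i) ^ 2 = (B / T) ^ 2 * (x (i + 1) ^ 2 / 4) := by
      simp only [x]; field_simp; ring
    have h7 : g (i + 2) = 2 * x (i + 1) / (1 + 2 * x (i + 1)) := by
      have : x (i + 2) = 2 * x (i + 1) := by simp only [x]; ring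
      simp only [g, this]
    have hpos : 0 < Real.exp (x (i + 1)) - 1 := by linarith [hx (i + 1)]
    rw [h1, h6, h7]
    calc _ ≤ (B / T) ^ 2 * (x (i + 1) ^ 2 / 4) / ((Real.exp (x (i + 1)) - 1) / 2) := by
          apply div_le_div_of_nonneg_left (by positivity) (by linarith) (by linarith)
      _ = (B / T) ^ 2 / 2 * (x (i + 1) ^ 2 / (Real.exp (x (i + 1)) - 1)) := by
          field_simp; ring
      _ ≤ (B / T) ^ 2 / 2 * _ := mul_le_mul_of_nonneg_left h5 (by positivity)
      _ = _ := by simp only [g]; ring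
  unfold alpha
  refine (Finset.sum_le_sum fun i _ => term i).trans ?_
  rw [← Finset.mul_sum, Finset.sum_range_sub (fun i => g (i + 1))]
  have h1 : g (K + 1) ≤ 1 := by
    simp only [g]; rw [div_le_one (by linarith [hx (K + 1)])]; linarith
  have h0 : 0 ≤ g (0 + 1) := by have := hx (0 + 1); simp only [g]; positivity
  have : 0 ≤ 6 * (B / T) ^ 2 := by positivity
  nlinarith

end LH

/-- There exist absolute constants C > 0 and D > 0 such that the following holds.
Let n = 2^ℓ, let S ⊆ F_2^u have size m with u ≥ ℓ, set λ = m/n, and let h : F_2^u → F_2^ℓ be a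
uniformly random linear map. Then for every real T > 0 satisfying T ≥ D λ n^{1/T}, one has
Pr[M(S,h) ≥ T] ≤ C (λ n^{1/T} / T)^2. -/
theorem stmt_17 :
    ∃ C > (0 : ℝ), ∃ D > (0 : ℝ),
      ∀ (ℓ u : ℕ), ℓ ≤ u →
      ∀ (S : Finset (Fin u → ZMod 2)) (m n : ℕ), S.card = m → n = 2 ^ ℓ →
      ∀ lam : ℝ, lam = (m : ℝ) / n →
      ∀ T : ℝ, 0 < T → D * lam * (n : ℝ) ^ (1 / T) ≤ T →
      (Nat.card {h : Lin u ℓ // T ≤ (maxLoad u ℓ S h : ℝ)} : ℝ) /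
          (Nat.card (Lin u ℓ) : ℝ) ≤
        C * (lam * (n : ℝ) ^ (1 / T) / T) ^ 2 := by
  refine ⟨54, by norm_num, 6, by norm_num, ?_⟩
  intro ℓ u _ S m n hm hn lam hlam T hT hD
  classical
  have hY : (Fintype.card (Fin ℓ → ZMod 2) : ℝ) = n := by simp [hn]
  have hn1 : (1 : ℝ) ≤ n := by rw [hn]; push_cast; exact one_le_pow₀ (by norm_num)
  have hn0 : (0 : ℝ) < n := by linarith
  set r : ℝ := (n : ℝ) ^ (1 / T) with hr
  have hr1 : 1 ≤ r := Real.one_le_rpow hn1 (by positivity)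
  have hrT : r ^ T = n := by
    rw [hr, ← Real.rpow_mul hn0.le, one_div_mul_cancel hT.ne', Real.rpow_one]
  have he3 : Real.exp 1 < 3 := Real.exp_one_lt_three
  have he1 : 1 ≤ Real.exp 1 := Real.one_le_exp (by norm_num)
  set b : ℝ := Real.exp 1 * r with hb
  have hb1 : 1 ≤ b := by nlinarith
  have hlam0 : 0 ≤ lam := by rw [hlam]; positivity
  have hbT : b ^ T = Real.exp T * n := by
    rw [hb, Real.mul_rpow (by positivity) (by linarith), hrT, ← Real.exp_mul, one_mul]
  set B : ℝ := (b - 1) * lam with hB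
  have hBle : B ≤ 3 * (lam * r) := by
    have : b - 1 ≤ 3 * r := by nlinarith
    nlinarith
  have hB0 : 0 ≤ B := mul_nonneg (by linarith) hlam0
  have hBT : 2 * B ≤ T := by linarith
  let f : (Fin u → ZMod 2) → (Fin ℓ → ZMod 2) → ℕ := fun t y => if t ∈ S ∧ y = 0 then 1 else 0
  have hsumf : ∑ t, ∑ y, (f t y : ℝ) = m := by
    simp only [f, ite_and]
    simp [hm]
  have hsumb : ∑ t, ∑ y, b ^ f t y = 2 ^ u * (n : ℝ) + (b - 1) * m := by
    have : ∀ t y, b ^ f t y = 1 + (b - 1) * (f t y : ℝ) := by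
      intro t y
      simp only [f]
      split_ifs <;> simp
    simp only [this, Finset.sum_add_distrib, ← Finset.mul_sum, hsumf]
    simp [hn]
  have h2u : (0 : ℝ) < 2 ^ u := by positivity
  have hlm : lam * n = m := by rw [hlam]; field_simp
  have hL : 1 + B / 2 ^ u < Real.exp (T / 2 ^ u) := by
    have h1 := Real.add_one_le_exp (T / 2 ^ u)
    have h2 : B / 2 ^ u < T / 2 ^ u := by
      apply div_lt_div_of_pos_right _ h2u
      linarith
    linarith
  have hmain := LH.main_s17 b hb1 u f (Real.exp (T / 2 ^ u)) (B / 2 ^ u) (1 + B / 2 ^ u)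
    (by rw [hsumf, hY, ← hlm, hB]; field_simp)
    (by rw [hsumb, hY, ← hlm, hB]; field_simp) hL
  have hLT : Real.exp (T / 2 ^ u) ^ (2 ^ u) = Real.exp T := by
    rw [← Real.exp_nat_mul]; congr 1; push_cast; field_simp
  have hz : (1 + B / 2 ^ u - 1 - B / 2 ^ u) = 0 := by ring
  rw [hLT, hY, hz, zero_div, add_zero] at hmain
  have hal := LH.alpha_bound u B T hT hBT
  let E : (Fin u → Fin ℓ → ZMod 2) ≃ Lin u ℓ :=
    ((Pi.basisFun (ZMod 2) (Fin u)).constr ℕ).toEquiv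
  have hE : ∀ g t, E g t = LH.ev g t := by
    intro g t
    simp only [E, LH.ev]
    exact (Module.Basis.constr_apply_fintype (S := ℕ) (Pi.basisFun (ZMod 2) (Fin u)) g t).trans (by simp)
  have hcardLin : (Nat.card (Lin u ℓ) : ℝ) = (n : ℝ) ^ u := by
    rw [← Nat.card_congr E]
    simp [hn]
  have hload : ∀ g z, LH.load f g z = (S.filter fun v => E g v = z).card := by
    intro g z
    simp only [LH.load, f, Finset.card_filter, hE, sub_eq_zero, ite_and]
    simp [eq_comm]
  have hcard : (Nat.card {h : Lin u ℓ // T ≤ (maxLoad u ℓ S h : ℝ)} : ℝ) ≤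
      LH.cnt b f (Real.exp T * n) := by
    have e1 : Nat.card {h : Lin u ℓ // T ≤ (maxLoad u ℓ S h : ℝ)} =
        Nat.card {g : Fin u → Fin ℓ → ZMod 2 // T ≤ (maxLoad u ℓ S (E g) : ℝ)} :=
      (Nat.card_congr (E.subtypeEquiv (fun g => Iff.rfl))).symm
    rw [e1, Nat.card_eq_fintype_card, Fintype.card_subtype, Finset.card_filter]
    push_cast
    unfold LH.cnt
    refine Finset.sum_le_sum fun g _ => ?_
    by_cases hg : T ≤ (maxLoad u ℓ S (E g) : ℝ)
    · rw [if_pos hg, if_pos]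
      obtain ⟨z, -, hz⟩ := Finset.exists_mem_eq_sup (Finset.univ : Finset (Fin ℓ → ZMod 2))
        Finset.univ_nonempty (fun y => (S.filter fun v => E g v = y).card)
      have hz' : maxLoad u ℓ S (E g) = LH.load f g z := by rw [hload]; exact hz
      rw [hz'] at hg
      rw [← hbT]
      calc b ^ T ≤ b ^ ((LH.load f g z : ℕ) : ℝ) := Real.rpow_le_rpow_of_exponent_le hb1 hg
        _ = b ^ LH.load f g z := Real.rpow_natCast _ _
        _ ≤ LH.pot b f g := Finset.single_le_sum (f := fun z => b ^ LH.load f g z)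
            (fun i _ => by positivity) (Finset.mem_univ z)
    · rw [if_neg hg]
      split_ifs <;> norm_num
  rw [hcardLin, div_le_iff₀ (by positivity)]
  refine (hcard.trans hmain).trans ?_
  rw [mul_comm]
  refine mul_le_mul_of_nonneg_right (hal.trans ?_) (by positivity)
  have h1 : B / T ≤ 3 * (lam * r / T) := by
    rw [← mul_div_assoc]; exact div_le_div_of_nonneg_right hBle hT.le
  have h2 : 0 ≤ B / T := by positivity
  nlinarith
end

section
/- There exist absolute constants C > 0 and D > 0 such that the following holds. Let n = 2^ℓ, let S ⊆ F_2^u have size m with u ≥ ℓ, set λ = m/n, let t > 0 be the real number defined by t · ln(t/(e·λ)) = ln n, and let h : F_2^u → F_2^ℓ be a uniformly random linear map. Then for every real R > 1 satisfying R (t/λ)^{1 − 1/R} ≥ D, one has Pr[M(S,h) ≥ R t] ≤ (C/R^2) (λ/t)^{2 − 2/R}. -/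
namespace LinHash

open Finset

/-- Averages are invariant under surjective additive homomorphisms. -/
lemma avg_surj {G H : Type*} [AddCommGroup G] [AddCommGroup H] [Fintype G] [Fintype H]
    (φ : G →+ H) (hφ : Function.Surjective φ) (F : H → ℝ) :
    (∑ g, F (φ g)) / (Fintype.card G : ℝ) = (∑ y, F y) / (Fintype.card H : ℝ) := by
  classical
  have hfib : ∀ y : H, (univ.filter fun g => φ g = y).card = (univ.filter fun g => φ g = 0).card := by
    intro y
    obtain ⟨g0, hg0⟩ := hφ y
    refine Finset.card_bij' (fun g _ => g - g0) (fun g _ => g + g0) ?_ ?_ ?_ ?_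
    · intro g hg; simp at hg ⊢; simp [hg, hg0]
    · intro g hg; simp at hg ⊢; simp [hg, hg0]
    · intro g hg; simp
    · intro g hg; simp
  set c := (univ.filter fun g => φ g = 0).card with hc
  have h1 : ∀ F : H → ℝ, ∑ g, F (φ g) = c * ∑ y, F y := by
    intro F
    rw [← Finset.sum_fiberwise_of_maps_to (s := univ) (t := univ) (g := φ) (fun _ _ => mem_univ _),
      Finset.mul_sum]
    refine Finset.sum_congr rfl fun y _ => ?_
    rw [← hfib y, Finset.sum_congr rfl (g := fun _ => F y), Finset.sum_const, nsmul_eq_mul]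
    intro g hg; simp at hg; rw [hg]
  have h2 := h1 (fun _ => 1)
  simp at h2
  have hc0 : (c : ℝ) ≠ 0 := by
    intro h0
    rw [h0] at h2
    simp at h2
  have hH : (Fintype.card H : ℝ) ≠ 0 := by
    simp
  rw [h1 F, h2]
  field_simp

/-- Load of bin `y`. -/
def load {u k : ℕ} (S : Finset (Fin u → ZMod 2)) (h : Lin u k) (y : Fin k → ZMod 2) : ℕ :=
  (S.filter fun v => h v = y).card

/-- The exponential potential. -/
noncomputable def Phi {u k : ℕ} (a : ℝ) (S : Finset (Fin u → ZMod 2)) (h : Lin u k) : ℝ :=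
  (∑ y, a ^ load S h y) / 2 ^ k

lemma sum_load {u k : ℕ} (S : Finset (Fin u → ZMod 2)) (h : Lin u k) :
    ∑ y, load S h y = S.card :=
  (Finset.card_eq_sum_card_fiberwise (f := h) (s := S) (t := univ) (fun _ _ => by simp)).symm

lemma Phi_aux {u k : ℕ} (a : ℝ) (S : Finset (Fin u → ZMod 2)) (h : Lin u k) :
    1 + (a - 1) * S.card / 2 ^ k = (∑ y, (1 + (load S h y : ℝ) * (a - 1))) / 2 ^ k := by
  rw [Finset.sum_add_distrib, ← Finset.sum_mul, ← Nat.cast_sum, sum_load]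
  simp
  field_simp

lemma Phi_lower {u k : ℕ} {a : ℝ} (ha : 1 ≤ a) (S : Finset (Fin u → ZMod 2)) (h : Lin u k) :
    1 + (a - 1) * S.card / 2 ^ k ≤ Phi a S h := by
  rw [Phi_aux a S h, Phi]
  gcongr with y
  have := one_add_mul_le_pow (a := a - 1) (by linarith) (load S h y)
  simpa using this

lemma Phi_inj {u k : ℕ} {a : ℝ} (S : Finset (Fin u → ZMod 2)) (h : Lin u k)
    (hinj : Set.InjOn h S) :
    Phi a S h = 1 + (a - 1) * S.card / 2 ^ k := by
  rw [Phi_aux a S h, Phi]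
  congr 1
  refine Finset.sum_congr rfl fun y _ => ?_
  have : load S h y ≤ 1 := by
    rw [load, Finset.card_le_one]
    intro x hx z hz
    simp at hx hz
    exact hinj hx.1 hz.1 (hx.2.trans hz.2.symm)
  interval_cases load S h y <;> simp

/-- Existence of quotient maps by a single nonzero vector. -/
lemma exists_A (k : ℕ) (v : Fin (k + 1) → ZMod 2) : ∃ A : Lin (k + 1) k,
    Function.Surjective A ∧ (v ≠ 0 → ∀ x x', A x = A x' ↔ (x = x' ∨ x = x' + v)) := by
  by_cases hv : v = 0
  · subst hv
    refine ⟨LinearMap.funLeft _ _ Fin.succ, ?_, by simp⟩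
    intro y
    exact ⟨Fin.cons 0 y, by ext; simp [LinearMap.funLeft]⟩
  · obtain ⟨i, hi⟩ := Function.ne_iff.mp hv
    have hi1 : v i = 1 := by
      have : ∀ z : ZMod 2, z ≠ 0 → z = 1 := by decide
      exact this _ hi
    let A : Lin (k + 1) k :=
      { toFun := fun x j => x (i.succAbove j) + x i * v (i.succAbove j)
        map_add' := by intro x y; ext j; simp; ring
        map_smul' := by intro c x; ext j; simp; ring }
    have hA : ∀ x j, A x j = x (i.succAbove j) + x i * v (i.succAbove j) := fun _ _ => rfl
    refine ⟨A, ?_, ?_⟩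
    · intro y
      refine ⟨i.insertNth 0 y, ?_⟩
      ext j
      rw [hA]; simp
    · intro _ x x'
      have key : ∀ p q r s w : ZMod 2, p + q * w = r + s * w → q = s → p = r := by decide
      have key2 : ∀ p q r s w : ZMod 2, p + q * w = r + s * w → q ≠ s → p = r + w := by decide
      have key3 : ∀ q s : ZMod 2, q ≠ s → q = s + 1 := by decide
      have key4 : ∀ r s w : ZMod 2, (r + w) + (s + 1) * w = r + s * w := by decide
      constructor
      · intro h
        have h' : ∀ j, x (i.succAbove j) + x i * v (i.succAbove j)
            = x' (i.succAbove j) + x' i * v (i.succAbove j) := fun j => by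
          rw [← hA, ← hA, h]
        by_cases hq : x i = x' i
        · left
          ext j
          rcases Fin.eq_self_or_eq_succAbove i j with rfl | ⟨j, rfl⟩
          · rw [hq]
          · rw [key _ _ _ _ _ (h' j) hq]
        · right
          ext j
          rcases Fin.eq_self_or_eq_succAbove i j with rfl | ⟨j, rfl⟩
          · rw [Pi.add_apply, hi1, key3 _ _ hq]
          · rw [Pi.add_apply, key2 _ _ _ _ _ (h' j) hq]
      · rintro (rfl | rfl)
        · rfl
        · ext j
          rw [hA, hA, Pi.add_apply, Pi.add_apply, hi1, key4]

noncomputable def A {k : ℕ} (v : Fin (k + 1) → ZMod 2) : Lin (k + 1) k := (exists_A k v).choose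

lemma A_surj {k : ℕ} (v : Fin (k + 1) → ZMod 2) : Function.Surjective (A v) :=
  (exists_A k v).choose_spec.1

lemma A_ker {k : ℕ} {v : Fin (k + 1) → ZMod 2} (hv : v ≠ 0) (x x' : Fin (k + 1) → ZMod 2) :
    A v x = A v x' ↔ (x = x' ∨ x = x' + v) :=
  (exists_A k v).choose_spec.2 hv x x'

lemma Phi_A {u k : ℕ} (a : ℝ) (S : Finset (Fin u → ZMod 2)) (h : Lin u (k + 1))
    {v : Fin (k + 1) → ZMod 2} (hv : v ≠ 0) :
    Phi a S ((A v) ∘ₗ h : Lin u k) =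
      (∑ x, a ^ load S h x * a ^ load S h (x + v)) / 2 ^ (k + 1) := by
  have := avg_surj (A v).toAddMonoidHom (A_surj v) (fun y => a ^ load S ((A v) ∘ₗ h : Lin u k) y)
  simp only [Fintype.card_fun, ZMod.card, Fintype.card_fin] at this
  rw [Phi]
  push_cast at this
  rw [← this]
  congr 1
  refine Finset.sum_congr rfl fun x _ => ?_
  rw [← pow_add]
  congr 1
  simp only [load]
  rw [← Finset.card_union_of_disjoint]
  · congr 1
    ext w
    rw [mem_union, mem_filter, mem_filter, mem_filter]
    change (w ∈ S ∧ A v (h w) = A v x) ↔ _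
    rw [A_ker hv]
    tauto
  · rw [Finset.disjoint_filter]
    intro w _ h1 h2
    rw [h1] at h2
    exact hv (by simpa using h2)

lemma sum_Phi_A {u k : ℕ} (a : ℝ) (S : Finset (Fin u → ZMod 2)) (h : Lin u (k + 1)) :
    (∑ v ∈ univ.erase 0, Phi a S ((A v) ∘ₗ h : Lin u k)) / (2 ^ (k + 1) - 1) ≤ Phi a S h ^ 2 := by
  have h2 : (2 : ℝ) ≤ 2 ^ (k + 1) := by
    rw [pow_succ]
    have : (1 : ℝ) ≤ 2 ^ k := one_le_pow₀ (by norm_num)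
    linarith
  set N : ℝ := 2 ^ (k + 1) with hN
  set g : (Fin (k + 1) → ZMod 2) → ℝ := fun x => a ^ load S h x with hg
  have h1 : ∑ v ∈ univ.erase 0, Phi a S ((A v) ∘ₗ h : Lin u k)
      = ((∑ x, g x) ^ 2 - ∑ x, g x ^ 2) / N := by
    rw [Finset.sum_congr rfl (g := fun v => (∑ x, g x * g (x + v)) / N)
      (fun v hv => Phi_A a S h (by simpa using hv))]
    rw [← Finset.sum_div]
    congr 1
    rw [eq_sub_iff_add_eq]
    have h3 : ∑ x, g x ^ 2 = ∑ x, g x * g (x + 0) := by simp [sq]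
    rw [h3, Finset.sum_erase_add univ (fun v => ∑ x, g x * g (x + v)) (mem_univ 0),
      Finset.sum_comm, sq, Finset.sum_mul]
    refine Finset.sum_congr rfl fun x _ => ?_
    rw [← Finset.mul_sum]
    congr 1
    exact Equiv.sum_comp (Equiv.addLeft x) g
  have hcs : (∑ x, g x) ^ 2 ≤ N * ∑ x, g x ^ 2 := by
    have := sq_sum_le_card_mul_sum_sq (s := univ) (f := g)
    simpa [hN] using this
  rw [h1, div_le_iff₀ (by linarith), Phi, div_pow, ← hN, div_le_iff₀ (by linarith)]
  have : (∑ x, g x) ^ 2 / N ^ 2 * (N - 1) * N = (∑ x, g x) ^ 2 - (∑ x, g x) ^ 2 / N := by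
    field_simp
  rw [this]
  have : (∑ x, g x) ^ 2 / N ≤ ∑ x, g x ^ 2 := by
    rw [div_le_iff₀ (by linarith)]; linarith
  linarith


/-- The averaged value process going up the chain of refinements. -/
noncomputable def V {u ℓ : ℕ} (F : Lin u ℓ → ℝ) : (i : ℕ) → Lin u (ℓ + i) → ℝ
  | 0 => F
  | i + 1 => fun h =>
      (∑ v ∈ univ.erase 0, V F i ((A v) ∘ₗ h : Lin u (ℓ + i))) / (2 ^ (ℓ + i + 1) - 1)

lemma card_erase (k : ℕ) :
    (((univ : Finset (Fin (k + 1) → ZMod 2)).erase 0).card : ℝ) = 2 ^ (k + 1) - 1 := by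
  rw [Finset.card_erase_of_mem (mem_univ _), Nat.cast_sub]
  · simp
  · exact Finset.card_pos.mpr ⟨0, mem_univ _⟩

lemma two_pow_sub (k : ℕ) : (0 : ℝ) < 2 ^ (k + 1) - 1 := by
  have : (1 : ℝ) < 2 ^ (k + 1) := one_lt_pow₀ (by norm_num) (by simp)
  linarith

lemma V_nonneg {u ℓ : ℕ} (F : Lin u ℓ → ℝ) (hF : ∀ h, 0 ≤ F h) (i : ℕ) (h : Lin u (ℓ + i)) :
    0 ≤ V F i h := by
  induction i with
  | zero => exact hF h
  | succ i ih =>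
    rw [V]
    exact div_nonneg (Finset.sum_nonneg fun v _ => ih _) (two_pow_sub _).le

lemma V_le_one {u ℓ : ℕ} (F : Lin u ℓ → ℝ) (hF : ∀ h, F h ≤ 1) (i : ℕ) (h : Lin u (ℓ + i)) :
    V F i h ≤ 1 := by
  induction i with
  | zero => exact hF h
  | succ i ih =>
    rw [V, div_le_one (two_pow_sub _), ← card_erase]
    refine (Finset.sum_le_card_nsmul _ _ 1 fun v _ => ih _).trans (by simp)

noncomputable local instance (u k : ℕ) : Fintype (Lin u k) :=
  haveI : Finite (Lin u k) := DFunLike.finite _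
  Fintype.ofFinite _

lemma sum_V {u ℓ : ℕ} (F : Lin u ℓ → ℝ) (i : ℕ) :
    (∑ h, V F i h) / (Fintype.card (Lin u (ℓ + i)) : ℝ)
      = (∑ h, F h) / (Fintype.card (Lin u ℓ) : ℝ) := by
  induction i with
  | zero => rfl
  | succ i ih =>
    rw [← ih]
    simp only [V]
    rw [← Finset.sum_div, Finset.sum_comm, div_div, mul_comm, ← div_div, Finset.sum_div]
    have key : ∀ v : Fin (ℓ + i + 1) → ZMod 2,
        (∑ h : Lin u (ℓ + (i + 1)), V F i ((A v) ∘ₗ h : Lin u (ℓ + i))) /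
          (Fintype.card (Lin u (ℓ + (i + 1))) : ℝ)
        = (∑ h, V F i h) / (Fintype.card (Lin u (ℓ + i)) : ℝ) := by
      intro v
      refine avg_surj (G := Lin u (ℓ + (i + 1))) (H := Lin u (ℓ + i))
        (LinearMap.compRight (ZMod 2) (A v)).toAddMonoidHom ?_ (V F i)
      intro h
      obtain ⟨g, hg⟩ := (A v).exists_rightInverse_of_surjective (LinearMap.range_eq_top.mpr (A_surj v))
      refine ⟨(g ∘ₗ h : Lin u (ℓ + (i + 1))), ?_⟩
      change A v ∘ₗ (g ∘ₗ h) = h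
      rw [← LinearMap.comp_assoc, hg, LinearMap.id_comp]
    rw [Finset.sum_congr rfl fun v _ => key v, Finset.sum_const, nsmul_eq_mul, card_erase]
    have := (two_pow_sub (ℓ + i)).ne'
    field_simp

lemma prob_zero {u k : ℕ} (d : Fin u → ZMod 2) (hd : d ≠ 0) :
    (∑ h : Lin u k, (if h d = 0 then (1 : ℝ) else 0)) / (Fintype.card (Lin u k) : ℝ)
      = 1 / 2 ^ k := by
  have := avg_surj (G := Lin u k) (H := Fin k → ZMod 2)
    (LinearMap.applyₗ (R := ZMod 2) (M := Fin u → ZMod 2) (M₂ := Fin k → ZMod 2) d).toAddMonoidHom ?_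
    (fun y => if y = 0 then (1 : ℝ) else 0)
  · simpa using this
  · intro y
    obtain ⟨j, hj⟩ := Function.ne_iff.mp hd
    have hj1 : d j = 1 := by
      have : ∀ z : ZMod 2, z ≠ 0 → z = 1 := by decide
      exact this _ hj
    refine ⟨((LinearMap.proj j : (Fin u → ZMod 2) →ₗ[ZMod 2] ZMod 2).smulRight y : Lin u k), ?_⟩
    simp [hj1]

/-- The final averaging over the (almost surely injective) top level. -/
lemma final_avg {u ℓ : ℕ} (F : Lin u ℓ → ℝ) (hF1 : ∀ h, F h ≤ 1) (S : Finset (Fin u → ZMod 2))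
    (B : ℝ) (hB : 0 ≤ B) (i : ℕ)
    (hV : ∀ h : Lin u (ℓ + i), Set.InjOn h S → V F i h ≤ B) :
    (∑ h, F h) / (Fintype.card (Lin u ℓ) : ℝ) ≤ B + S.card ^ 2 * (1 / 2 ^ i) := by
  classical
  rw [← sum_V F i]
  have hc : (0 : ℝ) < Fintype.card (Lin u (ℓ + i)) := by
    exact_mod_cast Fintype.card_pos
  have h1 : ∀ h : Lin u (ℓ + i), V F i h ≤ B + ∑ p ∈ S.offDiag,
      (if h (p.1 - p.2) = 0 then (1 : ℝ) else 0) := by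
    intro h
    have hnn : ∀ p ∈ S.offDiag, (0:ℝ) ≤ (if h (p.1 - p.2) = 0 then (1 : ℝ) else 0) := by
      intro p _; split_ifs <;> norm_num
    by_cases hi : Set.InjOn h S
    · have := Finset.sum_nonneg hnn
      linarith [hV h hi]
    · simp only [Set.InjOn, not_forall] at hi
      obtain ⟨x, hx, y, hy, hxy, hne⟩ := hi
      have hp : (x, y) ∈ S.offDiag := by simp; exact ⟨hx, hy, hne⟩
      have := Finset.single_le_sum hnn hp
      simp only [map_sub, hxy, sub_self, if_true] at this
      have h2 := V_le_one F hF1 i h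
      simp only [map_sub]
      linarith
  calc (∑ h, V F i h) / (Fintype.card (Lin u (ℓ + i)) : ℝ)
      ≤ (∑ h : Lin u (ℓ + i), (B + ∑ p ∈ S.offDiag,
      (if h (p.1 - p.2) = 0 then (1 : ℝ) else 0))) / (Fintype.card (Lin u (ℓ + i)) : ℝ) := by
        gcongr with h; exact h1 h
    _ = B + ∑ p ∈ S.offDiag, (1 / 2 ^ (ℓ + i) : ℝ) := by
        rw [Finset.sum_add_distrib, add_div, Finset.sum_comm]
        congr 1
        · simp
        · rw [Finset.sum_div]
          refine Finset.sum_congr rfl fun p hp => prob_zero _ ?_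
          simp at hp
          exact sub_ne_zero.mpr hp.2.2
    _ ≤ _ := by
        rw [Finset.sum_const, nsmul_eq_mul]
        gcongr
        · have : S.offDiag.card ≤ S.card ^ 2 := by
            rw [Finset.offDiag_card, sq]; omega
          exact_mod_cast this
        · norm_num
        · omega

/-- Jensen step. -/
lemma V_exp {u ℓ : ℕ} {a s : ℝ} (ha : 1 ≤ a) (S : Finset (Fin u → ZMod 2)) (F : Lin u ℓ → ℝ)
    (hF1 : ∀ h, F h ≤ 1) (hF : ∀ h, 0 < F h → Real.exp s ≤ Phi a S h)
    (i : ℕ) : ∀ τ : ℝ, 0 ≤ τ → 2 ^ i * τ ≤ 1 → ∀ h : Lin u (ℓ + i),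
    V F i h ≤ Real.exp (-s * τ) * Phi a S h ^ (2 ^ i * τ) := by
  have hP0 : ∀ {k : ℕ} (h : Lin u k), 1 ≤ Phi a S h := by
    intro k h
    refine le_trans ?_ (Phi_lower ha S h)
    have : 0 ≤ (a - 1) * S.card / 2 ^ k := by
      have : 0 ≤ a - 1 := by linarith
      positivity
    linarith
  induction i with
  | zero =>
    intro τ hτ _ h
    rw [V]
    by_cases hp : 0 < F h
    · have h1 := hF h hp
      refine (hF1 h).trans ?_
      have h2 : Real.exp s ^ τ ≤ Phi a S h ^ τ := Real.rpow_le_rpow (Real.exp_pos _).le h1 hτ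
      rw [← Real.exp_mul] at h2
      simp only [pow_zero, one_mul]
      calc (1:ℝ) = Real.exp (-s * τ) * Real.exp (s * τ) := by rw [← Real.exp_add]; simp
        _ ≤ _ := by gcongr
    · have := hP0 h
      have : 0 ≤ Real.exp (-s * τ) * Phi a S h ^ (2 ^ 0 * τ) := by positivity
      have h3 : F h ≤ 0 := not_lt.mp hp
      exact h3.trans this
  | succ i ih =>
    intro τ hτ h1 h
    set θ : ℝ := 2 ^ i * τ with hθ
    have hθ0 : 0 ≤ θ := by positivity
    have hθ1 : θ ≤ 1 := by
      rw [pow_succ] at h1; nlinarith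
    have hN := two_pow_sub (ℓ + i)
    set N : ℝ := 2 ^ (ℓ + i + 1) - 1 with hNdef
    rw [V]
    have hjen := (Real.concaveOn_rpow hθ0 hθ1).le_map_sum (t := univ.erase (0 : Fin (ℓ + i + 1) → ZMod 2))
      (w := fun _ => 1 / N) (p := fun v => Phi a S ((A v) ∘ₗ h : Lin u (ℓ + i)))
      (fun v _ => by positivity)
      (by rw [Finset.sum_const, nsmul_eq_mul, card_erase, ← hNdef]; field_simp)
      (fun v _ => by simp only [Set.mem_Ici]; linarith [hP0 ((A v) ∘ₗ h : Lin u (ℓ + i))])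
    simp only [smul_eq_mul, ← Finset.mul_sum] at hjen
    have hs := sum_Phi_A (k := ℓ + i) a S h
    rw [← hNdef] at hs
    have hb : (1 / N * ∑ v ∈ univ.erase 0, Phi a S ((A v) ∘ₗ h : Lin u (ℓ + i))) ^ θ
        ≤ Phi a S h ^ (2 ^ (i + 1) * τ) := by
      have : Phi a S h ^ ((2:ℝ) ^ (i + 1) * τ) = (Phi a S h ^ 2) ^ θ := by
        rw [← Real.rpow_natCast (Phi a S h) 2, ← Real.rpow_mul (by linarith [hP0 h])]
        congr 1
        rw [hθ]; push_cast; ring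
      rw [this]
      refine Real.rpow_le_rpow ?_ ?_ hθ0
      · exact mul_nonneg (by positivity) (Finset.sum_nonneg fun v _ => by
          linarith [hP0 ((A v) ∘ₗ h : Lin u (ℓ + i))])
      · rw [one_div, inv_mul_eq_div]; exact hs
    calc (∑ v ∈ univ.erase 0, V F i ((A v) ∘ₗ h : Lin u (ℓ + i))) / N
        ≤ (∑ v ∈ univ.erase 0, Real.exp (-s * τ) * Phi a S ((A v) ∘ₗ h : Lin u (ℓ + i)) ^ θ) / N := by
          gcongr with v hv
          exact ih τ hτ hθ1 _
      _ = Real.exp (-s * τ) * (1 / N * ∑ v ∈ univ.erase 0, Phi a S ((A v) ∘ₗ h : Lin u (ℓ + i)) ^ θ) := by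
          rw [← Finset.mul_sum]; ring
      _ ≤ _ := by
          gcongr
          exact hjen.trans hb

/-- excess -/
noncomputable def ex {u k : ℕ} (a : ℝ) (S : Finset (Fin u → ZMod 2)) (h : Lin u k) : ℝ :=
  Phi a S h - 1 - (a - 1) * S.card / 2 ^ k

lemma V_step {u ℓ : ℕ} {a α β b : ℝ} (S : Finset (Fin u → ZMod 2)) (F : Lin u ℓ → ℝ)
    (i : ℕ) (hβ : 0 ≤ β) (hV : ∀ h : Lin u (ℓ + i), V F i h ≤ α + β * ex a S h)
    (hb : b = (a - 1) * S.card / 2 ^ (ℓ + (i + 1)))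
    (h : Lin u (ℓ + (i + 1))) :
    V F (i + 1) h ≤ α + β * (2 * ex a S h + (ex a S h + b) ^ 2) := by
  have hN := two_pow_sub (ℓ + i)
  have hs := sum_Phi_A (k := ℓ + i) a S h
  have hcard := card_erase (ℓ + i)
  set N : ℝ := 2 ^ (ℓ + i + 1) - 1 with hNdef
  have hb2 : (a - 1) * S.card / 2 ^ (ℓ + i) = 2 * b := by
    rw [hb, ← add_assoc, pow_succ]; field_simp
  rw [V, ← hNdef]
  calc (∑ v ∈ univ.erase 0, V F i ((A v) ∘ₗ h : Lin u (ℓ + i))) / N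
        ≤ (∑ v ∈ univ.erase 0, (α + β * ex a S ((A v) ∘ₗ h : Lin u (ℓ + i)))) / N := by
          gcongr with v hv
          exact hV _
    _ = α + β * ((∑ v ∈ univ.erase 0, Phi a S ((A v) ∘ₗ h : Lin u (ℓ + i))) / N - 1 - 2 * b) := by
          simp only [ex, hb2]
          rw [Finset.sum_add_distrib, ← Finset.mul_sum, Finset.sum_sub_distrib,
            Finset.sum_sub_distrib, Finset.sum_const, Finset.sum_const, Finset.sum_const,
            nsmul_eq_mul, nsmul_eq_mul, nsmul_eq_mul, hcard]
          field_simp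
    _ ≤ α + β * (Phi a S h ^ 2 - 1 - 2 * b) := by gcongr
    _ = _ := by
          have : Phi a S h = 1 + b + ex a S h := by rw [ex, hb]; ring
          rw [this]; ring


lemma exp_neg_le3 {x : ℝ} (hx : 0 < x) : Real.exp (-x) ≤ 6 * (1 / x) ^ 3 := by
  have h := Real.pow_div_factorial_le_exp x hx.le 3
  rw [show ((Nat.factorial 3 : ℕ) : ℝ) = 6 by norm_num [Nat.factorial]] at h
  rw [Real.exp_neg, inv_le_comm₀ (Real.exp_pos _) (by positivity)]
  refine le_trans (le_of_eq ?_) h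
  field_simp

lemma exp_neg_le2 {x : ℝ} (hx : 0 < x) : Real.exp (-x) ≤ 2 * (1 / x) ^ 2 := by
  have h := Real.pow_div_factorial_le_exp x hx.le 2
  rw [show ((Nat.factorial 2 : ℕ) : ℝ) = 2 by norm_num [Nat.factorial]] at h
  rw [Real.exp_neg, inv_le_comm₀ (Real.exp_pos _) (by positivity)]
  refine le_trans (le_of_eq ?_) h
  field_simp

lemma ex_nonneg {u k : ℕ} {a : ℝ} (ha : 1 ≤ a) (S : Finset (Fin u → ZMod 2)) (h : Lin u k) :
    0 ≤ ex a S h := by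
  have := Phi_lower ha S h
  rw [ex]; linarith

/-- Phase B. -/
lemma phaseB {u ℓ : ℕ} {a s μ : ℝ} (ha : 1 ≤ a) (hs : 1 ≤ s) (S : Finset (Fin u → ZMod 2))
    (hμ : μ = (a - 1) * S.card / 2 ^ ℓ) (F : Lin u ℓ → ℝ)
    (hF1 : ∀ h, F h ≤ 1) (hF : ∀ h, 0 < F h → Real.exp s ≤ Phi a S h)
    (i₀ : ℕ) (hi₀ : μ ≤ 2 ^ i₀) (hi₀' : i₀ = 0 ∨ 2 ^ i₀ ≤ 2 * μ) (j : ℕ) :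
    ∀ h : Lin u (ℓ + (i₀ + j)), V F (i₀ + j) h ≤
      24 * (μ ^ 2 / s ^ 2 + μ ^ 2 * 2 ^ (i₀ + j) / s ^ 3) + 24 * (2 ^ (i₀ + j) / s) ^ 3 * ex a S h := by
  have hs0 : 0 < s := by linarith
  have hμ0 : 0 ≤ μ := by
    rw [hμ]
    have : 0 ≤ a - 1 := by linarith
    positivity
  have hexp : ∀ (i : ℕ) (h : Lin u (ℓ + i)),
      V F i h ≤ Real.exp (-(s / 2 ^ i)) * (1 + μ / 2 ^ i + ex a S h) := by
    intro i h
    have := V_exp ha S F hF1 hF i (1 / 2 ^ i) (by positivity) (by field_simp; rfl) h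
    rw [show (2:ℝ) ^ i * (1 / 2 ^ i) = 1 by field_simp, Real.rpow_one] at this
    convert this using 2
    · congr 1; ring
    · rw [ex, hμ, pow_add]; field_simp; ring
  induction j with
  | zero =>
    intro h
    change Lin u (ℓ + i₀) at h
    have he := ex_nonneg ha S h
    change V F i₀ h ≤ 24 * (μ ^ 2 / s ^ 2 + μ ^ 2 * 2 ^ i₀ / s ^ 3) + 24 * (2 ^ i₀ / s) ^ 3 * ex a S h
    rcases hi₀' with h0 | h0
    · subst h0
      by_cases hp : 0 < F h
      · have h1 := hF h hp
        have h2 : Phi a S h = 1 + μ + ex a S h := by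
          rw [ex, hμ]; simp
        have h3 : (2.7 : ℝ) ≤ Real.exp s := by
          have := Real.exp_one_gt_d9
          have := Real.exp_le_exp.mpr hs
          linarith
        have h4 : Real.exp s ≤ 4 * ex a S h := by
          simp only [pow_zero] at hi₀
          have h5 : Real.exp s ≤ 1 + μ + ex a S h := h2 ▸ h1
          nlinarith [Real.exp_one_gt_d9, Real.exp_le_exp.mpr hs]
        have h6 := exp_neg_le3 hs0
        have h7 : V F 0 h ≤ 1 := hF1 h
        have h8 : (1 : ℝ) ≤ 24 * (1 / s) ^ 3 * ex a S h := by
          calc (1:ℝ) = Real.exp (-s) * Real.exp s := by rw [← Real.exp_add]; simp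
            _ ≤ 6 * (1 / s) ^ 3 * (4 * ex a S h) := by gcongr
            _ = _ := by ring
        simp only [pow_zero]
        have : 0 ≤ 24 * (μ ^ 2 / s ^ 2 + μ ^ 2 * 1 / s ^ 3) := by positivity
        linarith
      · have : V F 0 h ≤ 0 := not_lt.mp hp
        refine this.trans ?_
        have := ex_nonneg ha S h
        positivity
    · refine (hexp i₀ h).trans ?_
      have hx : 0 < s / 2 ^ i₀ := by positivity
      have e2 := exp_neg_le2 hx
      have e3 := exp_neg_le3 hx
      rw [one_div_div] at e2 e3
      have hb : μ / 2 ^ i₀ ≤ 1 := by rw [div_le_one (by positivity)]; exact hi₀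
      have h4 : (2 ^ i₀ / s) ^ 2 ≤ 4 * (μ ^ 2 / s ^ 2) := by
        calc (2 ^ i₀ / s) ^ 2 ≤ (2 * μ / s) ^ 2 := by gcongr
          _ = _ := by ring
      have h5 : 0 ≤ μ ^ 2 * 2 ^ i₀ / s ^ 3 := by positivity
      have h5' : 0 ≤ μ ^ 2 / s ^ 2 := by positivity
      have h6 : 0 ≤ (2 ^ i₀ / s) ^ 3 * ex a S h := mul_nonneg (by positivity) he
      calc Real.exp (-(s / 2 ^ i₀)) * (1 + μ / 2 ^ i₀ + ex a S h)
          ≤ Real.exp (-(s / 2 ^ i₀)) * (2 + ex a S h) := by gcongr; linarith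
        _ = Real.exp (-(s / 2 ^ i₀)) * 2 + Real.exp (-(s / 2 ^ i₀)) * ex a S h := by ring
        _ ≤ (2 * (2 ^ i₀ / s) ^ 2) * 2 + (6 * (2 ^ i₀ / s) ^ 3) * ex a S h := by gcongr
        _ ≤ _ := by linarith
  | succ j ih =>
    intro h
    have he := ex_nonneg ha S h
    have hstep := V_step (b := μ / 2 ^ (i₀ + j + 1)) S F (i₀ + j) (by positivity) ih
      (by rw [hμ, div_div, ← pow_add]) h
    change V F (i₀ + j + 1) h ≤ _
    have hexp' := hexp (i₀ + j + 1) h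
    change V F (i₀ + j + 1) h ≤ 24 * (μ ^ 2 / s ^ 2 + μ ^ 2 * 2 ^ (i₀ + j + 1) / s ^ 3)
      + 24 * (2 ^ (i₀ + j + 1) / s) ^ 3 * ex a S h
    have h2i : (2 : ℝ) ^ i₀ ≤ 2 ^ (i₀ + j) := pow_le_pow_right₀ (by norm_num) (by omega)
    rw [pow_succ (2 : ℝ) (i₀ + j)] at hstep hexp' ⊢
    set q : ℝ := 2 ^ (i₀ + j) with hq
    have hq0 : 0 < q := by positivity
    set e := ex a S h with hedef
    have hb0 : 0 ≤ μ / (q * 2) := by positivity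
    have hb : μ / (q * 2) ≤ 1 / 2 := by
      rw [div_le_iff₀ (by positivity)]; linarith
    by_cases hle : e ≤ 1
    · refine hstep.trans ?_
      have h1 : 2 * e + (e + μ / (q * 2)) ^ 2 ≤ 8 * e + (μ / (q * 2)) ^ 2 := by nlinarith
      have h2 : 24 * (q / s) ^ 3 * (2 * e + (e + μ / (q * 2)) ^ 2) ≤
          24 * (q / s) ^ 3 * (8 * e + (μ / (q * 2)) ^ 2) := by gcongr
      have h3 : 24 * (q / s) ^ 3 * (8 * e + (μ / (q * 2)) ^ 2) =
          24 * (q * 2 / s) ^ 3 * e + 6 * (μ ^ 2 * q / s ^ 3) := by field_simp; ring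
      have h4 : 0 ≤ μ ^ 2 * q / s ^ 3 := by positivity
      have h5 : μ ^ 2 * (q * 2) / s ^ 3 = 2 * (μ ^ 2 * q / s ^ 3) := by ring
      rw [h5]
      linarith
    · refine hexp'.trans ?_
      have hx : 0 < s / (q * 2) := by positivity
      have e3 := exp_neg_le3 hx
      rw [one_div_div] at e3
      have h5 : 0 ≤ 24 * (μ ^ 2 / s ^ 2 + μ ^ 2 * (q * 2) / s ^ 3) := by positivity
      have h6 : 0 ≤ (q * 2 / s) ^ 3 * e := mul_nonneg (by positivity) he
      calc Real.exp (-(s / (q * 2))) * (1 + μ / (q * 2) + e)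
          ≤ 6 * (q * 2 / s) ^ 3 * (3 * e) := by gcongr; linarith
        _ ≤ _ := by linarith

lemma main_bound {u ℓ : ℕ} {a s μ : ℝ} (ha : 1 ≤ a) (hs : 1 ≤ s) (S : Finset (Fin u → ZMod 2))
    (hμ : μ = (a - 1) * S.card / 2 ^ ℓ) (hμs : 2 * μ ≤ s) (F : Lin u ℓ → ℝ)
    (hF1 : ∀ h, F h ≤ 1) (hF : ∀ h, 0 < F h → Real.exp s ≤ Phi a S h) :
    (∑ h, F h) / (Fintype.card (Lin u ℓ) : ℝ) ≤ 264 * (μ / s) ^ 2 := by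
  have hs0 : 0 < s := by linarith
  have hμ0 : 0 ≤ μ := by
    rw [hμ]
    have : 0 ≤ a - 1 := by linarith
    positivity
  obtain ⟨i₀, hi₀, hi₀'⟩ : ∃ i₀ : ℕ, μ ≤ 2 ^ i₀ ∧ (i₀ = 0 ∨ 2 ^ i₀ ≤ 2 * μ) := by
    by_cases h1 : 1 ≤ μ
    · obtain ⟨n, hn1, hn2⟩ := exists_nat_pow_near h1 (one_lt_two)
      exact ⟨n + 1, hn2.le, Or.inr (by rw [pow_succ]; linarith)⟩
    · exact ⟨0, by simp; linarith, Or.inl rfl⟩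
  obtain ⟨I, hI1, hI2⟩ : ∃ I : ℕ, s ≤ 2 ^ I ∧ 2 ^ I ≤ 2 * s := by
    obtain ⟨n, hn1, hn2⟩ := exists_nat_pow_near hs (one_lt_two)
    exact ⟨n + 1, hn2.le, (by rw [pow_succ]; linarith)⟩
  have hiI : i₀ ≤ I := by
    rcases hi₀' with h | h
    · omega
    · have : (2:ℝ) ^ i₀ ≤ 2 ^ I := by linarith
      exact (pow_le_pow_iff_right₀ (by norm_num : (1:ℝ) < 2)).mp this
  obtain ⟨j₀, rfl⟩ := Nat.exists_eq_add_of_le hiI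
  have hB := phaseB ha hs S hμ F hF1 hF i₀ hi₀ hi₀' j₀
  set I := i₀ + j₀ with hI
  set M := μ ^ 2 / s ^ 2 with hM
  have hM0 : 0 ≤ M := by positivity
  have hA : ∀ j : ℕ, ∀ h : Lin u (ℓ + (I + j)), V F (I + j) h ≤
      (72 * M + 192 * M * (1 - (3 / 4) ^ j)) + 192 * 3 ^ j * ex a S h := by
    intro j
    induction j with
    | zero =>
      intro h
      have he := ex_nonneg ha S h
      refine (hB h).trans ?_
      simp only [pow_zero] at he ⊢
      have h1 : μ ^ 2 * 2 ^ I / s ^ 3 ≤ 2 * M := by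
        calc μ ^ 2 * 2 ^ I / s ^ 3 ≤ μ ^ 2 * (2 * s) / s ^ 3 := by gcongr
          _ = 2 * M := by rw [hM]; field_simp
      have h2 : (2 ^ I / s) ^ 3 ≤ 8 := by
        have : 2 ^ I / s ≤ 2 := by rw [div_le_iff₀ hs0]; exact hI2
        calc (2 ^ I / s) ^ 3 ≤ 2 ^ 3 := by gcongr
          _ = 8 := by norm_num
      have h3 : (2 ^ I / s) ^ 3 * ex a S h ≤ 8 * ex a S h := by gcongr
      linarith
    | succ j ih =>
      intro h
      have he := ex_nonneg ha S h
      have hstep := V_step (b := μ / 2 ^ (I + j + 1)) S F (I + j) (by positivity) ih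
        (by rw [hμ, div_div, ← pow_add]) h
      have hone := V_le_one F hF1 (I + j + 1) h
      change V F (I + j + 1) h ≤ _
      set e := ex a S h with hedef
      have h34 : (3 / 4 : ℝ) ^ (j + 1) ≤ 1 := pow_le_one₀ (by norm_num) (by norm_num)
      have h3j : (1 : ℝ) ≤ 3 ^ j := one_le_pow₀ (by norm_num)
      have h4j : (1 : ℝ) ≤ 2 ^ j := one_le_pow₀ (by norm_num)
      set b := μ / 2 ^ (I + j + 1) with hbdef
      have hb0 : 0 ≤ b := by positivity
      have hden : s * 2 ^ j * 2 ≤ 2 ^ (I + j + 1) := by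
        rw [pow_succ, pow_add]; gcongr
      have hb1 : b ≤ μ / (s * 2 ^ j * 2) := by rw [hbdef]; gcongr
      have hb : b ≤ 1 / 4 := by
        rw [hbdef, div_le_iff₀ (by positivity)]
        nlinarith
      by_cases hle : e ≤ 1 / 2
      · refine hstep.trans ?_
        have h1 : 2 * e + (e + b) ^ 2 ≤ 3 * e + b ^ 2 := by nlinarith
        have hb2 : b ^ 2 ≤ M / 4 / 4 ^ j := by
          calc b ^ 2 ≤ (μ / (s * 2 ^ j * 2)) ^ 2 := by gcongr
            _ = M / 4 / 4 ^ j := by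
              rw [hM, show (4:ℝ) ^ j = (2 ^ j) ^ 2 by rw [← pow_mul, mul_comm, pow_mul]; norm_num]
              field_simp; norm_num
        have h2 : 192 * 3 ^ j * (2 * e + (e + b) ^ 2) ≤ 192 * 3 ^ j * (3 * e + M / 4 / 4 ^ j) := by
          exact mul_le_mul_of_nonneg_left (by linarith) (by positivity)
        have h3 : 192 * 3 ^ j * (3 * e + M / 4 / 4 ^ j)
            = 192 * 3 ^ (j + 1) * e + 192 * M * ((3 / 4) ^ j - (3 / 4) ^ (j + 1)) := by
          rw [pow_succ, pow_succ, div_pow]; field_simp; ring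
        linarith
      · refine hone.trans ?_
        have h1 : 0 ≤ 192 * M * (1 - (3 / 4) ^ (j + 1)) := mul_nonneg (by positivity) (by linarith)
        have h3 : (3 : ℝ) ^ (j + 1) = 3 * 3 ^ j := by ring
        rw [h3]
        nlinarith
  have hfin : ∀ j : ℕ, (∑ h, F h) / (Fintype.card (Lin u ℓ) : ℝ)
      ≤ 264 * M + S.card ^ 2 * (1 / 2) ^ j := by
    intro j
    have := final_avg F hF1 S (264 * M) (by positivity) (I + j) ?_
    · refine this.trans ?_
      gcongr
      rw [one_div_pow]
      gcongr
      · norm_num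
      · omega
    · intro h hinj
      refine (hA j h).trans ?_
      have : ex a S h = 0 := by rw [ex, Phi_inj S h hinj]; ring
      rw [this]
      have : 0 ≤ M * (3 / 4) ^ j := by positivity
      linarith
  have hlim : Filter.Tendsto (fun j : ℕ => 264 * M + (S.card : ℝ) ^ 2 * (1 / 2) ^ j) Filter.atTop
      (nhds (264 * M + (S.card : ℝ) ^ 2 * 0)) :=
    ((tendsto_pow_atTop_nhds_zero_of_lt_one (by norm_num) (by norm_num)).const_mul _).const_add _
  have := ge_of_tendsto' hlim hfin
  rw [div_pow]
  linarith


lemma card_bound {u ℓ : ℕ} {a s μ : ℝ} (ha : 1 ≤ a) (hs : 1 ≤ s) (S : Finset (Fin u → ZMod 2))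
    (hμ : μ = (a - 1) * S.card / 2 ^ ℓ) (hμs : 2 * μ ≤ s) (P : Lin u ℓ → Prop)
    (hP : ∀ h, P h → Real.exp s ≤ Phi a S h) :
    (Nat.card {h : Lin u ℓ // P h} : ℝ) / (Nat.card (Lin u ℓ) : ℝ) ≤ 264 * (μ / s) ^ 2 := by
  classical
  have := main_bound ha hs S hμ hμs (fun h => if P h then 1 else 0)
    (fun h => by split_ifs <;> norm_num)
    (fun h hh => hP h (by by_contra hn; simp [hn] at hh))
  rw [Nat.card_eq_fintype_card, Nat.card_eq_fintype_card, Fintype.card_subtype]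
  simpa using this

lemma exp_le_Phi {u ℓ : ℕ} {a s r : ℝ} (ha : 1 ≤ a) (S : Finset (Fin u → ZMod 2)) (h : Lin u ℓ)
    (hr : r ≤ (maxLoad u ℓ S h : ℝ)) (hsr : s + Real.log (2 ^ ℓ) ≤ r * Real.log a) :
    Real.exp s ≤ Phi a S h := by
  obtain ⟨y, -, hy⟩ := Finset.exists_mem_eq_sup (univ : Finset (Fin ℓ → ZMod 2)) ⟨0, mem_univ _⟩
    (load S h)
  have hy' : maxLoad u ℓ S h = load S h y := hy
  have ha0 : 0 < a := by linarith
  rw [Phi, le_div_iff₀ (by positivity)]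
  have h1 : a ^ load S h y ≤ ∑ y, a ^ load S h y :=
    Finset.single_le_sum (f := fun y => a ^ load S h y) (fun _ _ => by positivity) (mem_univ y)
  refine le_trans ?_ h1
  rw [hy'] at hr
  have hla : 0 ≤ Real.log a := Real.log_nonneg ha
  calc Real.exp s * 2 ^ ℓ = Real.exp (s + Real.log (2 ^ ℓ)) := by
        rw [Real.exp_add, Real.exp_log (by positivity)]
    _ ≤ Real.exp (load S h y * Real.log a) := by
        apply Real.exp_le_exp.mpr
        exact hsr.trans (by gcongr)
    _ = a ^ load S h y := by
        rw [Real.exp_nat_mul, Real.exp_log ha0]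

end LinHash

/-- There exist absolute constants C > 0 and D > 0 such that the following holds.
Let n = 2^ℓ, let S ⊆ F_2^u have size m with u ≥ ℓ, set λ = m/n, let t > 0 be the real number
defined by t · ln(t/(e·λ)) = ln n, and let h : F_2^u → F_2^ℓ be a uniformly random linear map.
Then for every real R > 1 satisfying R (t/λ)^{1 − 1/R} ≥ D, one has
Pr[M(S,h) ≥ R t] ≤ (C/R^2) (λ/t)^{2 − 2/R}. -/
theorem stmt_18 :
    ∃ C > (0 : ℝ), ∃ D > (0 : ℝ),
      ∀ (ℓ u : ℕ), ℓ ≤ u →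
      ∀ (S : Finset (Fin u → ZMod 2)) (m n : ℕ), S.card = m → n = 2 ^ ℓ →
      ∀ lam : ℝ, lam = (m : ℝ) / n →
      ∀ t : ℝ, 0 < t → t * Real.log (t / (Real.exp 1 * lam)) = Real.log n →
      ∀ R : ℝ, 1 < R → D ≤ R * (t / lam) ^ (1 - 1 / R) →
      (Nat.card {h : Lin u ℓ // R * t ≤ (maxLoad u ℓ S h : ℝ)} : ℝ) /
          (Nat.card (Lin u ℓ) : ℝ) ≤
        (C / R ^ 2) * (lam / t) ^ (2 - 2 / R) := by
  refine ⟨264 * Real.exp 1 ^ 2, by positivity, 2 * Real.exp 1, by positivity, ?_⟩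
  intro ℓ u _ S m n hm hn lam hlam t ht hteq R hR hD
  have hE : 0 < Real.exp 1 := Real.exp_pos _
  have hE1 : 1 < Real.exp 1 := by simp
  have hR0 : 0 < R := by linarith
  have hRi : 0 < 1 - 1 / R := by
    have : 1 / R < 1 := by rw [div_lt_one hR0]; exact hR
    linarith
  have hnR : (n : ℝ) = 2 ^ ℓ := by rw [hn]; push_cast; rfl
  have hn1 : (1 : ℝ) ≤ n := by rw [hnR]; exact one_le_pow₀ (by norm_num)
  have hm1 : (1 : ℝ) ≤ m := by
    rcases Nat.eq_zero_or_pos m with h0 | h0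
    · exfalso
      rw [hlam, h0] at hD
      simp only [Nat.cast_zero, zero_div, div_zero] at hD
      rw [Real.zero_rpow hRi.ne'] at hD
      linarith
    · exact_mod_cast h0
  have hlam0 : 0 < lam := by rw [hlam]; positivity
  set x := t / lam with hx
  have hx0 : 0 < x := by positivity
  have hlog : Real.log (t / (Real.exp 1 * lam)) = Real.log x - 1 := by
    rw [mul_comm, ← div_div, ← hx, Real.log_div hx0.ne' hE.ne', Real.log_exp]
  rw [hlog] at hteq
  have hlogn : 0 ≤ Real.log n := Real.log_nonneg hn1
  have hlx : 1 ≤ Real.log x := by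
    by_contra hc
    push Not at hc
    nlinarith
  have ht1 : 1 ≤ t := by
    by_contra hc
    push Not at hc
    have h1 : Real.log x ≤ Real.log n := by
      apply Real.log_le_log hx0
      rw [hx, hlam, div_div_eq_mul_div, div_le_iff₀ (by linarith)]
      nlinarith
    nlinarith
  set y := x ^ (1 - 1 / R) with hy
  have hy0 : 0 < y := by positivity
  have hxy : x ^ (1 / R) = x / y := by
    rw [hy, Real.rpow_sub hx0, Real.rpow_one]
    field_simp
  set a := Real.exp 1 * x ^ (1 / R) with hadef
  have hloga : Real.log a = 1 + Real.log x / R := by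
    rw [hadef, Real.log_mul hE.ne' (by positivity), Real.log_exp, Real.log_rpow hx0]; ring
  have ha0 : 0 < a := by positivity
  have ha : 1 ≤ a := by
    rw [← Real.log_nonneg_iff ha0, hloga]
    positivity
  have hs : 1 ≤ R * t := by nlinarith
  set μ := (a - 1) * (S.card : ℝ) / 2 ^ ℓ with hμ
  have hμ' : μ = (a - 1) * lam := by rw [hμ, hm, hlam, hnR]; ring
  have hμ0 : 0 ≤ μ := by
    rw [hμ']; exact mul_nonneg (by linarith) hlam0.le
  have hμle : μ ≤ Real.exp 1 * t / y := by
    have : Real.exp 1 * t / y = a * lam := by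
      rw [hadef, hxy, hx]; field_simp
    rw [this, hμ']
    nlinarith
  have hμs : 2 * μ ≤ R * t := by
    have : Real.exp 1 * t / y ≤ R * t / 2 := by
      rw [div_le_iff₀ hy0]
      nlinarith
    linarith
  refine (LinHash.card_bound ha hs S hμ hμs _ ?_).trans ?_
  · intro h hh
    refine LinHash.exp_le_Phi ha S h hh ?_
    rw [← hnR, hloga]
    have : R * t * (1 + Real.log x / R) = R * t + t * Real.log x := by field_simp
    rw [this]
    nlinarith
  · have h1 : (lam / t) ^ (2 - 2 / R) = (1 / y) ^ 2 := by
      have : lam / t = x⁻¹ := by rw [hx, inv_div]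
      rw [this, Real.inv_rpow hx0.le, one_div, inv_pow, hy, ← Real.rpow_natCast,
        ← Real.rpow_mul hx0.le]
      congr 2
      push_cast
      ring
    rw [h1]
    calc 264 * (μ / (R * t)) ^ 2 ≤ 264 * (Real.exp 1 * t / y / (R * t)) ^ 2 := by gcongr
      _ = _ := by field_simp
end

section
/- For every ε > 0 there exists ρ_0 > 0 such that the following holds. Let n = 2^ℓ, let S ⊆ F_2^u have size m with u ≥ ℓ, set λ = m/n, and let t > 0 be the real number defined by t · ln(t/(e·λ)) = ln n. If t/λ ≥ ρ_0, then the expected maximum load of a uniformly random linear map h : F_2^u → F_2^ℓ satisfies E_h[M(S,h)] ≤ (1 + ε) t. -/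
open Finset BigOperators in
/-- Averages are preserved by surjective homomorphisms of finite groups. -/
lemma expect_comp_surj {A B : Type*} [AddCommGroup A] [AddCommGroup B] [Fintype A] [Fintype B]
    (φ : A →+ B) (hφ : Function.Surjective φ) (f : B → ℝ) :
    𝔼 a, f (φ a) = 𝔼 b, f b := by
  classical
  have h1 : ∀ b : B, 𝔼 a, f (φ a + b) = 𝔼 a, f (φ a) := by
    intro b
    obtain ⟨c, rfl⟩ := hφ b
    simp_rw [← map_add]
    exact Fintype.expect_equiv (Equiv.addRight c) _ _ (fun x => rfl)
  have h2 : ∀ a : A, 𝔼 b, f (φ a + b) = 𝔼 b, f b := fun a =>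
    Fintype.expect_equiv (Equiv.addLeft (φ a)) _ _ (fun x => rfl)
  calc 𝔼 a, f (φ a) = 𝔼 b : B, 𝔼 a, f (φ a + b) := by
        simp_rw [h1]; rw [Finset.expect_const Finset.univ_nonempty]
    _ = 𝔼 a, 𝔼 b : B, f (φ a + b) := Finset.expect_comm _ _ _
    _ = 𝔼 b, f b := by
        simp_rw [h2]; rw [Finset.expect_const Finset.univ_nonempty]

/-- The load of a bin, as a natural number. -/
def binLoad {u ℓ : ℕ} (S : Finset (Fin u → ZMod 2)) (h : Lin u ℓ) (y : Fin ℓ → ZMod 2) : ℕ :=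
  (S.filter fun v => h v = y).card

/-- Exponential weight of a bin. -/
noncomputable def expLoad {u ℓ : ℕ} (s : ℝ) (S : Finset (Fin u → ZMod 2)) (h : Lin u ℓ)
    (y : Fin ℓ → ZMod 2) : ℝ := Real.exp (s * binLoad S h y)

open Finset BigOperators in
/-- Average exponential weight. -/
noncomputable def potential {u ℓ : ℕ} (s : ℝ) (S : Finset (Fin u → ZMod 2)) (h : Lin u ℓ) : ℝ :=
  𝔼 y, expLoad s S h y

lemma expLoad_pos {u ℓ : ℕ} (s : ℝ) (S : Finset (Fin u → ZMod 2)) (h : Lin u ℓ)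
    (y : Fin ℓ → ZMod 2) : 0 < expLoad s S h y := Real.exp_pos _

lemma potential_pos {u ℓ : ℕ} (s : ℝ) (S : Finset (Fin u → ZMod 2)) (h : Lin u ℓ) :
    0 < potential s S h :=
  Finset.expect_pos (fun y _ => expLoad_pos s S h y) Finset.univ_nonempty

lemma exists_quot {ℓ : ℕ} (w : Fin (ℓ + 1) → ZMod 2) (hw : w ≠ 0) :
    ∃ q : Lin (ℓ + 1) ℓ, Function.Surjective q ∧ LinearMap.ker q = Submodule.span (ZMod 2) {w} := by
  have hfr : Module.finrank (ZMod 2)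
      ((Fin (ℓ + 1) → ZMod 2) ⧸ (Submodule.span (ZMod 2) {w})) =
      Module.finrank (ZMod 2) (Fin ℓ → ZMod 2) := by
    have h1 := Submodule.finrank_quotient_add_finrank (Submodule.span (ZMod 2) {w})
    rw [finrank_span_singleton hw] at h1
    simp at h1 ⊢
    omega
  let e := LinearEquiv.ofFinrankEq _ _ hfr
  refine ⟨e.toLinearMap ∘ₗ Submodule.mkQ _, ?_, ?_⟩
  · exact e.surjective.comp (Submodule.mkQ_surjective _)
  · rw [LinearEquiv.ker_comp, Submodule.ker_mkQ]

lemma binLoad_quot {u ℓ : ℕ} (S : Finset (Fin u → ZMod 2)) (h : Lin u (ℓ + 1))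
    (w : Fin (ℓ + 1) → ZMod 2) (hw : w ≠ 0) (q : Lin (ℓ + 1) ℓ)
    (hq : LinearMap.ker q = Submodule.span (ZMod 2) {w}) (y : Fin (ℓ + 1) → ZMod 2) :
    binLoad S (q ∘ₗ h) (q y) = binLoad S h y + binLoad S h (y + w) := by
  classical
  unfold binLoad
  rw [← Finset.card_union_of_disjoint]
  · congr 1
    rw [← Finset.filter_or]
    apply Finset.filter_congr
    intro v _
    have hk : q (h v) = q y ↔ h v - y ∈ Submodule.span (ZMod 2) {w} := by
      rw [← hq, LinearMap.mem_ker, map_sub, sub_eq_zero]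
    rw [LinearMap.comp_apply, hk, Submodule.mem_span_singleton]
    constructor
    · rintro ⟨a, ha⟩
      have : a = 0 ∨ a = 1 := (by decide : ∀ a : ZMod 2, a = 0 ∨ a = 1) a
      rcases this with rfl | rfl
      · left; rw [zero_smul] at ha; exact sub_eq_zero.1 ha.symm
      · right; rw [one_smul] at ha; rw [ha]; abel
    · rintro (h1 | h1)
      · exact ⟨0, by simp [h1]⟩
      · exact ⟨1, by simp [h1]⟩
  · rw [Finset.disjoint_left]
    intro v hv hv'
    simp only [Finset.mem_filter] at hv hv'
    apply hw
    have := hv.2.symm.trans hv'.2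
    simpa using this

open Finset BigOperators in
lemma potential_quot {u ℓ : ℕ} (s : ℝ) (S : Finset (Fin u → ZMod 2)) (h : Lin u (ℓ + 1))
    (w : Fin (ℓ + 1) → ZMod 2) (hw : w ≠ 0) (q : Lin (ℓ + 1) ℓ) (hs : Function.Surjective q)
    (hq : LinearMap.ker q = Submodule.span (ZMod 2) {w}) :
    potential s S (q ∘ₗ h) = 𝔼 y, expLoad s S h y * expLoad s S h (y + w) := by
  unfold potential
  rw [← expect_comp_surj q.toAddMonoidHom hs]
  apply Finset.expect_congr rfl
  intro y _
  simp only [LinearMap.toAddMonoidHom_coe]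
  unfold expLoad
  rw [binLoad_quot S h w hw q hq, ← Real.exp_add]
  push_cast
  ring_nf

open Finset BigOperators in
/-- Expected logarithm of the potential. -/
noncomputable def meanLog (s : ℝ) {u : ℕ} (S : Finset (Fin u → ZMod 2)) (ℓ : ℕ) : ℝ :=
  𝔼 h : Lin u ℓ, Real.log (potential s S h)

open Finset BigOperators in
lemma meanLog_le_shift (s : ℝ) {u : ℕ} (S : Finset (Fin u → ZMod 2)) (ℓ : ℕ)
    (w : Fin (ℓ + 1) → ZMod 2) :
    meanLog s S ℓ ≤ 𝔼 h : Lin u (ℓ + 1),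
      Real.log (𝔼 y, expLoad s S h y * expLoad s S h (y + w)) := by
  have key : ∀ w : Fin (ℓ + 1) → ZMod 2, w ≠ 0 → meanLog s S ℓ = 𝔼 h : Lin u (ℓ + 1),
      Real.log (𝔼 y, expLoad s S h y * expLoad s S h (y + w)) := by
    intro w hw
    obtain ⟨q, hs, hq⟩ := exists_quot w hw
    let φ : Lin u (ℓ + 1) →+ Lin u ℓ :=
      { toFun := fun h => q ∘ₗ h
        map_zero' := by simp
        map_add' := fun a b => LinearMap.comp_add _ _ _ }
    have hφ : Function.Surjective φ := by
      obtain ⟨r, hr⟩ := LinearMap.exists_rightInverse_of_surjective q (LinearMap.range_eq_top.2 hs)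
      intro g
      refine ⟨r ∘ₗ g, ?_⟩
      change q ∘ₗ (r ∘ₗ g) = g
      rw [← LinearMap.comp_assoc, hr, LinearMap.id_comp]
    unfold meanLog
    rw [← expect_comp_surj φ hφ]
    apply Finset.expect_congr rfl
    intro h _
    rw [← potential_quot s S h w hw q hs hq]
    rfl
  by_cases hw : w = 0
  · subst hw
    rw [key (fun _ => 1) (fun h => by simpa using congrFun h 0)]
    apply Finset.expect_le_expect
    intro h _
    apply Real.log_le_log
    · exact Finset.expect_pos (fun y _ => mul_pos (expLoad_pos s S h _) (expLoad_pos s S h _))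
        Finset.univ_nonempty
    · set w : Fin (ℓ + 1) → ZMod 2 := fun _ => 1
      have h2 : 𝔼 y, expLoad s S h (y + w) * expLoad s S h (y + w)
          = 𝔼 y, expLoad s S h y * expLoad s S h y :=
        Fintype.expect_equiv (Equiv.addRight w) _ _ (fun x => rfl)
      have h3 : 𝔼 y, (2 * (expLoad s S h y * expLoad s S h (y + w))) ≤
          𝔼 y, (expLoad s S h y * expLoad s S h y +
            expLoad s S h (y + w) * expLoad s S h (y + w)) := by
        apply Finset.expect_le_expect
        intro y _
        nlinarith [sq_nonneg (expLoad s S h y - expLoad s S h (y + w))]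
      rw [Finset.expect_add_distrib, h2, ← Finset.mul_expect] at h3
      simp only [add_zero]
      linarith
  · exact (key w hw).le

open Finset BigOperators in
lemma meanLog_succ (s : ℝ) {u : ℕ} (S : Finset (Fin u → ZMod 2)) (ℓ : ℕ) :
    meanLog s S ℓ ≤ 2 * meanLog s S (ℓ + 1) := by
  have h1 : meanLog s S ℓ ≤ 𝔼 w : Fin (ℓ + 1) → ZMod 2, 𝔼 h : Lin u (ℓ + 1),
      Real.log (𝔼 y, expLoad s S h y * expLoad s S h (y + w)) := by
    rw [← Finset.expect_const (Finset.univ_nonempty (α := Fin (ℓ + 1) → ZMod 2)) (meanLog s S ℓ)]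
    apply Finset.expect_le_expect
    intro w _
    exact meanLog_le_shift s S ℓ w
  refine h1.trans ?_
  rw [Finset.expect_comm]
  unfold meanLog
  rw [Finset.mul_expect]
  apply Finset.expect_le_expect
  intro h _
  have hp := potential_pos s S h
  set c := potential s S h with hc
  have hX : 𝔼 w, 𝔼 y, expLoad s S h y * expLoad s S h (y + w) = c ^ 2 := by
    rw [Finset.expect_comm]
    have : ∀ y, 𝔼 w, expLoad s S h y * expLoad s S h (y + w) = expLoad s S h y * c := by
      intro y
      rw [← Finset.mul_expect]
      congr 1
      exact Fintype.expect_equiv (Equiv.addLeft y) _ _ (fun x => rfl)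
    simp_rw [this]
    rw [← Finset.expect_mul, sq]
    rfl
  calc 𝔼 w, Real.log (𝔼 y, expLoad s S h y * expLoad s S h (y + w))
      ≤ 𝔼 w, ((𝔼 y, expLoad s S h y * expLoad s S h (y + w)) * (c ^ 2)⁻¹
          + (2 * Real.log c - 1)) := by
        apply Finset.expect_le_expect
        intro w _
        have hpos : 0 < 𝔼 y, expLoad s S h y * expLoad s S h (y + w) :=
          Finset.expect_pos (fun y _ => mul_pos (expLoad_pos s S h _) (expLoad_pos s S h _))
            Finset.univ_nonempty
        have := Real.log_le_sub_one_of_pos (mul_pos hpos (inv_pos.2 (pow_pos hp 2)))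
        rw [Real.log_mul hpos.ne' (inv_pos.2 (pow_pos hp 2)).ne', Real.log_inv, Real.log_pow] at this
        push_cast at this
        linarith
    _ = 2 * Real.log c := by
        rw [Finset.expect_add_distrib, ← Finset.expect_mul, hX,
          Finset.expect_const Finset.univ_nonempty, mul_inv_cancel₀ (pow_pos hp 2).ne']
        ring

lemma meanLog_iter (s : ℝ) {u : ℕ} (S : Finset (Fin u → ZMod 2)) (ℓ k : ℕ) :
    2 ^ ℓ * meanLog s S ℓ ≤ 2 ^ (ℓ + k) * meanLog s S (ℓ + k) := by
  induction k with
  | zero => simp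
  | succ k ih =>
    refine ih.trans ?_
    have := meanLog_succ s S (ℓ + k)
    calc (2 : ℝ) ^ (ℓ + k) * meanLog s S (ℓ + k)
        ≤ 2 ^ (ℓ + k) * (2 * meanLog s S (ℓ + k + 1)) := by gcongr
      _ = _ := by rw [← add_assoc, pow_succ]; ring

open Finset BigOperators in
/-- A nonzero vector is mapped to zero with probability `2^-L`. -/
lemma expect_eval_zero {u : ℕ} (L : ℕ) (x : Fin u → ZMod 2) (hx : x ≠ 0) :
    𝔼 h : Lin u L, (if h x = 0 then (1 : ℝ) else 0) = 1 / 2 ^ L := by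
  let φ : Lin u L →+ (Fin L → ZMod 2) :=
    { toFun := fun h => h x
      map_zero' := by simp
      map_add' := fun a b => rfl }
  have hφ : Function.Surjective φ := by
    intro y
    obtain ⟨i, hi⟩ := Function.ne_iff.1 hx
    refine ⟨(LinearMap.proj i : (Fin u → ZMod 2) →ₗ[ZMod 2] ZMod 2).smulRight ((x i)⁻¹ • y), ?_⟩
    change x i • ((x i)⁻¹ • y) = y
    exact smul_inv_smul₀ hi y
  have := expect_comp_surj φ hφ (fun y => if y = 0 then (1 : ℝ) else 0)
  refine this.trans ?_
  simp [Finset.expect_eq_sum_div_card]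

open Finset BigOperators in
lemma sum_expLoad_sub_one {u L : ℕ} (s : ℝ) (S : Finset (Fin u → ZMod 2)) (h : Lin u L) :
    ∑ y, (expLoad s S h y - 1) = ∑ y ∈ S.image h, (expLoad s S h y - 1) := by
  symm
  apply Finset.sum_subset (Finset.subset_univ _)
  intro y _ hy
  have : binLoad S h y = 0 := by
    unfold binLoad
    rw [Finset.card_eq_zero, Finset.filter_eq_empty_iff]
    intro v hv hvy
    exact hy (Finset.mem_image.2 ⟨v, hv, hvy⟩)
  simp [expLoad, this]

open Finset BigOperators in
lemma log_potential_le {u L : ℕ} (s : ℝ) (hs : 0 ≤ s) (S : Finset (Fin u → ZMod 2))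
    (h : Lin u L) :
    2 ^ L * Real.log (potential s S h) ≤ S.card * (Real.exp s - 1) +
      (S.card * Real.exp (s * S.card)) *
        ∑ p ∈ S.offDiag, (if h (p.1 - p.2) = 0 then (1 : ℝ) else 0) := by
  classical
  have h1 : (2 : ℝ) ^ L * Real.log (potential s S h) ≤ ∑ y, (expLoad s S h y - 1) := by
    have := Real.log_le_sub_one_of_pos (potential_pos s S h)
    have h2 : (2 : ℝ) ^ L * (potential s S h - 1) = ∑ y, (expLoad s S h y - 1) := by
      unfold potential
      rw [Finset.expect_eq_sum_div_card, Finset.sum_sub_distrib]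
      simp
      field_simp
    rw [← h2]
    gcongr
  refine h1.trans ?_
  rw [sum_expLoad_sub_one]
  have hes : 0 ≤ Real.exp s - 1 := by linarith [Real.one_le_exp hs]
  have hcard : ((S.image h).card : ℝ) ≤ S.card := by exact_mod_cast Finset.card_image_le
  by_cases hinj : Set.InjOn h S
  · have hb : ∀ y ∈ S.image h, expLoad s S h y - 1 ≤ Real.exp s - 1 := by
      intro y _
      have : binLoad S h y ≤ 1 := by
        unfold binLoad
        rw [Finset.card_le_one]
        intro a ha b hb
        simp only [Finset.mem_filter] at ha hb
        exact hinj ha.1 hb.1 (ha.2.trans hb.2.symm)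
      have h2 : (binLoad S h y : ℝ) ≤ 1 := by exact_mod_cast this
      unfold expLoad
      have : s * binLoad S h y ≤ s := by nlinarith
      linarith [Real.exp_le_exp.2 this]
    have := Finset.sum_le_card_nsmul _ _ _ hb
    rw [nsmul_eq_mul] at this
    have h4 : 0 ≤ (S.card * Real.exp (s * S.card)) *
        ∑ p ∈ S.offDiag, (if h (p.1 - p.2) = 0 then (1 : ℝ) else 0) := by
      apply mul_nonneg (by positivity)
      exact Finset.sum_nonneg (fun p _ => by split_ifs <;> norm_num)
    nlinarith
  · have hb : ∀ y ∈ S.image h, expLoad s S h y - 1 ≤ Real.exp (s * S.card) := by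
      intro y _
      have h2 : (binLoad S h y : ℝ) ≤ S.card := by exact_mod_cast Finset.card_filter_le _ _
      unfold expLoad
      have : s * binLoad S h y ≤ s * S.card := by gcongr
      linarith [Real.exp_le_exp.2 this]
    have := Finset.sum_le_card_nsmul _ _ _ hb
    rw [nsmul_eq_mul] at this
    have h5 : (1 : ℝ) ≤ ∑ p ∈ S.offDiag, (if h (p.1 - p.2) = 0 then (1 : ℝ) else 0) := by
      unfold Set.InjOn at hinj
      push Not at hinj
      obtain ⟨a, ha, b, hb, hab, hne⟩ := hinj
      have hmem : (a, b) ∈ S.offDiag := Finset.mem_offDiag.2 ⟨ha, hb, hne⟩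
      have := Finset.single_le_sum (f := fun p : (Fin u → ZMod 2) × (Fin u → ZMod 2) =>
        if h (p.1 - p.2) = 0 then (1 : ℝ) else 0)
        (fun p _ => by split_ifs <;> norm_num) hmem
      simpa [hab] using this
    have h6 : ((S.image h).card : ℝ) * Real.exp (s * S.card) ≤ S.card * Real.exp (s * S.card) := by
      gcongr
    have h7 : (S.card : ℝ) * Real.exp (s * S.card) * 1 ≤ (S.card * Real.exp (s * S.card)) *
        ∑ p ∈ S.offDiag, (if h (p.1 - p.2) = 0 then (1 : ℝ) else 0) := by gcongr
    have h8 : 0 ≤ (S.card : ℝ) * (Real.exp s - 1) := by positivity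
    linarith

open Finset BigOperators in
lemma meanLog_large {u : ℕ} (s : ℝ) (hs : 0 ≤ s) (S : Finset (Fin u → ZMod 2)) (L : ℕ) :
    2 ^ L * meanLog s S L ≤ S.card * (Real.exp s - 1) +
      (S.card * Real.exp (s * S.card)) * S.offDiag.card * (1 / 2) ^ L := by
  unfold meanLog
  rw [Finset.mul_expect]
  refine (Finset.expect_le_expect (fun h _ => log_potential_le s hs S h)).trans ?_
  rw [Finset.expect_add_distrib, Finset.expect_const Finset.univ_nonempty, ← Finset.mul_expect,
    Finset.expect_sum_comm]
  rw [Finset.sum_congr rfl (fun p hp => expect_eval_zero L (p.1 - p.2)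
    (sub_ne_zero.2 (Finset.mem_offDiag.1 hp).2.2))]
  rw [Finset.sum_const, nsmul_eq_mul, one_div_pow]
  apply le_of_eq
  ring

lemma meanLog_bound {u : ℕ} (s : ℝ) (hs : 0 ≤ s) (S : Finset (Fin u → ZMod 2)) (ℓ : ℕ) :
    2 ^ ℓ * meanLog s S ℓ ≤ S.card * (Real.exp s - 1) := by
  have hlim : Filter.Tendsto (fun k : ℕ => S.card * (Real.exp s - 1) +
      (S.card * Real.exp (s * S.card)) * S.offDiag.card * (1 / 2 : ℝ) ^ (k + ℓ)) Filter.atTop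
      (nhds (S.card * (Real.exp s - 1) +
        (S.card * Real.exp (s * S.card)) * S.offDiag.card * 0)) := by
    apply Filter.Tendsto.const_add
    apply Filter.Tendsto.const_mul
    exact (tendsto_pow_atTop_nhds_zero_of_lt_one (by norm_num) (by norm_num)).comp
      (Filter.tendsto_add_atTop_nat ℓ)
  rw [mul_zero, add_zero] at hlim
  refine ge_of_tendsto' hlim (fun k => ?_)
  rw [add_comm k ℓ]
  exact (meanLog_iter s S ℓ k).trans (meanLog_large s hs S (ℓ + k))

lemma maxLoad_le {u ℓ : ℕ} (s : ℝ) (S : Finset (Fin u → ZMod 2)) (h : Lin u ℓ) :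
    s * maxLoad u ℓ S h ≤ Real.log (2 ^ ℓ) + Real.log (potential s S h) := by
  obtain ⟨y, _, hy⟩ := Finset.exists_mem_eq_sup (Finset.univ : Finset (Fin ℓ → ZMod 2))
    Finset.univ_nonempty (fun y => (S.filter fun v => h v = y).card)
  have hM : maxLoad u ℓ S h = binLoad S h y := hy
  rw [hM, ← Real.log_mul (by positivity) (potential_pos s S h).ne',
    Real.le_log_iff_exp_le (mul_pos (by positivity) (potential_pos s S h))]
  have h2 : (2 : ℝ) ^ ℓ * potential s S h = ∑ y, expLoad s S h y := by
    unfold potential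
    rw [Finset.expect_eq_sum_div_card]
    simp
    field_simp
  rw [h2]
  exact Finset.single_le_sum (f := expLoad s S h) (fun y _ => (expLoad_pos s S h y).le)
    (Finset.mem_univ y)

/-- For every ε > 0 there exists ρ_0 > 0 such that the following holds. Let
n = 2^ℓ, let S ⊆ F_2^u have size m with u ≥ ℓ, set λ = m/n, and let t > 0 be the real number
defined by t · ln(t/(e·λ)) = ln n. If t/λ ≥ ρ_0, then the expected maximum load of a uniformly
random linear map h : F_2^u → F_2^ℓ satisfies E_h[M(S,h)] ≤ (1 + ε) t. -/
theorem stmt_19 (ε : ℝ) (hε : 0 < ε) :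
    ∃ ρ₀ > (0 : ℝ),
      ∀ (ℓ u : ℕ), ℓ ≤ u →
      ∀ (S : Finset (Fin u → ZMod 2)) (m n : ℕ), S.card = m → n = 2 ^ ℓ →
      ∀ lam : ℝ, lam = (m : ℝ) / n →
      ∀ t : ℝ, 0 < t → t * Real.log (t / (Real.exp 1 * lam)) = Real.log n →
      ρ₀ ≤ t / lam →
      (∑ h : Lin u ℓ, (maxLoad u ℓ S h : ℝ)) / (Fintype.card (Lin u ℓ) : ℝ) ≤
        (1 + ε) * t := by
  refine ⟨3, by norm_num, ?_⟩
  intro ℓ u _ S m n hm hn lam hlam t ht heq hρ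
  have hlam0 : 0 < lam := by
    by_contra hneg
    have : t / lam ≤ 0 := div_nonpos_of_nonneg_of_nonpos ht.le (not_lt.1 hneg)
    linarith
  have hr : 0 < t / lam := div_pos ht hlam0
  set s := Real.log (t / lam) with hs_def
  have hs : 0 < s := Real.log_pos (by linarith)
  have hexp : Real.exp s = t / lam := Real.exp_log hr
  have hlog : Real.log (t / (Real.exp 1 * lam)) = s - 1 := by
    have : t / (Real.exp 1 * lam) = (t / lam) / Real.exp 1 := by
      field_simp
    rw [this, Real.log_div hr.ne' (Real.exp_pos 1).ne', Real.log_exp]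
  rw [hlog] at heq
  have hn' : (n : ℝ) = 2 ^ ℓ := by rw [hn]; push_cast; rfl
  have hb := meanLog_bound s hs.le S ℓ
  have hA : meanLog s S ℓ ≤ t := by
    have h2 : (0 : ℝ) < 2 ^ ℓ := by positivity
    have hm' : (S.card : ℝ) = lam * 2 ^ ℓ := by
      rw [hlam, hm, hn']; field_simp
    rw [hm', hexp] at hb
    have h3 : lam * 2 ^ ℓ * (t / lam - 1) = 2 ^ ℓ * (t - lam) := by field_simp
    rw [h3] at hb
    have := le_of_mul_le_mul_left hb h2
    linarith
  have hE : s * Finset.expect Finset.univ (fun h : Lin u ℓ => (maxLoad u ℓ S h : ℝ)) ≤ s * t := by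
    rw [Finset.mul_expect]
    refine (Finset.expect_le_expect (fun h _ => maxLoad_le s S h)).trans ?_
    rw [Finset.expect_add_distrib, Finset.expect_const Finset.univ_nonempty, ← hn', ← heq]
    change t * (s - 1) + meanLog s S ℓ ≤ s * t
    linarith
  have hfin := le_of_mul_le_mul_left hE hs
  rw [Finset.expect_eq_sum_div_card, Finset.card_univ] at hfin
  refine hfin.trans ?_
  nlinarith [mul_pos hε ht]
end
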